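/- arXiv:1209.6008 — 6 statements merged into one kernel-verified Lean document; each statement's English description precedes it below -/
import Mathlib

section
/- Let p be a prime and F_q a finite field of characteristic p. A sequence u : ℕ → F_q is p-automatic if and only if there exist d ≥ 1, radii l, r ≥ 0, coefficients f_{j,i} ∈ F_q (for −l ≤ j ≤ r and 1 ≤ i ≤ d), initial rows R_0, …, R_{d−1} : ℤ → F_q each eventually periodic in both directions, and a column index m₀ ∈ ℤ, such that the spacetime diagram (R_n)_{n≥0} of the corresponding linear cellular automaton with memory d satisfies R_n(m₀) = u(n) for all n ≥ 0. -/
/-- A sequence `u : ℕ → A` is `k`-automatic: there is a DFAO (finite state set `S`,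
initial state `s₀`, transition function `δ`, output function `ω`) such that `u n` is
obtained by feeding the base-`k` digits of `n` (least significant first) to the automaton. -/
def IsKAutomatic (k : ℕ) {A : Type*} (u : ℕ → A) : Prop :=
  ∃ (S : Type) (_ : Fintype S) (s₀ : S) (δ : S → ℕ → S) (ω : S → A),
    ∀ n : ℕ, u n = ω ((Nat.digits k n).foldl δ s₀)

/-- A configuration `R : ℤ → B` is eventually periodic in both directions. -/
def EventuallyPeriodicBoth {B : Type*} (R : ℤ → B) : Prop :=
  ∃ (N per : ℕ), 1 ≤ per ∧
    (∀ m : ℤ, (N : ℤ) ≤ m → R (m + per) = R m) ∧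
    (∀ m : ℤ, m ≤ -(N : ℤ) → R (m - per) = R m)


section Backward

variable {F : Type*} [Field F]

/-- Translation operators on functions on the lattice. -/
def latticeShift : Multiplicative (ℤ × ℤ) →* Module.End F (ℤ × ℤ → F) where
  toFun a := { toFun := fun v x => v (x + a.toAdd), map_add' := fun _ _ => rfl,
               map_smul' := fun _ _ => rfl }
  map_one' := by ext v x; simp
  map_mul' a b := by
    refine LinearMap.ext fun v => funext fun x => ?_
    simp [add_assoc]

/-- The operator associated to a linear CA with memory. -/
noncomputable def caOp (d l r : ℕ) (f : ℤ → ℕ → F) : AddMonoidAlgebra F (ℤ × ℤ) :=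
  1 - ∑ i ∈ Finset.Icc 1 d, ∑ j ∈ Finset.Icc (-(l : ℤ)) (r : ℤ),
    AddMonoidAlgebra.single (-(i : ℤ), j) (f j i)

lemma caOp_apply (d l r : ℕ) (f : ℤ → ℕ → F) (v : ℤ × ℤ → F) (n m : ℤ) :
    (AddMonoidAlgebra.lift F _ _ latticeShift (caOp d l r f)) v (n, m) =
      v (n, m) - ∑ i ∈ Finset.Icc 1 d, ∑ j ∈ Finset.Icc (-(l : ℤ)) (r : ℤ),
        f j i * v (n - i, m + j) := by
  simp [caOp, map_sum, latticeShift, sub_eq_add_neg]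

lemma caOp_pow (p : ℕ) [Fact p.Prime] [CharP F p] (d l r : ℕ) (f : ℤ → ℕ → F)
    (v : ℤ × ℤ → F) (n m : ℤ) :
    (AddMonoidAlgebra.lift F _ _ latticeShift (caOp d l r f ^ p)) v (n, m) =
      v (n, m) - ∑ i ∈ Finset.Icc 1 d, ∑ j ∈ Finset.Icc (-(l : ℤ)) (r : ℤ),
        f j i ^ p * v (n - p * i, m + p * j) := by
  have : CharP (AddMonoidAlgebra F (ℤ × ℤ)) p :=
    charP_of_injective_algebraMap (algebraMap F (AddMonoidAlgebra F (ℤ × ℤ))).injective p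
  have h : caOp d l r f ^ p = 1 - ∑ i ∈ Finset.Icc 1 d, ∑ j ∈ Finset.Icc (-(l : ℤ)) (r : ℤ),
    AddMonoidAlgebra.single (p • (-(i : ℤ), j)) (f j i ^ p) := by
    rw [caOp, sub_pow_char, one_pow, sum_pow_char]
    congr 1
    refine Finset.sum_congr rfl fun i _ => ?_
    rw [sum_pow_char]
    refine Finset.sum_congr rfl fun j _ => ?_
    rw [AddMonoidAlgebra.single_pow]
  rw [h]
  simp [map_sum, latticeShift, sub_eq_add_neg]

lemma frob_rel (p : ℕ) [hp : Fact p.Prime] [CharP F p] (d l r : ℕ) (f : ℤ → ℕ → F)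
    (G : ℕ → ℤ → F)
    (hG : ∀ n, d ≤ n → ∀ m : ℤ,
          G n m = ∑ i ∈ Finset.Icc 1 d, ∑ j ∈ Finset.Icc (-(l : ℤ)) (r : ℤ),
            f j i * G (n - i) (m + j)) (n c : ℕ) (hn : d ≤ n) (m : ℤ) :
    G (p * n + c) (p * m) = ∑ i ∈ Finset.Icc 1 d, ∑ j ∈ Finset.Icc (-(l : ℤ)) (r : ℤ),
            f j i ^ p * G (p * (n - i) + c) (p * (m + j)) := by
  set v : ℤ × ℤ → F := fun x => G x.1.toNat x.2 with hv
  have key : ∀ k : ℕ, ∀ n m : ℤ, ((k + 1) * d : ℤ) ≤ n →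
      (AddMonoidAlgebra.lift F _ _ latticeShift (caOp d l r f ^ (k + 1))) v (n, m) = 0 := by
    intro k
    induction k with
    | zero =>
      intro n m h
      lift n to ℕ using (by
        have : (0:ℤ) ≤ d := by positivity
        push_cast at h
        linarith)
      rw [zero_add, pow_one, caOp_apply, sub_eq_zero]
      simp only [hv]
      rw [Int.toNat_natCast, hG n (by push_cast at h; linarith)]
      refine Finset.sum_congr rfl fun i hi => Finset.sum_congr rfl fun j _ => ?_
      have : ((n : ℤ) - (i : ℤ)).toNat = n - i := by omega
      rw [this]
    | succ k ih =>
      intro n m h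
      rw [pow_succ', map_mul, Module.End.mul_apply, caOp_apply]
      push_cast at h
      rw [ih n m (by nlinarith)]
      rw [zero_sub, neg_eq_zero]
      refine Finset.sum_eq_zero fun i hi => Finset.sum_eq_zero fun j _ => ?_
      rw [ih, mul_zero]
      have := (Finset.mem_Icc.mp hi).2
      have : (i : ℤ) ≤ d := by exact_mod_cast this
      nlinarith
  have h1 := key (p - 1) (p * n + c) (p * m) (by
    have h0 : ((p - 1 : ℕ) : ℤ) + 1 = p := by have := hp.out.pos; omega
    rw [h0]
    have : (d : ℤ) ≤ n := by exact_mod_cast hn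
    nlinarith)
  rw [Nat.sub_add_cancel hp.out.pos, caOp_pow, sub_eq_zero] at h1
  simp only [hv] at h1
  have e1 : ((p : ℤ) * n + c).toNat = p * n + c := by
    rw [← Nat.cast_mul, ← Nat.cast_add, Int.toNat_natCast]
  rw [e1] at h1
  rw [h1]
  refine Finset.sum_congr rfl fun i hi => Finset.sum_congr rfl fun j _ => ?_
  have hi' := (Finset.mem_Icc.mp hi).2
  have e2 : ((p : ℤ) * n + c - p * i).toNat = p * (n - i) + c := by
    have : ((p : ℤ) * n + c - p * i) = ((p * (n - i) + c : ℕ) : ℤ) := by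
      push_cast [Nat.cast_sub (hi'.trans hn)]; ring
    rw [this, Int.toNat_natCast]
  rw [e2, mul_add]

/-- Eventually periodic with explicit threshold and period. -/
def EPB {B : Type*} (T per : ℕ) (R : ℤ → B) : Prop :=
  (∀ m : ℤ, (T : ℤ) ≤ m → R (m + per) = R m) ∧ (∀ m : ℤ, m ≤ -(T : ℤ) → R (m - per) = R m)

lemma EPB.mul_per {B : Type*} {T per : ℕ} {R : ℤ → B} (h : EPB T per R) (k : ℕ) :
    EPB T (per * k) R := by
  constructor
  · intro m hm
    induction k with
    | zero => simp
    | succ k ih =>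
      have : m + ((per * (k + 1) : ℕ) : ℤ) = (m + (per * k : ℕ)) + per := by push_cast; ring
      rw [this, h.1, ih]
      have : (0 : ℤ) ≤ ((per * k : ℕ) : ℤ) := by positivity
      linarith
  · intro m hm
    induction k with
    | zero => simp
    | succ k ih =>
      have : m - ((per * (k + 1) : ℕ) : ℤ) = (m - (per * k : ℕ)) - per := by push_cast; ring
      rw [this, h.2, ih]
      have : (0 : ℤ) ≤ ((per * k : ℕ) : ℤ) := by positivity
      linarith

lemma EPB.mono {B : Type*} {T T' per : ℕ} {R : ℤ → B} (h : EPB T per R) (hT : T ≤ T') :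
    EPB T' per R := by
  have : (T : ℤ) ≤ T' := by exact_mod_cast hT
  exact ⟨fun m hm => h.1 m (by linarith), fun m hm => h.2 m (by linarith)⟩

lemma EPB.ext {B : Type*} {T per : ℕ} (hper : 1 ≤ per) {R R' : ℤ → B} (h : EPB T per R)
    (h' : EPB T per R') (hh : ∀ m ∈ Finset.Icc (-((T + per : ℕ) : ℤ)) ((T + per : ℕ) : ℤ), R m = R' m) :
    R = R' := by
  have key : ∀ k : ℕ, ∀ m : ℤ, m.natAbs ≤ k → R m = R' m := by
    intro k
    induction k with
    | zero => 
      intro m hm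
      apply hh; rw [Finset.mem_Icc]; omega
    | succ k ih =>
      intro m hm
      by_cases hb : m.natAbs ≤ T + per
      · apply hh; rw [Finset.mem_Icc]; omega
      · rcases le_total 0 m with h0 | h0
        · have e : m = (m - per) + per := by ring
          rw [e, h.1 _ (by omega), h'.1 _ (by omega)]
          exact ih _ (by omega)
        · have e : m = (m + per) - per := by ring
          rw [e, h.2 _ (by omega), h'.2 _ (by omega)]
          exact ih _ (by omega)
  exact funext fun m => key _ m le_rfl

lemma rows_EPB (d l r T per : ℕ) (f : ℤ → ℕ → F)
    (G : ℕ → ℤ → F)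
    (hG : ∀ n, d ≤ n → ∀ m : ℤ,
          G n m = ∑ i ∈ Finset.Icc 1 d, ∑ j ∈ Finset.Icc (-(l : ℤ)) (r : ℤ),
            f j i * G (n - i) (m + j))
    (h0 : ∀ n, n < d → EPB T per (G n)) (n : ℕ) : EPB (T + n * (l + r)) per (G n) := by
  induction n using Nat.strong_induction_on with
  | _ n ih =>
    by_cases hn : n < d
    · exact (h0 n hn).mono (by nlinarith)
    · push Not at hn
      have hb : ∀ i ∈ Finset.Icc 1 d, EPB (T + (n - 1) * (l + r)) per (G (n - i)) := by
        intro i hi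
        rw [Finset.mem_Icc] at hi
        refine (ih (n - i) (by omega)).mono ?_
        have : (n - i) * (l + r) ≤ (n - 1) * (l + r) := Nat.mul_le_mul_right _ (by omega)
        omega
      have hlr : ∀ i ∈ Finset.Icc 1 d,
          (T + n * (l + r) : ℤ) = ((T + (n - 1) * (l + r) : ℕ) : ℤ) + (l + r) := by
        intro i hi
        rw [Finset.mem_Icc] at hi
        obtain ⟨n, rfl⟩ : ∃ k, n = k + 1 := ⟨n - 1, by omega⟩
        push_cast [Nat.add_sub_cancel]
        ring
      constructor
      · intro m hm
        rw [hG n hn, hG n hn]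
        refine Finset.sum_congr rfl fun i hi => Finset.sum_congr rfl fun j hj => ?_
        have := hlr i hi
        rw [Finset.mem_Icc] at hj
        push_cast at hm
        rw [show m + per + j = (m + j) + per by ring, (hb i hi).1 _ (by linarith)]
      · intro m hm
        rw [hG n hn, hG n hn]
        refine Finset.sum_congr rfl fun i hi => Finset.sum_congr rfl fun j hj => ?_
        have := hlr i hi
        rw [Finset.mem_Icc] at hj
        push_cast at hm
        rw [show m - per + j = (m + j) - per by ring, (hb i hi).2 _ (by linarith)]

/-- A finite family of spacetime diagrams, closed under decimation. -/
def CASet (F : Type*) [Field F] (d l r T per : ℕ) : Set (ℕ → ℤ → F) :=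
  {G | (∃ f : ℤ → ℕ → F, ∀ n, d ≤ n → ∀ m : ℤ,
          G n m = ∑ i ∈ Finset.Icc 1 d, ∑ j ∈ Finset.Icc (-(l : ℤ)) (r : ℤ),
            f j i * G (n - i) (m + j)) ∧ ∀ n, n < d → EPB T per (G n)}

lemma CASet_finite [Fintype F] (d l r T per : ℕ) (hper : 1 ≤ per) :
    (CASet F d l r T per).Finite := by
  have hf : ∀ G : CASet F d l r T per, ∃ f : ℤ → ℕ → F, ∀ n, d ≤ n → ∀ m : ℤ,
          G.1 n m = ∑ i ∈ Finset.Icc 1 d, ∑ j ∈ Finset.Icc (-(l : ℤ)) (r : ℤ),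
            f j i * G.1 (n - i) (m + j) := fun G => G.2.1
  choose f hf using hf
  let Φ : CASet F d l r T per →
    ((Finset.Icc (-(l : ℤ)) (r : ℤ) → Finset.Icc 1 d → F) ×
      (Finset.range d → Finset.Icc (-((T + per : ℕ) : ℤ)) ((T + per : ℕ) : ℤ) → F)) :=
    fun G => (fun j i => f G j.1 i.1, fun n m => G.1 n.1 m.1)
  have hinj : Function.Injective Φ := by
    intro G G' hGG
    have e1 : ∀ j ∈ Finset.Icc (-(l : ℤ)) (r : ℤ), ∀ i ∈ Finset.Icc 1 d, f G j i = f G' j i :=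
      fun j hj i hi => congrFun (congrFun (congrArg Prod.fst hGG) ⟨j, hj⟩) ⟨i, hi⟩
    have e2 : ∀ n ∈ Finset.range d,
        ∀ m ∈ Finset.Icc (-((T + per : ℕ) : ℤ)) ((T + per : ℕ) : ℤ), G.1 n m = G'.1 n m :=
      fun n hn m hm => congrFun (congrFun (congrArg Prod.snd hGG) ⟨n, hn⟩) ⟨m, hm⟩
    apply Subtype.ext
    funext n
    induction n using Nat.strong_induction_on with
    | _ n ih =>
      by_cases hn : n < d
      · exact EPB.ext hper (G.2.2 n hn) (G'.2.2 n hn) (e2 n (Finset.mem_range.mpr hn))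
      · push Not at hn
        funext m
        rw [hf G n hn, hf G' n hn]
        refine Finset.sum_congr rfl fun i hi => Finset.sum_congr rfl fun j hj => ?_
        rw [e1 j hj i hi, ih (n - i)]
        rw [Finset.mem_Icc] at hi
        omega
  exact Set.finite_coe_iff.mp (Finite.of_injective Φ hinj)

lemma CASet_decimate (p : ℕ) [hp : Fact p.Prime] [CharP F p] (d l r T per : ℕ)
    (hT : 2 * d * (l + r) ≤ T) (G : ℕ → ℤ → F) (hG : G ∈ CASet F d l r T per) (c : ℕ)
    (hc : c < p) : (fun n m => G (p * n + c) (p * m)) ∈ CASet F d l r T per := by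
  obtain ⟨⟨f, hf⟩, h0⟩ := hG
  refine ⟨⟨fun j i => f j i ^ p, fun n hn m => frob_rel p d l r f G hf n c hn m⟩, ?_⟩
  intro n hn
  have hE := (rows_EPB d l r T per f G hf h0 (p * n + c)).mul_per p
  have hp2 := hp.out.two_le
  have hb : T + (p * n + c) * (l + r) ≤ p * T := by
    have h1 : p * n + c ≤ p * d := by nlinarith
    have h2 : (p * n + c) * (l + r) ≤ p * d * (l + r) := Nat.mul_le_mul_right _ h1
    obtain ⟨k, rfl⟩ := Nat.exists_eq_add_of_le hp2
    nlinarith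
  have hb' : ((T + (p * n + c) * (l + r) : ℕ) : ℤ) ≤ p * T := by exact_mod_cast hb
  have hp0 : (0 : ℤ) < p := by exact_mod_cast hp.out.pos
  constructor
  · intro m hm
    have := hE.1 (p * m) (by nlinarith)
    simp only
    rw [← this]
    congr 1; push_cast; ring
  · intro m hm
    have := hE.2 (p * m) (by nlinarith)
    simp only
    rw [← this]
    congr 1; push_cast; ring

lemma automatic_of_CASet [Fintype F] (p : ℕ) [hp : Fact p.Prime] [CharP F p] (d l r T per : ℕ)
    (hper : 1 ≤ per) (hT : 2 * d * (l + r) ≤ T) (G : ℕ → ℤ → F)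
    (hG : G ∈ CASet F d l r T per) : IsKAutomatic p (fun n => G n 0) := by
  have hfin : Finite (CASet F d l r T per) := CASet_finite d l r T per hper
  obtain ⟨N, ⟨e⟩⟩ := Finite.exists_equiv_fin (CASet F d l r T per)
  let δ : CASet F d l r T per → ℕ → CASet F d l r T per := fun H c =>
    ⟨_, CASet_decimate p d l r T per hT H.1 H.2 (c % p) (Nat.mod_lt _ hp.out.pos)⟩
  refine ⟨Fin N, inferInstance, e ⟨G, hG⟩, fun s c => e (δ (e.symm s) c),
    fun s => (e.symm s).1 0 0, ?_⟩
  have key : ∀ n : ℕ, ∀ H : CASet F d l r T per,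
      H.1 n 0 = (e.symm ((Nat.digits p n).foldl (fun s c => e (δ (e.symm s) c)) (e H))).1 0 0 := by
    intro n
    induction n using Nat.strong_induction_on with
    | _ n ih =>
      intro H
      rcases Nat.eq_zero_or_pos n with rfl | hn
      · simp
      · rw [Nat.digits_def' hp.out.one_lt hn, List.foldl_cons]
        simp only [Equiv.symm_apply_apply]
        rw [← ih (n / p) (Nat.div_lt_self hn hp.out.one_lt)]
        simp only [δ, Nat.mod_mod, mul_zero]
        rw [Nat.div_add_mod]
  exact fun n => key n ⟨G, hG⟩

lemma automatic_of_column [Fintype F] (p : ℕ) [hp : Fact p.Prime] [CharP F p] (u : ℕ → F)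
    (h : ∃ (d l r : ℕ) (f : ℤ → ℕ → F) (R : ℕ → ℤ → F) (m₀ : ℤ),
        1 ≤ d ∧
        (∀ i, i < d → EventuallyPeriodicBoth (R i)) ∧
        (∀ n, d ≤ n → ∀ m : ℤ,
          R n m = ∑ i ∈ Finset.Icc 1 d, ∑ j ∈ Finset.Icc (-(l : ℤ)) (r : ℤ),
            f j i * R (n - i) (m + j)) ∧
        (∀ n, R n m₀ = u n)) : IsKAutomatic p u := by
  obtain ⟨d, l, r, f, R, m₀, -, hE, hR, hu⟩ := h
  choose! N per hper h1 h2 using hE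
  have hu' : u = fun n => (fun n m => R n (m + m₀)) n 0 := by
    funext n; simp [hu]
  rw [hu']
  refine automatic_of_CASet p d l r (2 * d * (l + r) + (∑ i ∈ Finset.range d, N i) + m₀.natAbs)
    (∏ i ∈ Finset.range d, per i) ?_ (by omega) (fun n m => R n (m + m₀)) ⟨⟨f, ?_⟩, ?_⟩
  · exact Finset.one_le_prod' (fun i hi => hper i (Finset.mem_range.mp hi))
  · intro n hn m
    simp only
    rw [hR n hn]
    refine Finset.sum_congr rfl fun i hi => Finset.sum_congr rfl fun j hj => ?_
    congr 2; ring
  · intro n hn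
    have hmem := Finset.mem_range.mpr hn
    obtain ⟨k, hk⟩ := Finset.dvd_prod_of_mem per hmem
    have hN : N n ≤ ∑ i ∈ Finset.range d, N i :=
      Finset.single_le_sum (f := N) (fun _ _ => Nat.zero_le _) hmem
    rw [hk]
    have hb : EPB (N n) (per n) (R n) := ⟨h1 n hn, h2 n hn⟩
    have hb := hb.mul_per k
    generalize per n * k = P at *
    generalize hX : 2 * d * (l + r) = X
    constructor
    · intro m hm
      simp only
      rw [← hb.1 (m + m₀) (by omega)]
      congr 1; ring
    · intro m hm
      simp only
      rw [← hb.2 (m + m₀) (by omega)]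
      congr 1; ring

end Backward

section ForwardOre

open PowerSeries

lemma coeff_pow_frob {R : Type*} [CommRing R] (p e : ℕ) [Fact p.Prime] [CharP R p] (f : R⟦X⟧)
    (n : ℕ) :
    coeff n (f ^ p ^ e) = if p ^ e ∣ n then coeff (n / p ^ e) f ^ p ^ e else 0 := by
  have hp0 : p ≠ 0 := (Fact.out : p.Prime).ne_zero
  have h : PowerSeries.map (iterateFrobenius R p e) (expand (p ^ e) (pow_ne_zero e hp0) f)
      = f ^ p ^ e :=
    MvPowerSeries.map_iterateFrobenius_expand p hp0 f e
  rw [← h, PowerSeries.coeff_map, coeff_expand]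
  split_ifs
  · simp [iterateFrobenius_def]
  · simp

variable {F : Type*} [Field F] [Fintype F]

lemma coeff_pow_card (p e : ℕ) [Fact p.Prime] [CharP F p]
    (hq : Fintype.card F = p ^ e) (f : F⟦X⟧) (n : ℕ) :
    coeff n (f ^ p ^ e) = if p ^ e ∣ n then coeff (n / p ^ e) f else 0 := by
  rw [coeff_pow_frob, ← hq, FiniteField.pow_card]

lemma pow_card_eq_expand (p e : ℕ) [hp : Fact p.Prime] [CharP F p]
    (hq : Fintype.card F = p ^ e) (f : F⟦X⟧) (k : ℕ) :
    f ^ (p ^ e) ^ k = expand (p ^ (e * k)) (pow_ne_zero _ hp.out.ne_zero) f := by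
  ext n
  rw [← pow_mul, coeff_pow_frob, coeff_expand]
  congr 1
  rw [pow_mul, ← hq, FiniteField.pow_card_pow]

lemma polySmul_eq {F : Type*} [Field F] (a : Polynomial F) (g : F⟦X⟧) :
    a • g = (a : F⟦X⟧) * g := by
  rw [Algebra.smul_def]
  congr 1

/-- generating function attached to a state -/
noncomputable def stateSeries {F S : Type*} [Field F] (p : ℕ) (δ : S → ℕ → S) (ω : S → F)
    (s : S) : F⟦X⟧ := PowerSeries.mk fun n => ω ((Nat.digits p n).foldl δ s)

lemma stateSeries_eq {F S : Type*} [Field F] (p : ℕ) (hp : 1 < p) (δ : S → ℕ → S) (ω : S → F)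
    (s : S) : stateSeries p δ ω s = C (ω s - ω (δ s 0)) +
      ∑ r ∈ Finset.range p, X ^ r * expand p (by omega) (stateSeries p δ ω (δ s r)) := by
  ext n
  rw [map_add, map_sum]
  have h1 : ∀ r ∈ Finset.range p, r ≠ n % p →
      coeff n (X ^ r * expand p (by omega) (stateSeries p δ ω (δ s r))) = 0 := by
    intro r hr hne
    rw [Finset.mem_range] at hr
    rw [coeff_X_pow_mul']
    split_ifs with hle
    · rw [coeff_expand, if_neg]
      rintro ⟨c, hc⟩
      apply hne
      have : n = r + p * c := by omega
      rw [this, Nat.add_mul_mod_self_left, Nat.mod_eq_of_lt hr]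
    · rfl
  rw [Finset.sum_eq_single_of_mem (n % p) (Finset.mem_range.mpr (Nat.mod_lt _ (by omega))) h1]
  rw [coeff_X_pow_mul', if_pos (Nat.mod_le _ _), coeff_expand]
  have h2 : n - n % p = p * (n / p) := by have := Nat.div_add_mod n p; omega
  rw [h2, if_pos (Dvd.intro _ rfl), Nat.mul_div_cancel_left _ (by omega)]
  rw [stateSeries, stateSeries, coeff_mk, coeff_mk, coeff_C]
  rcases Nat.eq_zero_or_pos n with rfl | hn
  · simp
  · rw [if_neg (by omega), zero_add, Nat.digits_def' hp hn, List.foldl_cons]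

lemma ore_exists (p e : ℕ) [hp : Fact p.Prime] [CharP F p]
    (hq : Fintype.card F = p ^ e) (u : ℕ → F) (hu : IsKAutomatic p u) :
    ∃ (K : ℕ) (A : ℕ → Polynomial F), (∃ k < K, A k ≠ 0) ∧
      ∑ k ∈ Finset.range K, (A k : F⟦X⟧) * (PowerSeries.mk u) ^ (p ^ e) ^ k = 0 := by
  classical
  obtain ⟨S, _, s₀, δ, ω, hω⟩ := hu
  have hp0 := hp.out.ne_zero
  set U := stateSeries p δ ω with hU
  have hu : PowerSeries.mk u = U s₀ := by
    ext n; simp [hU, stateSeries, hω]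
  rw [hu]
  let g : ℕ → Option S → F⟦X⟧ := fun k o =>
    o.elim 1 (fun s => expand (p ^ k) (pow_ne_zero _ hp0) (U s))
  let V : ℕ → Submodule (Polynomial F) F⟦X⟧ := fun k => Submodule.span _ (Set.range (g k))
  have hone : ∀ k, (1 : F⟦X⟧) ∈ V k := fun k => Submodule.subset_span ⟨none, rfl⟩
  have hV : ∀ k, V k ≤ V (k + 1) := by
    intro k
    refine Submodule.span_le.mpr ?_
    rintro _ ⟨o, rfl⟩
    cases o with
    | none => exact hone (k + 1)
    | some s =>
      change expand (p ^ k) (pow_ne_zero _ hp0) (U s) ∈ V (k + 1)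
      rw [hU, stateSeries_eq p hp.out.one_lt, map_add, map_sum, expand_C]
      refine Submodule.add_mem _ ?_ (Submodule.sum_mem _ fun r _ => ?_)
      · have := Submodule.smul_mem _ (Polynomial.C (ω s - ω (δ s 0))) (hone (k + 1))
        rwa [polySmul_eq, mul_one, Polynomial.coe_C] at this
      · have hm : expand (p ^ (k + 1)) (pow_ne_zero _ hp0) (U (δ s r)) ∈ V (k + 1) :=
          Submodule.subset_span ⟨some (δ s r), rfl⟩
        have := Submodule.smul_mem _ (Polynomial.X ^ (p ^ k * r)) hm
        rw [polySmul_eq, Polynomial.coe_pow, Polynomial.coe_X] at this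
        rw [map_mul, map_pow, expand_X, ← pow_mul]
        convert this using 2
        rw [← expand_mul]
        rfl
  have hVm : Monotone V := monotone_nat_of_le_succ hV
  set N := Fintype.card (Option S) with hN
  let v : Fin (N + 1) → F⟦X⟧ := fun k => U s₀ ^ (p ^ e) ^ (k : ℕ)
  have hv : Set.range v ≤ V (e * N) := by
    rintro _ ⟨k, rfl⟩
    change U s₀ ^ (p ^ e) ^ (k : ℕ) ∈ V (e * N)
    rw [pow_card_eq_expand p e hq]
    exact hVm (Nat.mul_le_mul_left e (by omega : (k : ℕ) ≤ N))
      (Submodule.subset_span ⟨some s₀, rfl⟩)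
  have hnot : ¬ LinearIndependent (Polynomial F) v := by
    intro hli
    have h1 := linearIndependent_le_span' v hli (Set.range (g (e * N))) hv
    rw [Cardinal.mk_fin] at h1
    have h1' : N + 1 ≤ Fintype.card (Set.range (g (e * N))) := by exact_mod_cast h1
    have h2 := Fintype.card_range_le (g (e * N))
    omega
  rw [Fintype.not_linearIndependent_iff] at hnot
  obtain ⟨a, ha, i, hi⟩ := hnot
  refine ⟨N + 1, fun k => if h : k < N + 1 then a ⟨k, h⟩ else 0, ⟨i, i.2, by
    simp only [dif_pos i.2]; exact hi⟩, ?_⟩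
  rw [Finset.sum_range, ← ha]
  refine Finset.sum_congr rfl fun k _ => ?_
  rw [polySmul_eq]
  simp only [dif_pos k.2]
  rfl

lemma exists_section {F : Type*} [Field F] (q r : ℕ) (hq : 0 < q) (A : Polynomial F) :
    ∃ B : Polynomial F, ∀ n, B.coeff n = A.coeff (q * n + r) := by
  refine ⟨PowerSeries.trunc (A.natDegree + 1) (PowerSeries.mk fun n => A.coeff (q * n + r)), ?_⟩
  intro n
  rw [coeff_trunc, coeff_mk]
  split_ifs with h
  · rfl
  · rw [Polynomial.coeff_eq_zero_of_natDegree_lt]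
    nlinarith

lemma section_mul (p e : ℕ) [hp : Fact p.Prime] [CharP F p]
    (hq : Fintype.card F = p ^ e) (A B : Polynomial F) (g : F⟦X⟧) (r : ℕ) (hr : r < p ^ e)
    (hB : ∀ n, B.coeff n = A.coeff (p ^ e * n + r)) (n : ℕ) :
    coeff n ((B : F⟦X⟧) * g) = coeff (p ^ e * n + r) ((A : F⟦X⟧) * g ^ p ^ e) := by
  rw [coeff_mul, coeff_mul]
  have hpos : 0 < p ^ e := pow_pos hp.out.pos e
  refine Finset.sum_of_injOn (fun x => (p ^ e * x.1 + r, p ^ e * x.2)) ?_ ?_ ?_ ?_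
  · rintro ⟨a, b⟩ _ ⟨c, d⟩ _ h
    simp only [Prod.mk.injEq] at h
    have h1 := Nat.eq_of_mul_eq_mul_left hpos (Nat.add_right_cancel h.1)
    have h2 := Nat.eq_of_mul_eq_mul_left hpos h.2
    rw [h1, h2]
  · rintro ⟨a, b⟩ h
    have h' : a + b = n := Finset.HasAntidiagonal.mem_antidiagonal.mp h
    refine Finset.HasAntidiagonal.mem_antidiagonal.mpr ?_
    simp only
    rw [← h']; ring
  · rintro ⟨a, b⟩ h hn
    replace h : a + b = p ^ e * n + r := Finset.HasAntidiagonal.mem_antidiagonal.mp h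
    simp only
    rw [coeff_pow_card p e hq]
    split_ifs with hd
    · exfalso
      obtain ⟨c, rfl⟩ := hd
      apply hn
      have hcn : c ≤ n := by
        by_contra hc
        have : p ^ e * (n + 1) ≤ p ^ e * c := Nat.mul_le_mul_left _ (by omega)
        rw [mul_add] at this
        omega
      refine ⟨(n - c, c), Finset.HasAntidiagonal.mem_antidiagonal.mpr (Nat.sub_add_cancel hcn), ?_⟩
      simp only [Prod.mk.injEq, and_true]
      rw [Nat.mul_sub]
      have : p ^ e * c ≤ p ^ e * n := Nat.mul_le_mul_left _ hcn
      omega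
    · rw [mul_zero]
  · rintro ⟨a, b⟩ _
    simp only
    rw [coeff_pow_card p e hq, if_pos (Dvd.intro _ rfl), Nat.mul_div_cancel_left _ hpos,
      Polynomial.coeff_coe, Polynomial.coeff_coe, hB]

lemma ore_descend (p e : ℕ) [hp : Fact p.Prime] [CharP F p]
    (hq : Fintype.card F = p ^ e) (U : F⟦X⟧) (k₀ : ℕ) : ∀ (K : ℕ) (A : ℕ → Polynomial F),
      A 0 ≠ 0 → ∑ k ∈ Finset.range K, (A k : F⟦X⟧) * U ^ (p ^ e) ^ (k₀ + k) = 0 →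
      ∃ (A : ℕ → Polynomial F), A 0 ≠ 0 ∧
        ∑ k ∈ Finset.range K, (A k : F⟦X⟧) * U ^ (p ^ e) ^ k = 0 := by
  induction k₀ with
  | zero =>
    intro K A h0 h
    exact ⟨A, h0, by simpa using h⟩
  | succ k₀ ih =>
    intro K A h0 h
    obtain ⟨n, hn⟩ : ∃ n, (A 0).coeff n ≠ 0 := by
      by_contra hc
      push Not at hc
      exact h0 (Polynomial.ext (by simpa using hc))
    have hpos : 0 < p ^ e := by have := hp.out.pos; positivity
    have hr : n % p ^ e < p ^ e := Nat.mod_lt _ hpos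
    choose B hB using fun k => exists_section (p ^ e) (n % p ^ e) hpos (A k)
    refine ih K B ?_ ?_
    · intro hz
      apply hn
      rw [← Nat.div_add_mod n (p ^ e), ← hB 0, hz, Polynomial.coeff_zero]
    · ext m
      rw [map_sum, map_zero]
      have := congrArg (coeff (p ^ e * m + n % p ^ e)) h
      rw [map_sum, map_zero] at this
      rw [← this]
      refine Finset.sum_congr rfl fun k _ => ?_
      rw [section_mul p e hq (A k) (B k) _ _ hr (hB k), ← pow_mul, ← pow_succ]
      congr 4
      ring

lemma ore_separable (p e : ℕ) [hp : Fact p.Prime] [CharP F p]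
    (hq : Fintype.card F = p ^ e) (u : ℕ → F) (hu : IsKAutomatic p u) :
    ∃ (K : ℕ) (A : ℕ → Polynomial F), A 0 ≠ 0 ∧
      ∑ k ∈ Finset.range (K + 1), (A k : F⟦X⟧) * (PowerSeries.mk u) ^ (p ^ e) ^ k = 0 := by
  classical
  obtain ⟨K, A, hex, h⟩ := ore_exists p e hq u hu
  have hs := Nat.find_spec hex
  have hmin := fun k (hk : k < Nat.find hex) => Nat.find_min hex hk
  generalize Nat.find hex = k₀ at hs hmin
  obtain ⟨K', rfl⟩ : ∃ K', K = k₀ + (K' + 1) := ⟨K - k₀ - 1, by omega⟩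
  rw [Finset.sum_range_add, Finset.sum_eq_zero, zero_add] at h
  · obtain ⟨A', h1, h2⟩ := ore_descend p e hq (PowerSeries.mk u) k₀ (K' + 1)
      (fun k => A (k₀ + k)) (by simpa using hs.2) h
    exact ⟨K', A', h1, h2⟩
  · intro k hk
    rw [Finset.mem_range] at hk
    have := hmin k hk
    have : A k = 0 := by
      by_contra hne
      exact this ⟨by omega, hne⟩
    rw [this]; simp

end ForwardOre

section ForwardReduce

open PowerSeries

lemma exists_reduced {F : Type*} [Field F] (p e : ℕ) [hp : Fact p.Prime] [CharP F p] (he : 0 < e)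
    (U : F⟦X⟧) (K : ℕ) (A : ℕ → Polynomial F) (hA : A 0 ≠ 0)
    (h : ∑ k ∈ Finset.range (K + 1), (A k : F⟦X⟧) * U ^ (p ^ e) ^ k = 0) :
    ∃ (B c : Polynomial F) (β : ℕ → Polynomial F) (M : ℕ) (W : F⟦X⟧),
      B.coeff 0 = 1 ∧ constantCoeff W = 0 ∧ (∀ n, 1 ≤ n → coeff (n + M) U = coeff n W) ∧
      (B : F⟦X⟧) * W = X * ((c : F⟦X⟧) +
        ∑ k ∈ Finset.range K, (β k : F⟦X⟧) * W ^ (p ^ e) ^ (k + 1)) := by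
  have hchar : CharP F⟦X⟧ p :=
    charP_of_injective_ringHom (f := PowerSeries.C (R := F)) PowerSeries.C_injective p
  obtain ⟨B₀, hB₀, hB₀n⟩ := Polynomial.exists_eq_pow_rootMultiplicity_mul_and_not_dvd (A 0) hA 0
  rw [Polynomial.C_0, sub_zero] at hB₀ hB₀n
  generalize Polynomial.rootMultiplicity 0 (A 0) = a at hB₀
  rw [Polynomial.X_dvd_iff] at hB₀n
  set b := B₀.coeff 0 with hb
  set M := a + 1 with hM
  set T := trunc (M + 1) U with hT
  let W₁ : F⟦X⟧ := PowerSeries.mk fun n => coeff (n + 1 + M) U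
  have hU : U = (T : F⟦X⟧) + X ^ M * (X * W₁) := by
    ext n
    rw [map_add, Polynomial.coeff_coe, hT, coeff_trunc, ← mul_assoc, ← pow_succ, coeff_X_pow_mul']
    by_cases hn : n < M + 1
    · rw [if_pos hn, if_neg (by omega), add_zero]
    · rw [if_neg hn, if_pos (by omega), zero_add, coeff_mk]
      congr 2; omega
  set W := X * W₁ with hW
  have hpow : ∀ k, U ^ (p ^ e) ^ k =
      (T : F⟦X⟧) ^ (p ^ e) ^ k + X ^ (M * (p ^ e) ^ k) * W ^ (p ^ e) ^ k := by
    intro k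
    rw [hU, ← pow_mul p e k, add_pow_char_pow, mul_pow, pow_mul X M]
  have hexp : ∀ k, ∃ t, M * (p ^ e) ^ (k + 1) = (a + M + 1) + t := by
    intro k
    apply Nat.exists_eq_add_of_le
    have h1 : 2 ≤ (p ^ e) ^ (k + 1) := by
      rw [← pow_mul]
      calc 2 ≤ p := hp.out.two_le
        _ = p ^ 1 := (pow_one p).symm
        _ ≤ p ^ (e * (k + 1)) := Nat.pow_le_pow_right hp.out.pos (Nat.mul_pos he (by omega))
    nlinarith
  choose t ht using hexp
  set Cp : Polynomial F := ∑ k ∈ Finset.range (K + 1), A k * T ^ (p ^ e) ^ k with hCp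
  have hCp' : (Cp : F⟦X⟧) = ∑ k ∈ Finset.range (K + 1), (A k : F⟦X⟧) * (T : F⟦X⟧) ^ (p ^ e) ^ k := by
    have := map_sum (Polynomial.coeToPowerSeries.ringHom (R := F))
      (fun k => A k * T ^ (p ^ e) ^ k) (Finset.range (K + 1))
    simp only [Polynomial.coeToPowerSeries.ringHom_apply, Polynomial.coe_mul,
      Polynomial.coe_pow] at this
    exact this
  set Sg : F⟦X⟧ := ∑ k ∈ Finset.range K, (A (k + 1) : F⟦X⟧) * X ^ t k * W ^ (p ^ e) ^ (k + 1)
    with hSg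
  have hA0 : (A 0 : F⟦X⟧) = X ^ a * (B₀ : F⟦X⟧) := by
    rw [hB₀]; simp
  have h1 : (Cp : F⟦X⟧) + X ^ (a + M) * ((B₀ : F⟦X⟧) * W) + X ^ (a + M + 1) * Sg = 0 := by
    rw [← h, hCp', Finset.sum_range_succ', Finset.sum_range_succ', hSg, Finset.mul_sum]
    simp only [hpow, mul_add, Finset.sum_add_distrib]
    have : ∀ k, (A (k + 1) : F⟦X⟧) * (X ^ (M * (p ^ e) ^ (k + 1)) * W ^ (p ^ e) ^ (k + 1)) =
        X ^ (a + M + 1) * ((A (k + 1) : F⟦X⟧) * X ^ t k * W ^ (p ^ e) ^ (k + 1)) := by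
      intro k
      rw [ht, pow_add X (a + M + 1)]
      ring
    simp only [this]
    rw [hA0]
    ring
  obtain ⟨c₀, hc₀⟩ : Polynomial.X ^ (a + M + 1) ∣ Cp := by
    rw [Polynomial.X_pow_dvd_iff]
    have : (X : F⟦X⟧) ^ (a + M + 1) ∣ (Cp : F⟦X⟧) := by
      refine ⟨-((B₀ : F⟦X⟧) * W₁ + Sg), ?_⟩
      rw [hW] at h1
      linear_combination h1
    rw [X_pow_dvd_iff] at this
    simpa using this
  have h2 : X * (c₀ : F⟦X⟧) + (B₀ : F⟦X⟧) * W + X * Sg = 0 := by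
    have hne : (X : F⟦X⟧) ^ (a + M) ≠ 0 := pow_ne_zero _ X_ne_zero
    apply mul_left_cancel₀ hne
    rw [hc₀] at h1
    push_cast at h1
    rw [mul_zero, ← h1]
    ring
  refine ⟨Polynomial.C b⁻¹ * B₀, -(Polynomial.C b⁻¹ * c₀),
    fun k => -(Polynomial.C b⁻¹ * A (k + 1) * Polynomial.X ^ t k), M, W, ?_, ?_, ?_, ?_⟩
  · rw [Polynomial.coeff_C_mul, ← hb, inv_mul_cancel₀ hB₀n]
  · simp [hW]
  · intro n hn
    obtain ⟨n, rfl⟩ := Nat.exists_eq_add_of_le' hn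
    rw [hW, coeff_succ_X_mul, coeff_mk]
  · push_cast
    have : ∑ k ∈ Finset.range K, -((C b⁻¹ : F⟦X⟧) * (A (k + 1) : F⟦X⟧) * X ^ t k)
        * W ^ (p ^ e) ^ (k + 1) = - (C b⁻¹ * Sg) := by
      rw [hSg, Finset.mul_sum, ← Finset.sum_neg_distrib]
      refine Finset.sum_congr rfl fun k _ => ?_
      ring
    rw [this]
    linear_combination (C b⁻¹ : F⟦X⟧) * h2

end ForwardReduce

section ForwardLaurent

open PowerSeries

variable {F : Type*} [Field F]

/-- Extraction of the coefficient of `x ^ m` from a power series over Laurent polynomials. -/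
noncomputable def laurCol (m : ℤ) : (LaurentPolynomial F)⟦X⟧ →+ F⟦X⟧ where
  toFun f := PowerSeries.mk fun n => (coeff n f).coeff m
  map_zero' := by ext n; simp
  map_add' f g := by ext n; simp

lemma coeff_laurCol (m : ℤ) (f : (LaurentPolynomial F)⟦X⟧) (n : ℕ) :
    coeff n (laurCol m f) = (coeff n f).coeff m := by
  simp [laurCol]

/-- The embedding of `F⟦X⟧`. -/
noncomputable abbrev laurEmb : F⟦X⟧ →+* (LaurentPolynomial F)⟦X⟧ :=
  PowerSeries.map LaurentPolynomial.C

/-- The monomial `x ^ k`. -/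
noncomputable abbrev laurX (k : ℤ) : (LaurentPolynomial F)⟦X⟧ :=
  PowerSeries.C (LaurentPolynomial.T k)

lemma laurent_coeff_C_mul (a : F) (f : LaurentPolynomial F) (m : ℤ) :
    (LaurentPolynomial.C a * f).coeff m = a * f.coeff m := by
  rw [← LaurentPolynomial.smul_eq_C_mul]; simp

lemma laurent_coeff_T_mul (k : ℤ) (f : LaurentPolynomial F) (m : ℤ) :
    (LaurentPolynomial.T k * f).coeff m = f.coeff (m - k) := by
  rw [LaurentPolynomial.T]
  have := AddMonoidAlgebra.coeff_single_mul_eq_mul_coeff (x := f) (r := 1) (m₁ := m) (m := k) (m - k)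
    (by intro a _; constructor <;> intro h <;> omega)
  rw [this, one_mul]

lemma laurCol_emb_mul (m : ℤ) (a : F⟦X⟧) (f : (LaurentPolynomial F)⟦X⟧) :
    laurCol m (laurEmb a * f) = a * laurCol m f := by
  ext n
  rw [coeff_laurCol, coeff_mul, coeff_mul, AddMonoidAlgebra.coeff_sum, Finsupp.finsetSum_apply]
  refine Finset.sum_congr rfl fun x _ => ?_
  rw [PowerSeries.coeff_map, laurent_coeff_C_mul, coeff_laurCol]

lemma laurCol_X_mul (m k : ℤ) (f : (LaurentPolynomial F)⟦X⟧) :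
    laurCol m (laurX k * f) = laurCol (m - k) f := by
  ext n
  rw [coeff_laurCol, coeff_C_mul, laurent_coeff_T_mul, coeff_laurCol]

lemma charP_laurent (p : ℕ) [CharP F p] : CharP (LaurentPolynomial F) p :=
  charP_of_injective_algebraMap (algebraMap F (LaurentPolynomial F)).injective p

lemma charP_laurentSeries (p : ℕ) [CharP F p] : CharP (LaurentPolynomial F)⟦X⟧ p :=
  have := charP_laurent (F := F) p
  charP_of_injective_ringHom (f := PowerSeries.C (R := LaurentPolynomial F)) PowerSeries.C_injective p

variable [Fintype F]

lemma laurent_coeff_pow (p e : ℕ) [hp : Fact p.Prime] [CharP F p]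
    (hq : Fintype.card F = p ^ e) (a : LaurentPolynomial F) (m : ℤ) :
    (a ^ p ^ e).coeff m = if ((p ^ e : ℕ) : ℤ) ∣ m then a.coeff (m / ((p ^ e : ℕ) : ℤ)) else 0 := by
  have := charP_laurent (F := F) p
  have hq0 : ((p ^ e : ℕ) : ℤ) ≠ 0 := by exact_mod_cast pow_ne_zero _ hp.out.ne_zero
  induction a using LaurentPolynomial.induction_on' with
  | add f g hf hg =>
    rw [add_pow_char_pow, AddMonoidAlgebra.coeff_add, Finsupp.add_apply, hf, hg]
    split_ifs
    · simp
    · simp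
  | C_mul_T n a =>
    rw [mul_pow, ← map_pow, ← hq, FiniteField.pow_card, hq, LaurentPolynomial.T_pow,
      laurent_coeff_C_mul, laurent_coeff_C_mul, LaurentPolynomial.T_apply, LaurentPolynomial.T_apply]
    by_cases hd : ((p ^ e : ℕ) : ℤ) ∣ m
    · obtain ⟨k, rfl⟩ := hd
      rw [if_pos (dvd_mul_right _ _), Int.mul_ediv_cancel_left _ hq0]
      congr 1
      simp only [mul_right_inj' hq0]
    · rw [if_neg hd, if_neg, mul_zero]
      rintro rfl
      exact hd (dvd_mul_right _ _)

lemma laurCol_pow (p e : ℕ) [hp : Fact p.Prime] [CharP F p]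
    (hq : Fintype.card F = p ^ e) (f : (LaurentPolynomial F)⟦X⟧) (m : ℤ) :
    laurCol (((p ^ e : ℕ) : ℤ) * m) (f ^ p ^ e) = (laurCol m f) ^ p ^ e := by
  have := charP_laurent (F := F) p
  have hq0 : ((p ^ e : ℕ) : ℤ) ≠ 0 := by exact_mod_cast pow_ne_zero _ hp.out.ne_zero
  ext n
  rw [coeff_laurCol, coeff_pow_frob, coeff_pow_card p e hq]
  split_ifs
  · rw [laurent_coeff_pow p e hq, if_pos (dvd_mul_right _ _), Int.mul_ediv_cancel_left _ hq0,
      coeff_laurCol]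
  · simp

end ForwardLaurent

section ForwardSupp

open PowerSeries

variable {F : Type*} [Field F]

/-- All exponents of `x` are congruent to `r` mod `q`. -/
def SuppMod (q r : ℤ) (f : (LaurentPolynomial F)⟦X⟧) : Prop :=
  ∀ n m, (coeff n f).coeff m ≠ 0 → q ∣ m - r

lemma SuppMod.add {q r : ℤ} {f g : (LaurentPolynomial F)⟦X⟧} (hf : SuppMod q r f)
    (hg : SuppMod q r g) : SuppMod q r (f + g) := by
  intro n m h
  rw [map_add, AddMonoidAlgebra.coeff_add, Finsupp.add_apply] at h
  by_cases h1 : (coeff n f).coeff m = 0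
  · rw [h1, zero_add] at h
    exact hg n m h
  · exact hf n m h1

lemma SuppMod.zero {q r : ℤ} : SuppMod q r (0 : (LaurentPolynomial F)⟦X⟧) := by
  intro n m h
  simp at h

lemma SuppMod.sum {ι : Type*} {q r : ℤ} (s : Finset ι) (f : ι → (LaurentPolynomial F)⟦X⟧)
    (h : ∀ i ∈ s, SuppMod q r (f i)) : SuppMod q r (∑ i ∈ s, f i) := by
  classical
  induction s using Finset.induction_on with
  | empty => simpa using SuppMod.zero
  | insert a s ha ih =>
    rw [Finset.sum_insert ha]
    exact (h a (Finset.mem_insert_self _ _)).add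
      (ih fun i hi => h i (Finset.mem_insert_of_mem hi))

lemma SuppMod.mul {q r s : ℤ} {f g : (LaurentPolynomial F)⟦X⟧} (hf : SuppMod q r f)
    (hg : SuppMod q s g) : SuppMod q (r + s) (f * g) := by
  intro n m h
  rw [coeff_mul, AddMonoidAlgebra.coeff_sum, Finsupp.finsetSum_apply] at h
  obtain ⟨x, _, hx⟩ := Finset.exists_ne_zero_of_sum_ne_zero h
  rw [AddMonoidAlgebra.coeff_mul_apply_left, Finsupp.sum] at hx
  obtain ⟨a, _, ha⟩ := Finset.exists_ne_zero_of_sum_ne_zero hx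
  have h1 := hf _ _ (left_ne_zero_of_mul ha)
  have h2 := hg _ _ (right_ne_zero_of_mul ha)
  rw [show m - (r + s) = (a - r) + (-a + m - s) by ring]
  exact dvd_add h1 h2

lemma SuppMod.congr {q r s : ℤ} {f : (LaurentPolynomial F)⟦X⟧} (hf : SuppMod q r f)
    (h : q ∣ r - s) : SuppMod q s f := by
  intro n m hm
  rw [show m - s = (m - r) + (r - s) by ring]
  exact dvd_add (hf n m hm) h

lemma SuppMod.emb (q : ℤ) (a : F⟦X⟧) : SuppMod q 0 (laurEmb a) := by
  intro n m h
  rw [PowerSeries.coeff_map, LaurentPolynomial.C_apply] at h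
  split_ifs at h with h1
  · simp [h1]
  · exact absurd rfl h

lemma SuppMod.X (q k : ℤ) : SuppMod q k (laurX k : (LaurentPolynomial F)⟦X⟧) := by
  intro n m h
  rw [PowerSeries.coeff_C] at h
  split_ifs at h with h1
  · rw [LaurentPolynomial.T_apply] at h
    split_ifs at h with h2
    · simp [← h2]
    · exact absurd rfl h
  · simp at h

lemma SuppMod.pow {q r : ℤ} {f : (LaurentPolynomial F)⟦X⟧} (hf : SuppMod q r f) (i : ℕ) :
    SuppMod q (i * r) (f ^ i) := by
  induction i with
  | zero =>
    have := SuppMod.emb q (1 : F⟦X⟧)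
    simpa using this
  | succ i ih =>
    rw [pow_succ]
    convert ih.mul hf using 1
    push_cast
    ring

lemma laurCol_eq_zero {q r m : ℤ} {f : (LaurentPolynomial F)⟦X⟧} (hf : SuppMod q r f)
    (h : ¬ q ∣ m - r) : laurCol m f = 0 := by
  ext n
  rw [coeff_laurCol, map_zero]
  by_contra hne
  exact h (hf n m hne)

/-- If `G = 1 + ψ G` with `ψ` of residue `-1`, then the columns of `G` satisfy a
Frobenius relation. -/
lemma laurCol_frob [Fintype F] (p e : ℕ) [hp : Fact p.Prime] [CharP F p]
    (hq : Fintype.card F = p ^ e) (ψ G : (LaurentPolynomial F)⟦X⟧)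
    (hψ : SuppMod ((p ^ e : ℕ) : ℤ) (-1) ψ) (hG : (1 - ψ) * G = 1) (m : ℤ) :
    laurCol (((p ^ e : ℕ) : ℤ) * m) G = (laurCol m G) ^ p ^ e := by
  have := charP_laurentSeries (F := F) p
  have hq0 : 0 < p ^ e := pow_pos hp.out.pos _
  have hgeom : (∑ i ∈ Finset.range (p ^ e), ψ ^ i) * (1 - ψ) = (1 - ψ) ^ p ^ e := by
    rw [sub_pow_char_pow, one_pow]
    have := geom_sum_mul ψ (p ^ e)
    linear_combination -this
  have hG2 : G = (∑ i ∈ Finset.range (p ^ e), ψ ^ i) * G ^ p ^ e := by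
    have h1 : (1 - ψ) ^ p ^ e * G ^ p ^ e = 1 := by rw [← mul_pow, hG, one_pow]
    rw [← hgeom] at h1
    calc G = G * 1 := (mul_one _).symm
      _ = (∑ i ∈ Finset.range (p ^ e), ψ ^ i) * G ^ p ^ e * ((1 - ψ) * G) := by
          linear_combination (-G) * h1
      _ = _ := by rw [hG, mul_one]
  have hGq : SuppMod ((p ^ e : ℕ) : ℤ) 0 (G ^ p ^ e) := by
    have := charP_laurent (F := F) p
    intro n m h
    rw [coeff_pow_frob] at h
    split_ifs at h
    · rw [laurent_coeff_pow p e hq] at h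
      split_ifs at h with hd
      · simpa using hd
      · exact absurd rfl h
    · simp at h
  rw [← laurCol_pow p e hq]
  conv_lhs => rw [hG2]
  rw [Finset.sum_mul, map_sum, Finset.sum_eq_single_of_mem 0 (by simpa using hq0)]
  · rw [pow_zero, one_mul]
  · intro i hi hi0
    apply laurCol_eq_zero ((hψ.pow i).mul hGq)
    intro hd
    have h3 : ((p ^ e : ℕ) : ℤ) ∣ (i : ℤ) := by
      have := dvd_sub hd (dvd_mul_right ((p ^ e : ℕ) : ℤ) m)
      rwa [show ((p ^ e : ℕ) : ℤ) * m - (i * -1 + 0) - ((p ^ e : ℕ) : ℤ) * m = i by ring] at this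
    have h4 := Int.natCast_dvd_natCast.mp h3
    exact absurd (Nat.le_of_dvd (by omega) h4) (by have := Finset.mem_range.mp hi; omega)

end ForwardSupp

section ForwardCA

open PowerSeries

lemma laurent_coeff_one {F : Type*} [Field F] (m : ℤ) :
    (1 : LaurentPolynomial F).coeff m = if 0 = m then 1 else 0 := by
  rw [← LaurentPolynomial.T_zero, LaurentPolynomial.T_apply]

lemma exists_laurent {F : Type*} [Field F] [Fintype F] (p e : ℕ) [hp : Fact p.Prime] [CharP F p]
    (he : 0 < e) (hq : Fintype.card F = p ^ e) (K : ℕ)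
    (B c : Polynomial F) (β : ℕ → Polynomial F) (W : F⟦X⟧)
    (hB : B.coeff 0 = 1) (hW0 : constantCoeff W = 0)
    (hW : (B : F⟦X⟧) * W = X * ((c : F⟦X⟧) +
        ∑ k ∈ Finset.range K, (β k : F⟦X⟧) * W ^ (p ^ e) ^ (k + 1))) :
    ∃ (P G : (LaurentPolynomial F)⟦X⟧) (d0 : ℕ), coeff 0 P = 1 ∧ (∀ n, d0 < n → coeff n P = 0) ∧
      (∀ n, d0 < n → coeff n (P * G) = 0) ∧ laurCol (-1) G = W := by
  have hcharF : CharP F⟦X⟧ p :=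
    charP_of_injective_ringHom (f := PowerSeries.C (R := F)) PowerSeries.C_injective p
  have hq2 : 2 ≤ p ^ e := by
    calc 2 ≤ p := hp.out.two_le
      _ = p ^ 1 := (pow_one p).symm
      _ ≤ p ^ e := Nat.pow_le_pow_right hp.out.pos he
  have hBc : constantCoeff (B : F⟦X⟧) = 1 := by
    rw [← coeff_zero_eq_constantCoeff_apply, Polynomial.coeff_coe, hB]
  have hBne : constantCoeff (B : F⟦X⟧) ≠ 0 := by rw [hBc]; exact one_ne_zero
  set S : (LaurentPolynomial F)⟦X⟧ := laurEmb (c : F⟦X⟧) * laurX (-1) +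
    ∑ k ∈ Finset.range K, laurEmb (β k : F⟦X⟧) * laurX (((p ^ e : ℕ) : ℤ) ^ (k + 1) - 1) with hS
  set ψ : (LaurentPolynomial F)⟦X⟧ := laurEmb ((B : F⟦X⟧)⁻¹ * X) * S with hψ
  have hψ0 : constantCoeff ψ = 0 := by
    rw [hψ, map_mul, ← coeff_zero_eq_constantCoeff_apply, PowerSeries.coeff_map]
    simp
  have hψS : SuppMod ((p ^ e : ℕ) : ℤ) (-1) ψ := by
    have h1 : SuppMod ((p ^ e : ℕ) : ℤ) (-1) S := by
      refine SuppMod.add ?_ (SuppMod.sum _ _ fun k _ => ?_)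
      · simpa using (SuppMod.emb _ (c : F⟦X⟧)).mul (SuppMod.X _ (-1))
      · refine ((SuppMod.emb _ (β k : F⟦X⟧)).mul (SuppMod.X _ _)).congr ?_
        rw [show (0 : ℤ) + (((p ^ e : ℕ) : ℤ) ^ (k + 1) - 1) - -1 = ((p ^ e : ℕ) : ℤ) ^ (k + 1) by ring]
        exact dvd_pow_self _ (by omega)
    simpa using (SuppMod.emb _ ((B : F⟦X⟧)⁻¹ * X)).mul h1
  obtain ⟨G, hG⟩ : ∃ G, (1 - ψ) * G = 1 :=
    ⟨invOfUnit (1 - ψ) 1, mul_invOfUnit _ _ (by simp [hψ0])⟩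
  have hG0 : coeff 0 G = 1 := by
    have := congrArg constantCoeff hG
    rw [map_mul, map_sub, hψ0, map_one, sub_zero, one_mul] at this
    rwa [coeff_zero_eq_constantCoeff_apply]
  have hfrob := laurCol_frob p e hq ψ G hψS hG
  have hiter : ∀ (k : ℕ) (m : ℤ), laurCol (((p ^ e : ℕ) : ℤ) ^ k * m) G
      = (laurCol m G) ^ (p ^ e) ^ k := by
    intro k
    induction k with
    | zero => intro m; simp
    | succ k ih =>
      intro m
      rw [pow_succ', mul_assoc, hfrob, ih, ← pow_mul, pow_succ]
  have key : ∀ D v : F⟦X⟧, D * v = 0 → constantCoeff v = 1 → D = 0 := by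
    intro D v h hv
    rcases mul_eq_zero.mp h with h | h
    · exact h
    · rw [h, map_zero] at hv
      exact absurd hv zero_ne_one
  have he0 : laurCol 0 G = 1 := by
    have h1 := hfrob 0
    rw [mul_zero] at h1
    have h0 : constantCoeff (laurCol 0 G) = 1 := by
      rw [← coeff_zero_eq_constantCoeff_apply, coeff_laurCol, hG0]
      simp [laurent_coeff_one]
    have h2 : (laurCol 0 G - 1) = (laurCol 0 G - 1) ^ p ^ e := by
      rw [sub_pow_char_pow, one_pow, ← h1]
    have h3 : constantCoeff (laurCol 0 G - 1) = 0 := by rw [map_sub, h0, map_one, sub_self]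
    rw [← sub_eq_zero]
    apply key _ (1 - (laurCol 0 G - 1) ^ (p ^ e - 1))
    · rw [mul_sub, mul_one, ← pow_succ', show p ^ e - 1 + 1 = p ^ e by omega, ← h2, sub_self]
    · rw [map_sub, map_one, map_pow, h3, zero_pow (by omega), sub_zero]
  have hBψ : laurEmb (B : F⟦X⟧) * ψ = laurEmb X * S := by
    rw [hψ, ← mul_assoc, ← map_mul, ← mul_assoc, PowerSeries.mul_inv_cancel _ hBne, one_mul]
  set P : (LaurentPolynomial F)⟦X⟧ := laurEmb (B : F⟦X⟧) - laurEmb X * S with hP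
  have hPG : P * G = laurEmb (B : F⟦X⟧) := by
    rw [hP, ← hBψ]
    linear_combination laurEmb (B : F⟦X⟧) * hG
  set e₁ := laurCol (-1) G with he₁
  have he10 : constantCoeff e₁ = 0 := by
    rw [← coeff_zero_eq_constantCoeff_apply, he₁, coeff_laurCol, hG0]
    simp [laurent_coeff_one]
  have hone : laurCol (-1) (1 : (LaurentPolynomial F)⟦X⟧) = 0 := by
    ext n
    rw [coeff_laurCol, coeff_one]
    split_ifs <;> simp [laurent_coeff_one]
  have he1 : (B : F⟦X⟧) * e₁ = X * ((c : F⟦X⟧) +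
        ∑ k ∈ Finset.range K, (β k : F⟦X⟧) * e₁ ^ (p ^ e) ^ (k + 1)) := by
    have h1 : laurEmb (B : F⟦X⟧) * G = laurEmb (B : F⟦X⟧) * 1 + laurEmb X * (S * G) := by
      linear_combination hPG
    have h2 := congrArg (laurCol (-1)) h1
    rw [map_add, laurCol_emb_mul, laurCol_emb_mul, laurCol_emb_mul, hone, mul_zero, zero_add,
      hS, add_mul, map_add, mul_assoc, laurCol_emb_mul, laurCol_X_mul, sub_self, he0, mul_one,
      Finset.sum_mul, map_sum] at h2
    rw [he₁, h2]
    congr 2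
    refine Finset.sum_congr rfl fun k _ => ?_
    rw [mul_assoc, laurCol_emb_mul, laurCol_X_mul, ← hiter]
    congr 3
    ring
  have hfin : e₁ = W := by
    rw [← sub_eq_zero]
    apply key _ ((B : F⟦X⟧) - X * ∑ k ∈ Finset.range K, (β k : F⟦X⟧) *
      (e₁ - W) ^ ((p ^ e) ^ (k + 1) - 1))
    · have h1 : ∀ k, (e₁ - W) * (e₁ - W) ^ ((p ^ e) ^ (k + 1) - 1)
          = e₁ ^ (p ^ e) ^ (k + 1) - W ^ (p ^ e) ^ (k + 1) := by
        intro k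
        have : 0 < (p ^ e) ^ (k + 1) := by positivity
        rw [← pow_succ', Nat.sub_add_cancel this, ← pow_mul, sub_pow_char_pow]
      have h2 : (e₁ - W) * ∑ k ∈ Finset.range K, (β k : F⟦X⟧) *
          (e₁ - W) ^ ((p ^ e) ^ (k + 1) - 1) =
          ∑ k ∈ Finset.range K, (β k : F⟦X⟧) * e₁ ^ (p ^ e) ^ (k + 1) -
          ∑ k ∈ Finset.range K, (β k : F⟦X⟧) * W ^ (p ^ e) ^ (k + 1) := by
        rw [Finset.mul_sum, ← Finset.sum_sub_distrib]
        refine Finset.sum_congr rfl fun k _ => ?_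
        rw [mul_left_comm, h1, mul_sub]
      linear_combination he1 - hW - X * h2
    · simp [hBc]
  have hcoe : ∀ (Q : Polynomial F) (n : ℕ), Q.natDegree < n → coeff n (laurEmb (Q : F⟦X⟧)) = 0 := by
    intro Q n hn
    rw [PowerSeries.coeff_map, Polynomial.coeff_coe, Polynomial.coeff_eq_zero_of_natDegree_lt hn,
      map_zero]
  have hbd : ∀ k ∈ Finset.range K, (β k).natDegree ≤ ∑ k ∈ Finset.range K, (β k).natDegree :=
    fun k hk => Finset.single_le_sum (f := fun k => (β k).natDegree) (fun _ _ => Nat.zero_le _) hk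
  refine ⟨P, G, B.natDegree + (1 + c.natDegree + ∑ k ∈ Finset.range K, (β k).natDegree),
    ?_, ?_, ?_, hfin⟩
  · rw [hP, map_sub, PowerSeries.coeff_map, Polynomial.coeff_coe, hB, map_one]
    simp
  · intro n hn
    obtain ⟨n, rfl⟩ := Nat.exists_eq_add_of_le' (show 1 ≤ n by omega)
    rw [hP, map_sub, hcoe _ _ (by omega), PowerSeries.map_X, coeff_succ_X_mul, hS, map_add,
      coeff_mul_C, hcoe _ _ (by omega), map_sum, Finset.sum_eq_zero]
    · simp
    · intro k hk
      rw [coeff_mul_C, hcoe _ _ (by have := hbd k hk; omega), zero_mul]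
  · intro n hn
    rw [hPG]
    exact hcoe _ _ (by omega)

lemma eventuallyPeriodic_laurent {F : Type*} [Field F] (g : LaurentPolynomial F) :
    EventuallyPeriodicBoth (fun m => g.coeff m) := by
  have hb : ∀ m : ℤ, (∑ a ∈ g.coeff.support, a.natAbs) < m.natAbs → g.coeff m = 0 := by
    intro m hm
    by_contra hne
    have := Finset.single_le_sum (f := fun a : ℤ => a.natAbs) (fun _ _ => Nat.zero_le _)
      (Finsupp.mem_support_iff.mpr hne)
    omega
  refine ⟨(∑ a ∈ g.coeff.support, a.natAbs) + 1, 1, le_rfl, ?_, ?_⟩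
  · intro m hm
    simp only
    rw [hb _ (by omega), hb _ (by omega)]
  · intro m hm
    simp only
    rw [hb _ (by omega), hb _ (by omega)]

lemma column_of_laurent {F : Type*} [Field F] (u : ℕ → F) (M d0 : ℕ)
    (P G : (LaurentPolynomial F)⟦X⟧) (hP0 : coeff 0 P = 1) (hP : ∀ n, d0 < n → coeff n P = 0)
    (hPG : ∀ n, d0 < n → coeff n (P * G) = 0)
    (hu : ∀ n, 1 ≤ n → u (n + M) = (coeff n G).coeff (-1)) :
    ∃ (d l r : ℕ) (f : ℤ → ℕ → F) (R : ℕ → ℤ → F) (m₀ : ℤ),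
        1 ≤ d ∧
        (∀ i, i < d → EventuallyPeriodicBoth (R i)) ∧
        (∀ n, d ≤ n → ∀ m : ℤ,
          R n m = ∑ i ∈ Finset.Icc 1 d, ∑ j ∈ Finset.Icc (-(l : ℤ)) (r : ℤ),
            f j i * R (n - i) (m + j)) ∧
        (∀ n, R n m₀ = u n) := by
  set L : ℕ := ∑ i ∈ Finset.range (d0 + 1), ∑ a ∈ (coeff i P).coeff.support, a.natAbs with hL
  have hLb : ∀ i, i ≤ d0 → ∀ a : ℤ, (coeff i P).coeff a ≠ 0 → a.natAbs ≤ L := by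
    intro i hi a ha
    refine le_trans (Finset.single_le_sum (f := fun a : ℤ => a.natAbs) (fun _ _ => Nat.zero_le _)
      (Finsupp.mem_support_iff.mpr ha)) ?_
    exact Finset.single_le_sum (f := fun i => ∑ a ∈ (coeff i P).coeff.support, a.natAbs)
      (fun _ _ => Nat.zero_le _) (Finset.mem_range.mpr (by omega))
  have hmul : ∀ i, i ≤ d0 → ∀ (g : LaurentPolynomial F) (m : ℤ),
      (coeff i P * g).coeff m =
        ∑ j ∈ Finset.Icc (-(L : ℤ)) (L : ℤ), (coeff i P).coeff (-j) * g.coeff (m + j) := by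
    intro i hi g m
    rw [AddMonoidAlgebra.coeff_mul_apply_left, Finsupp.sum]
    have h1 : ∑ a ∈ (coeff i P).coeff.support, (coeff i P).coeff a * g.coeff (-a + m) =
        ∑ a ∈ Finset.Icc (-(L : ℤ)) (L : ℤ), (coeff i P).coeff a * g.coeff (-a + m) := by
      apply Finset.sum_subset
      · intro a ha
        have := hLb i hi a (Finsupp.mem_support_iff.mp ha)
        rw [Finset.mem_Icc]
        omega
      · intro a _ ha
        rw [Finsupp.notMem_support_iff.mp ha, zero_mul]
    rw [h1]
    refine Finset.sum_nbij' (fun a => -a) (fun a => -a) ?_ ?_ ?_ ?_ ?_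
    · intro a ha
      rw [Finset.mem_Icc] at ha ⊢
      omega
    · intro a ha
      rw [Finset.mem_Icc] at ha ⊢
      omega
    · intro a _
      simp
    · intro a _
      simp
    · intro a _
      rw [neg_neg, add_comm]
  let R : ℕ → ℤ → F := fun n => if n ≤ M then fun _ => u n else fun m => (coeff (n - M) G).coeff m
  have hR : ∀ n, M < n → ∀ m, R n m = (coeff (n - M) G).coeff m := by
    intro n hn m
    simp only [R]
    rw [if_neg (by omega)]
  refine ⟨M + d0 + 1, L, L, fun j i => if i ≤ d0 then -(coeff i P).coeff (-j) else 0, R, -1,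
    by omega, ?_, ?_, ?_⟩
  · intro i _
    by_cases h : i ≤ M
    · simp only [R]
      rw [if_pos h]
      exact ⟨0, 1, le_rfl, fun _ _ => rfl, fun _ _ => rfl⟩
    · simp only [R]
      rw [if_neg h]
      exact eventuallyPeriodic_laurent _
  · intro n hn m
    have h0 := hPG (n - M) (by omega)
    rw [coeff_mul, Finset.Nat.sum_antidiagonal_eq_sum_range_succ
      (f := fun i j => coeff i P * coeff j G)] at h0
    have h1 : ∑ i ∈ Finset.range (d0 + 1), coeff i P * coeff (n - M - i) G = 0 := by
      rw [← h0]
      apply Finset.sum_subset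
      · intro a ha
        rw [Finset.mem_range] at ha ⊢
        omega
      · intro a _ ha
        rw [Finset.mem_range] at ha
        rw [hP a (by omega), zero_mul]
    rw [Finset.sum_range_succ', hP0, one_mul, Nat.sub_zero] at h1
    have h2 : coeff (n - M) G = - ∑ i ∈ Finset.range d0, coeff (i + 1) P * coeff (n - M - (i + 1)) G := by
      linear_combination h1
    rw [hR n (by omega), h2, AddMonoidAlgebra.coeff_neg, AddMonoidAlgebra.coeff_sum,
      Finsupp.neg_apply, Finsupp.finsetSum_apply]
    have h3 : ∑ i ∈ Finset.Icc 1 (M + d0 + 1), ∑ j ∈ Finset.Icc (-(L : ℤ)) (L : ℤ),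
        (if i ≤ d0 then -(coeff i P).coeff (-j) else 0) * R (n - i) (m + j) =
        ∑ i ∈ Finset.Icc 1 d0, ∑ j ∈ Finset.Icc (-(L : ℤ)) (L : ℤ),
        (if i ≤ d0 then -(coeff i P).coeff (-j) else 0) * R (n - i) (m + j) := by
      symm
      apply Finset.sum_subset
      · intro a ha
        rw [Finset.mem_Icc] at ha ⊢
        omega
      · intro a ha ha2
        rw [Finset.mem_Icc] at ha ha2
        refine Finset.sum_eq_zero fun j _ => ?_
        rw [if_neg (by omega), zero_mul]
    rw [h3, Finset.range_eq_Ico, ← Finset.sum_neg_distrib,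
      Finset.sum_Ico_add' (fun i => -(coeff i P * coeff (n - M - i) G).coeff m) 0 d0 1]
    refine Finset.sum_congr ?_ fun i hi => ?_
    · ext i
      simp only [Finset.mem_Ico, Finset.mem_Icc]
      omega
    · rw [Finset.mem_Icc] at hi
      rw [hmul i (by omega), ← Finset.sum_neg_distrib]
      refine Finset.sum_congr rfl fun j _ => ?_
      rw [if_pos (by omega), hR (n - i) (by omega), neg_mul,
        show n - M - i = n - i - M by omega]
  · intro n
    by_cases h : n ≤ M
    · simp only [R]
      rw [if_pos h]
    · rw [hR n (by omega), ← hu _ (by omega)]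
      congr 1
      omega

end ForwardCA

/-- A sequence over `F_q` (char `p`) is `p`-automatic iff it is a column of a spacetime
diagram of a linear cellular automaton with memory over `F_q` whose initial conditions
are eventually periodic in both directions. -/
theorem automatic_iff_column_of_linear_CA_with_memory
    (p : ℕ) (hp : p.Prime) (Fq : Type*) [Field Fq] [Fintype Fq] (hchar : CharP Fq p)
    (u : ℕ → Fq) :
    IsKAutomatic p u ↔
      ∃ (d l r : ℕ) (f : ℤ → ℕ → Fq) (R : ℕ → ℤ → Fq) (m₀ : ℤ),
        1 ≤ d ∧
        (∀ i, i < d → EventuallyPeriodicBoth (R i)) ∧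
        (∀ n, d ≤ n → ∀ m : ℤ,
          R n m = ∑ i ∈ Finset.Icc 1 d, ∑ j ∈ Finset.Icc (-(l : ℤ)) (r : ℤ),
            f j i * R (n - i) (m + j)) ∧
        (∀ n, R n m₀ = u n) := by
  haveI := Fact.mk hp
  haveI := hchar
  constructor
  · intro hu
    obtain ⟨e, -, hq⟩ := FiniteField.card Fq p
    obtain ⟨K, A, hA, h⟩ := ore_separable p e hq u hu
    obtain ⟨B, c, β, M, W, hB, hW0, hUW, hW⟩ := exists_reduced p e e.pos _ K A hA h
    obtain ⟨P, G, d0, hP0, hP, hPG, hG⟩ := exists_laurent p e e.pos hq K B c β W hB hW0 hW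
    refine column_of_laurent u M d0 P G hP0 hP hPG ?_
    intro n hn
    rw [← coeff_laurCol, hG, ← hUW n hn, PowerSeries.coeff_mk]
  · exact automatic_of_column p u
end

section
/- Let p be a prime and F_q a finite field of characteristic p. Let d ≥ 1, let l, r ≥ 0, let f_{j,i} ∈ F_q (−l ≤ j ≤ r, 1 ≤ i ≤ d) be the coefficients of a linear cellular automaton rule with memory d, and let R_0, …, R_{d−1} : ℤ → F_q be initial rows each eventually periodic in both directions. Then for every m ∈ ℤ, the column sequence (R_n(m))_{n≥0} of the resulting spacetime diagram is p-automatic. -/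
namespace CAaux

variable {F : Type*} [Field F]

/-- Translation of a two-dimensional array. -/
def shiftEnd (v : ℤ × ℤ) : Module.End F (ℤ × ℤ → F) where
  toFun R := fun w => R (w - v)
  map_add' _ _ := rfl
  map_smul' _ _ := rfl

/-- Translations as a monoid homomorphism. -/
def shiftHom : Multiplicative (ℤ × ℤ) →* Module.End F (ℤ × ℤ → F) where
  toFun v := shiftEnd v.toAdd
  map_one' := by
    ext R w
    simp [shiftEnd]
  map_mul' v w := by
    apply LinearMap.ext
    intro R
    funext x
    simp only [shiftEnd, toAdd_mul, LinearMap.coe_mk, AddHom.coe_mk, Module.End.mul_apply]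
    congr 1
    abel

/-- The action of Laurent polynomials on arrays. -/
noncomputable def act : AddMonoidAlgebra F (ℤ × ℤ) →ₐ[F] Module.End F (ℤ × ℤ → F) :=
  AddMonoidAlgebra.lift F _ (ℤ × ℤ) shiftHom

lemma act_single (v : ℤ × ℤ) (a : F) (R : ℤ × ℤ → F) (w : ℤ × ℤ) :
    act (AddMonoidAlgebra.single v a) R w = a * R (w - v) := by
  simp [act, shiftHom, shiftEnd]

variable {ι : Type} [Fintype ι]

/-- The characteristic Laurent polynomial of the rule. -/
noncomputable def pol (v : ι → ℤ × ℤ) (c : ι → F) : AddMonoidAlgebra F (ℤ × ℤ) :=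
  1 - ∑ i, AddMonoidAlgebra.single (v i) (c i)

lemma act_pol (v : ι → ℤ × ℤ) (c : ι → F) (R : ℤ × ℤ → F) (w : ℤ × ℤ) :
    act (pol v c) R w = R w - ∑ i, c i * R (w - v i) := by
  simp only [pol, map_sub, map_one, map_sum, LinearMap.sub_apply, Pi.sub_apply,
    Module.End.one_apply, LinearMap.sum_apply, Finset.sum_apply, act_single]

lemma pol_pow (p : ℕ) [Fact p.Prime] [CharP F p] (v : ι → ℤ × ℤ) (c : ι → F) :
    pol v c ^ p = pol (fun i => p • v i) (fun i => c i ^ p) := by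
  have : CharP (AddMonoidAlgebra F (ℤ × ℤ)) p :=
    charP_of_injective_algebraMap (algebraMap F (AddMonoidAlgebra F (ℤ × ℤ))).injective p
  unfold pol
  rw [sub_pow_char, one_pow, sum_pow_char]
  simp [AddMonoidAlgebra.single_pow]

/-- Arrays supported in finitely many rows, with eventually periodic rows. -/
structure Good (per D N : ℤ) (I : ℤ × ℤ → F) : Prop where
  low : ∀ n m, n < 0 → I (n, m) = 0
  high : ∀ n m, D ≤ n → I (n, m) = 0
  right : ∀ n m, N ≤ m → I (n, m + per) = I (n, m)
  left : ∀ n m, m ≤ -N → I (n, m - per) = I (n, m)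

lemma Good.step {per D N d L : ℤ} {I : ℤ × ℤ → F} (h : Good per D N I)
    (v : ι → ℤ × ℤ) (c : ι → F) (hd : 0 ≤ d) (hL : 0 ≤ L)
    (hv : ∀ i, 1 ≤ (v i).1 ∧ (v i).1 ≤ d ∧ -L ≤ (v i).2 ∧ (v i).2 ≤ L) :
    Good per (D + d) (N + L) (act (pol v c) I) := by
  have key : ∀ n m n' m', I (n, m) = I (n', m') →
      (∀ i, I ((n, m) - v i) = I ((n', m') - v i)) →
      act (pol v c) I (n, m) = act (pol v c) I (n', m') := by
    intro n m n' m' h1 h2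
    rw [act_pol, act_pol, h1]
    simp_rw [h2]
  have keyz : ∀ n m, I (n, m) = 0 → (∀ i, I ((n, m) - v i) = 0) →
      act (pol v c) I (n, m) = 0 := by
    intro n m h1 h2
    rw [act_pol, h1]
    simp [h2]
  constructor
  · intro n m hn
    refine keyz _ _ (h.low _ _ hn) fun i => ?_
    have := hv i
    exact h.low _ _ (by simp only; omega)
  · intro n m hn
    refine keyz _ _ (h.high _ _ (by omega)) fun i => ?_
    have := hv i
    exact h.high _ _ (by simp only; omega)
  · intro n m hm
    refine key _ _ _ _ (h.right _ _ (by omega)) fun i => ?_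
    have := hv i
    have := h.right (n - (v i).1) (m - (v i).2) (by omega)
    convert this using 2
    · ext
      · rfl
      · simp only [Prod.snd_sub]
        ring
    · rfl
  · intro n m hm
    refine key _ _ _ _ (h.left _ _ (by omega)) fun i => ?_
    have := hv i
    have := h.left (n - (v i).1) (m - (v i).2) (by omega)
    convert this using 2
    · ext
      · rfl
      · simp only [Prod.snd_sub]
        ring
    · rfl

lemma Good.steps {per D N d L : ℤ} {I : ℤ × ℤ → F} (h : Good per D N I)
    (v : ι → ℤ × ℤ) (c : ι → F) (hd : 0 ≤ d) (hL : 0 ≤ L)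
    (hv : ∀ i, 1 ≤ (v i).1 ∧ (v i).1 ≤ d ∧ -L ≤ (v i).2 ∧ (v i).2 ≤ L) (k : ℕ) :
    Good per (D + k * d) (N + k * L) (act (pol v c ^ k) I) := by
  induction k with
  | zero => simpa using h
  | succ k ih =>
    have := ih.step v c hd hL hv
    rw [pow_succ', map_mul, Module.End.mul_apply]
    convert this using 1 <;> push_cast <;> ring

lemma good_finite [Finite F] {per D N : ℤ} (hper : 1 ≤ per) (hN : 0 ≤ N) :
    {I : ℤ × ℤ → F | Good per D N I}.Finite := by
  let W := Finset.Ico (0 : ℤ) D ×ˢ Finset.Icc (-(N + per)) (N + per)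
  let res : (ℤ × ℤ → F) → (W → F) := fun I w => I w
  refine Set.Finite.of_finite_image (f := res) (Set.toFinite _) ?_
  intro I hI J hJ hIJ
  simp only [Set.mem_ofPred_eq] at hI hJ
  have base : ∀ n m, 0 ≤ n → n < D → -(N + per) ≤ m → m ≤ N + per → I (n, m) = J (n, m) := by
    intro n m h1 h2 h3 h4
    have hmem : (n, m) ∈ W := by
      simp only [W, Finset.mem_product, Finset.mem_Ico, Finset.mem_Icc]
      exact ⟨⟨h1, h2⟩, h3, h4⟩
    exact congrFun hIJ ⟨(n, m), hmem⟩
  have main : ∀ k : ℕ, ∀ n m, 0 ≤ n → n < D → -(N + per + k) ≤ m → m ≤ N + per + k →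
      I (n, m) = J (n, m) := by
    intro k
    induction k with
    | zero =>
      intro n m h1 h2 h3 h4
      exact base n m h1 h2 (by simpa using h3) (by simpa using h4)
    | succ k ih =>
      intro n m h1 h2 h3 h4
      push_cast at h3 h4
      by_cases hr : N + per < m
      · have e1 := hI.right n (m - per) (by omega)
        have e2 := hJ.right n (m - per) (by omega)
        rw [sub_add_cancel] at e1 e2
        rw [e1, e2]
        exact ih _ _ h1 h2 (by omega) (by omega)
      · by_cases hl : m < -(N + per)
        · have e1 := hI.left n (m + per) (by omega)
          have e2 := hJ.left n (m + per) (by omega)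
          rw [add_sub_cancel_right] at e1 e2
          rw [e1, e2]
          exact ih _ _ h1 h2 (by omega) (by omega)
        · exact base n m h1 h2 (by omega) (by omega)
  funext ⟨n, m⟩
  by_cases h1 : n < 0
  · rw [hI.low _ _ h1, hJ.low _ _ h1]
  by_cases h2 : D ≤ n
  · rw [hI.high _ _ h2, hJ.high _ _ h2]
  exact main m.natAbs n m (by omega) (by omega) (by omega) (by omega)

lemma act_inj (v : ι → ℤ × ℤ) (c : ι → F) (hv : ∀ i, 1 ≤ (v i).1) (R R' : ℤ × ℤ → F)
    (hR : ∀ n m, n < 0 → R (n, m) = 0) (hR' : ∀ n m, n < 0 → R' (n, m) = 0)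
    (h : act (pol v c) R = act (pol v c) R') : R = R' := by
  have main : ∀ k : ℕ, ∀ n m : ℤ, n < k → R (n, m) = R' (n, m) := by
    intro k
    induction k with
    | zero =>
      intro n m hn
      rw [hR _ _ (by simpa using hn), hR' _ _ (by simpa using hn)]
    | succ k ih =>
      intro n m hn
      push_cast at hn
      have := congrFun h (n, m)
      rw [act_pol, act_pol] at this
      have e : ∀ i, R ((n, m) - v i) = R' ((n, m) - v i) := by
        intro i
        have := hv i
        exact ih _ _ (by simp only; omega)
      simp_rw [e] at this
      exact sub_left_injective this
  funext ⟨n, m⟩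
  exact main (n.natAbs + 1) n m (by omega)

/-- The finite family of arrays. -/
def fam (v : ι → ℤ × ℤ) (per D N : ℤ) : Set (ℤ × ℤ → F) :=
  {R | (∀ n m, n < 0 → R (n, m) = 0) ∧ ∃ c : ι → F, Good per D N (act (pol v c) R)}

lemma fam_finite [Finite F] (v : ι → ℤ × ℤ) (hv : ∀ i, 1 ≤ (v i).1) {per D N : ℤ}
    (hper : 1 ≤ per) (hN : 0 ≤ N) : (fam (F := F) v per D N).Finite := by
  have : fam (F := F) v per D N ⊆ ⋃ c : ι → F,
      {R | (∀ n m, n < 0 → R (n, m) = 0) ∧ Good per D N (act (pol v c) R)} := by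
    rintro R ⟨h, c, hc⟩
    exact Set.mem_iUnion.2 ⟨c, h, hc⟩
  refine Set.Finite.subset (Set.finite_iUnion fun c => ?_) this
  refine Set.Finite.of_finite_image (f := fun R => act (pol v c) R)
    ((good_finite (F := F) (D := D) hper hN).subset ?_) ?_
  · rintro _ ⟨R, ⟨_, h⟩, rfl⟩
    exact h
  · rintro R ⟨h, _⟩ R' ⟨h', _⟩ e
    exact act_inj v c hv R R' h h' e

lemma right_mul {B : Type*} (g : ℤ → B) (N per : ℤ) (hper : 0 ≤ per)
    (h : ∀ m, N ≤ m → g (m + per) = g m) (k : ℕ) (m : ℤ) (hm : N ≤ m) :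
    g (m + k * per) = g m := by
  induction k with
  | zero => simp
  | succ k ih =>
    rw [← ih, ← h (m + k * per) (by nlinarith [mul_nonneg (Int.natCast_nonneg k) hper])]
    congr 1
    push_cast
    ring

lemma left_mul {B : Type*} (g : ℤ → B) (N per : ℤ) (hper : 0 ≤ per)
    (h : ∀ m, m ≤ -N → g (m - per) = g m) (k : ℕ) (m : ℤ) (hm : m ≤ -N) :
    g (m - k * per) = g m := by
  induction k with
  | zero => simp
  | succ k ih =>
    rw [← ih, ← h (m - k * per) (by nlinarith [mul_nonneg (Int.natCast_nonneg k) hper])]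
    congr 1
    push_cast
    ring

lemma common_period {B : Type*} (R : ℕ → ℤ → B) (d : ℕ)
    (h : ∀ i, i < d → EventuallyPeriodicBoth (R i)) :
    ∃ N per : ℕ, 1 ≤ per ∧ ∀ i < d, (∀ m : ℤ, (N : ℤ) ≤ m → R i (m + per) = R i m) ∧
      (∀ m : ℤ, m ≤ -(N : ℤ) → R i (m - per) = R i m) := by
  induction d with
  | zero => exact ⟨0, 1, le_rfl, fun i hi => absurd hi (Nat.not_lt_zero i)⟩
  | succ d ih =>
    obtain ⟨N1, q1, hq1, h1⟩ := ih fun i hi => h i (by omega)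
    obtain ⟨N2, q2, hq2, hr, hl⟩ := h d (by omega)
    refine ⟨N1 + N2, q1 * q2, Nat.mul_pos hq1 hq2, fun i hi => ?_⟩
    rcases Nat.lt_succ_iff_lt_or_eq.1 hi with hi | rfl
    · obtain ⟨hr1, hl1⟩ := h1 i hi
      constructor
      · intro m hm
        have := right_mul (R i) N1 q1 (by omega) hr1 q2 m (by push_cast at hm; omega)
        rw [← this]; push_cast; congr 2; ring
      · intro m hm
        have := left_mul (R i) N1 q1 (by omega) hl1 q2 m (by push_cast at hm; omega)
        rw [← this]; push_cast; congr 2; ring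
    · constructor
      · intro m hm
        have := right_mul (R i) N2 q2 (by omega) hr q1 m (by push_cast at hm; omega)
        rw [← this]; push_cast; rfl
      · intro m hm
        have := left_mul (R i) N2 q2 (by omega) hl q1 m (by push_cast at hm; omega)
        rw [← this]; push_cast; rfl

lemma fam_closed (p : ℕ) [hp : Fact p.Prime] [CharP F p] (v : ι → ℤ × ℤ) {per d N L : ℤ}
    (hper : 0 ≤ per) (hd : 0 ≤ d) (hL : 0 ≤ L) (hN : L + 1 ≤ N)
    (hv : ∀ i, 1 ≤ (v i).1 ∧ (v i).1 ≤ d ∧ -L ≤ (v i).2 ∧ (v i).2 ≤ L)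
    (R : ℤ × ℤ → F) (hR : R ∈ fam v per d N) (a b : ℤ) (ha : 0 ≤ a) (hap : a < p)
    (hb : 0 ≤ b) (hbp : b < p) :
    (fun w : ℤ × ℤ => R (p * w.1 + a, p * w.2 + b)) ∈ fam v per d N := by
  obtain ⟨h0, c, hc⟩ := hR
  have hp1 : (1 : ℤ) ≤ p := by exact_mod_cast hp.out.one_lt.le
  refine ⟨fun n m hn => h0 _ _ (by simp only; nlinarith), fun i => c i ^ p, ?_⟩
  set J := act (pol v c ^ (p - 1)) (act (pol v c) R) with hJ
  have hg : Good per (d + (p - 1 : ℕ) * d) (N + (p - 1 : ℕ) * L) J := hc.steps v c hd hL hv (p - 1)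
  rw [Nat.cast_sub hp.out.one_lt.le, Nat.cast_one] at hg
  have hJ2 : J = act (pol (fun i => p • v i) (fun i => c i ^ p)) R := by
    rw [hJ, ← Module.End.mul_apply, ← map_mul, ← pow_succ, Nat.sub_add_cancel hp.out.one_lt.le,
      pol_pow]
  have key : act (pol v fun i => c i ^ p) (fun w : ℤ × ℤ => R (p * w.1 + a, p * w.2 + b))
      = fun w : ℤ × ℤ => J (p * w.1 + a, p * w.2 + b) := by
    funext w
    rw [hJ2, act_pol, act_pol]
    congr 1
    refine Finset.sum_congr rfl fun i _ => ?_
    congr 2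
    ext <;> simp <;> ring
  rw [key]
  constructor
  · intro n m hn
    exact hg.low _ _ (by simp only; nlinarith)
  · intro n m hn
    exact hg.high _ _ (by simp only; nlinarith)
  · intro n m hm
    have := right_mul (fun m => J (p * n + a, m)) (N + (p - 1) * L) per hper
      (fun m hm => hg.right _ m hm) p (p * m + b) (by nlinarith)
    simp only at this ⊢
    rw [← this]
    congr 2
    ring
  · intro n m hm
    have := left_mul (fun m => J (p * n + a, m)) (N + (p - 1) * L) per hper
      (fun m hm => hg.left _ m hm) p (p * m + b) (by nlinarith)
    simp only at this ⊢
    rw [← this]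
    congr 2
    ring

lemma automatic_of_finite {A : Type*} (p : ℕ) (hp : 1 < p) (K : Set (ℕ → A)) (hK : K.Finite)
    (hcl : ∀ u ∈ K, ∀ a < p, (fun n => u (p * n + a)) ∈ K) (u : ℕ → A) (hu : u ∈ K) :
    IsKAutomatic p u := by
  classical
  have := hK.to_subtype
  obtain ⟨k, ⟨e⟩⟩ := Finite.exists_equiv_fin K
  let δ : K → ℕ → K := fun s a =>
    if h : a < p then ⟨fun n => s.1 (p * n + a), hcl s.1 s.2 a h⟩ else s
  have main : ∀ n : ℕ, ∀ s : K, s.1 n = ((Nat.digits p n).foldl δ s).1 0 := by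
    intro n
    induction n using Nat.strong_induction_on with
    | _ n ih =>
      intro s
      rcases Nat.eq_zero_or_pos n with rfl | hn
      · simp
      · rw [Nat.digits_def' hp hn, List.foldl_cons, ← ih _ (Nat.div_lt_self hn hp)]
        simp only [δ, dif_pos (Nat.mod_lt n (by omega : p > 0))]
        rw [Nat.div_add_mod]
  refine ⟨Fin k, inferInstance, e ⟨u, hu⟩, fun s a => e (δ (e.symm s) a),
    fun s => (e.symm s).1 0, fun n => ?_⟩
  have conj : ∀ (l : List ℕ) (s : K),
      l.foldl (fun s a => e (δ (e.symm s) a)) (e s) = e (l.foldl δ s) := by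
    intro l
    induction l with
    | nil => intro s; rfl
    | cons a l ih => intro s; simp [ih]
  rw [conj]
  simp only [Equiv.symm_apply_apply]
  exact main n ⟨u, hu⟩

end CAaux

/-- Every column of a spacetime diagram of a linear cellular automaton with memory `d`
over `F_q`, begun from initial rows that are eventually periodic in both directions,
is `p`-automatic. -/
theorem column_of_linear_CA_is_automatic
    (p : ℕ) (hp : p.Prime) (Fq : Type*) [Field Fq] [Fintype Fq] (hchar : CharP Fq p)
    (d l r : ℕ) (hd : 1 ≤ d) (f : ℤ → ℕ → Fq) (R : ℕ → ℤ → Fq)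
    (hinit : ∀ i, i < d → EventuallyPeriodicBoth (R i))
    (hrec : ∀ n, d ≤ n → ∀ m : ℤ,
      R n m = ∑ i ∈ Finset.Icc 1 d, ∑ j ∈ Finset.Icc (-(l : ℤ)) (r : ℤ),
        f j i * R (n - i) (m + j)) :
    ∀ m : ℤ, IsKAutomatic p (fun n => R n m) := by
  intro m₀
  have : Fact p.Prime := ⟨hp⟩
  obtain ⟨N₀, per, hper, hP⟩ := CAaux.common_period R d hinit
  let s := Finset.Icc 1 d ×ˢ Finset.Icc (-(l : ℤ)) (r : ℤ)
  let v : s → ℤ × ℤ := fun i => ((i.1.1 : ℤ), -i.1.2)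
  let c : s → Fq := fun i => f i.1.2 i.1.1
  let L : ℤ := l + r
  have hv : ∀ i, 1 ≤ (v i).1 ∧ (v i).1 ≤ d ∧ -L ≤ (v i).2 ∧ (v i).2 ≤ L := by
    rintro ⟨⟨i, j⟩, hi⟩
    simp only [s, Finset.mem_product, Finset.mem_Icc] at hi
    simp only [v, L]
    omega
  let E : ℤ × ℤ → Fq := fun w => if w.1 < 0 then 0 else R w.1.toNat w.2
  have hE0 : ∀ n m, n < 0 → E (n, m) = 0 := fun n m hn => by simp [E, hn]
  have hE1 : ∀ (n : ℕ) m, E (n, m) = R n m := fun n m => by simp [E]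
  have hEr : ∀ n m : ℤ, n < d → (N₀ : ℤ) ≤ m → E (n, m + per) = E (n, m) := by
    intro n m hn hm
    by_cases h : n < 0
    · rw [hE0 _ _ h, hE0 _ _ h]
    · lift n to ℕ using by omega
      rw [hE1, hE1]
      exact (hP n (by omega)).1 m hm
  have hEl : ∀ n m : ℤ, n < d → m ≤ -(N₀ : ℤ) → E (n, m - per) = E (n, m) := by
    intro n m hn hm
    by_cases h : n < 0
    · rw [hE0 _ _ h, hE0 _ _ h]
    · lift n to ℕ using by omega
      rw [hE1, hE1]
      exact (hP n (by omega)).2 m hm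
  have hhigh : ∀ n m : ℤ, (d : ℤ) ≤ n → CAaux.act (CAaux.pol v c) E (n, m) = 0 := by
    intro n m hn
    lift n to ℕ using by omega
    rw [CAaux.act_pol, hE1, hrec n (by omega) m, sub_eq_zero, ← Finset.sum_product',
      ← Finset.sum_coe_sort]
    refine Finset.sum_congr rfl fun i _ => ?_
    have hi := i.2
    simp only [Finset.mem_product, Finset.mem_Icc] at hi
    rw [← hE1, Nat.cast_sub (by omega)]
    simp only [c]
    congr 2
    ext
    · rfl
    · simp [v]
  have hfam : E ∈ CAaux.fam v (per : ℤ) (d : ℤ) (N₀ + L + 1) := by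
    refine ⟨hE0, c, ?_, hhigh, ?_, ?_⟩
    · intro n m hn
      rw [CAaux.act_pol, hE0 _ _ hn, Finset.sum_eq_zero, sub_zero]
      intro i _
      have := hv i
      rw [show (n, m) - v i = (n - (v i).1, m - (v i).2) from rfl, hE0 _ _ (by omega), mul_zero]
    · intro n m hm
      by_cases hn : (d : ℤ) ≤ n
      · rw [hhigh _ _ hn, hhigh _ _ hn]
      · rw [CAaux.act_pol, CAaux.act_pol, hEr _ _ (by omega) (by omega)]
        congr 1
        refine Finset.sum_congr rfl fun i _ => ?_
        have := hv i
        rw [show (n, m + (per : ℤ)) - v i = (n - (v i).1, m - (v i).2 + per) by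
          ext <;> simp; ring,
          hEr _ _ (by omega) (by omega)]
        rfl
    · intro n m hm
      by_cases hn : (d : ℤ) ≤ n
      · rw [hhigh _ _ hn, hhigh _ _ hn]
      · rw [CAaux.act_pol, CAaux.act_pol, hEl _ _ (by omega) (by omega)]
        congr 1
        refine Finset.sum_congr rfl fun i _ => ?_
        have := hv i
        rw [show (n, m - (per : ℤ)) - v i = (n - (v i).1, m - (v i).2 - per) by
          ext <;> simp; ring,
          hEl _ _ (by omega) (by omega)]
        rfl
  have hfin := CAaux.fam_finite (F := Fq) v (fun i => (hv i).1) (per := (per : ℤ)) (D := (d : ℤ))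
    (N := N₀ + L + 1) (by omega) (by omega)
  let M : ℤ := m₀.natAbs
  let K : Set (ℕ → Fq) := Set.image2 (fun (T : ℤ × ℤ → Fq) (m : ℤ) => fun n : ℕ => T ((n : ℤ), m))
    (CAaux.fam v (per : ℤ) (d : ℤ) (N₀ + L + 1)) (Set.Icc (-M) M)
  have hp0 : (0 : ℤ) < p := by exact_mod_cast hp.pos
  refine CAaux.automatic_of_finite p hp.one_lt K (hfin.image2 _ (Set.finite_Icc _ _)) ?_ _
    ⟨E, hfam, m₀, ⟨by omega, by omega⟩, funext fun n => hE1 n m₀⟩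
  rintro _ ⟨T, hT, m, ⟨hm1, hm2⟩, rfl⟩ a ha
  refine ⟨_, CAaux.fam_closed p v (by omega) (by omega) (by omega : 0 ≤ L) (by omega) hv T hT a
    (m % p) (by omega) (by omega) (Int.emod_nonneg _ hp0.ne') (Int.emod_lt_of_pos _ hp0),
    m / p, ⟨?_, ?_⟩, ?_⟩
  · rw [Int.le_ediv_iff_mul_le hp0]
    nlinarith
  · refine Int.ediv_le_of_le_mul hp0 ?_
    nlinarith
  · funext n
    simp only [Int.mul_ediv_add_emod]
    push_cast
    rfl
end

section
/- Let p be a prime and F_q a finite field of characteristic p. If u : ℕ → F_q is a p-automatic sequence, then there exist d ≥ 1, radii l, r ≥ 0, coefficients f_{j,i} ∈ F_q (−l ≤ j ≤ r, 1 ≤ i ≤ d), initial rows R_0, …, R_{d−1} : ℤ → F_q each having only finitely many nonzero entries, and a column index m₀ ∈ ℤ, such that the spacetime diagram of the corresponding linear cellular automaton with memory d satisfies R_n(m₀) = u(n) for all n ≥ 0. -/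
open PowerSeries

lemma aux_coeff_pow_card {F : Type*} [Field F] [Fintype F] (U : PowerSeries F) (n : ℕ) :
    coeff n (U ^ Fintype.card F) =
      if Fintype.card F ∣ n then coeff (n / Fintype.card F) U else 0 := by
  have h1 : coeff n (U ^ Fintype.card F) =
      coeff n (((trunc (n+1) U : Polynomial F) : PowerSeries F) ^ Fintype.card F) := by
    have := congrArg (fun P => Polynomial.coeff P n) (trunc_trunc_pow U (n+1) (Fintype.card F))
    simp only [coeff_trunc, Nat.lt_succ_self, if_true] at this
    exact this.symm
  rw [h1, ← Polynomial.coe_pow, ← FiniteField.expand_card, Polynomial.coeff_coe,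
    Polynomial.coeff_expand Fintype.card_pos, coeff_trunc]
  have : n / Fintype.card F < n + 1 := Nat.lt_succ_of_le (Nat.div_le_self _ _)
  simp [this]

lemma aux_coeff_decomp {F : Type*} [Field F] [Fintype F] (c : ℕ → PowerSeries F) (m : ℕ) :
    coeff m (∑ s ∈ Finset.range (Fintype.card F), X ^ s * (c s) ^ Fintype.card F) =
      coeff (m / Fintype.card F) (c (m % Fintype.card F)) := by
  have hq : 0 < Fintype.card F := Fintype.card_pos
  set q := Fintype.card F with hqd
  rw [map_sum, Finset.sum_eq_single (m % q)]
  · rw [coeff_X_pow_mul', if_pos (Nat.mod_le _ _), aux_coeff_pow_card, ← hqd,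
      if_pos (Nat.dvd_sub_mod m)]
    congr 1
    rw [Nat.sub_eq_of_eq_add (Nat.div_add_mod m q).symm, Nat.mul_div_cancel_left _ hq]
  · intro b hb hbm
    rw [coeff_X_pow_mul']
    split_ifs with h
    · rw [aux_coeff_pow_card, ← hqd, if_neg]
      intro hd
      apply hbm
      have := (Nat.modEq_iff_dvd' h).2 hd
      rw [← this, Nat.mod_eq_of_lt (Finset.mem_range.1 hb)]
    · rfl
  · intro h
    exact absurd (Finset.mem_range.2 (Nat.mod_lt _ hq)) h

/-- decimation -/
noncomputable def auxDec (q r : ℕ) {F : Type*} [Field F] : PowerSeries F →ₗ[F] PowerSeries F where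
  toFun f := mk fun n => coeff (q * n + r) f
  map_add' f g := by ext; simp
  map_smul' f g := by ext; simp

lemma aux_decomp {F : Type*} [Field F] [Fintype F] (f : PowerSeries F) :
    f = ∑ s ∈ Finset.range (Fintype.card F),
      X ^ s * (auxDec (Fintype.card F) s f) ^ Fintype.card F := by
  ext m
  rw [aux_coeff_decomp]
  simp [auxDec, Nat.div_add_mod]

lemma aux_dec_mul {F : Type*} [Field F] [Fintype F] (A B : PowerSeries F) (r : ℕ)
    (hr : r < Fintype.card F) :
    auxDec (Fintype.card F) r (A * B ^ Fintype.card F) = auxDec (Fintype.card F) r A * B := by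
  have hq : 0 < Fintype.card F := Fintype.card_pos
  have : A * B ^ Fintype.card F = ∑ s ∈ Finset.range (Fintype.card F),
      X ^ s * (auxDec (Fintype.card F) s A * B) ^ Fintype.card F := by
    conv_lhs => rw [aux_decomp A]
    rw [Finset.sum_mul]
    refine Finset.sum_congr rfl fun s _ => ?_
    rw [mul_pow]; ring
  ext n
  conv_lhs => rw [this]
  simp only [auxDec, LinearMap.coe_mk, AddHom.coe_mk, coeff_mk]
  have h := aux_coeff_decomp (F := F) (fun s => auxDec (Fintype.card F) s A * B)
    (Fintype.card F * n + r)
  simp only [auxDec, LinearMap.coe_mk, AddHom.coe_mk] at h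
  rw [h, Nat.mul_add_mod, Nat.mod_eq_of_lt hr, Nat.mul_add_div hq, Nat.div_eq_of_lt hr, add_zero]

lemma aux_dec_poly {F : Type*} [Field F] (q r : ℕ) (hq : 0 < q) (A : Polynomial F) :
    ∃ B : Polynomial F, (B : PowerSeries F) = auxDec q r (A : PowerSeries F) := by
  refine ⟨trunc (A.natDegree + 1) (auxDec q r (A : PowerSeries F)), ?_⟩
  ext n
  rw [Polynomial.coeff_coe, coeff_trunc]
  split_ifs with h
  · rfl
  · simp only [auxDec, LinearMap.coe_mk, AddHom.coe_mk, coeff_mk, Polynomial.coeff_coe]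
    rw [Polynomial.coeff_eq_zero_of_natDegree_lt]
    nlinarith

/-- A relation with nonzero lowest coefficient. -/
lemma aux_reduce {F : Type*} [Field F] [Fintype F] (U : PowerSeries F) (k : ℕ) :
    ∀ A : ℕ → Polynomial F,
      ∑ i ∈ Finset.range k, (A i : PowerSeries F) * U ^ (Fintype.card F) ^ i = 0 →
      (∃ i < k, A i ≠ 0) →
      ∃ (k' : ℕ) (B : ℕ → Polynomial F), B 0 ≠ 0 ∧
        ∑ i ∈ Finset.range (k' + 1), (B i : PowerSeries F) * U ^ (Fintype.card F) ^ i = 0 := by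
  have hq : 0 < Fintype.card F := Fintype.card_pos
  induction k with
  | zero => rintro A - ⟨i, hi, -⟩; omega
  | succ k ih =>
    rintro A hA ⟨i, hi, hAi⟩
    by_cases h0 : A 0 = 0
    · obtain ⟨i, rfl⟩ : ∃ j, i = j + 1 := by
        cases i with
        | zero => exact absurd h0 hAi
        | succ j => exact ⟨j, rfl⟩
      obtain ⟨m, hm⟩ : ∃ m, (A (i+1)).coeff m ≠ 0 := by
        by_contra! h
        exact hAi (Polynomial.ext (by simpa using h))
      set q := Fintype.card F with hqd
      set r := m % q with hr
      choose B hB using fun j => aux_dec_poly q r hq (A j)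
      refine ih (fun j => B (j+1)) ?_ ⟨i, by omega, ?_⟩
      · rw [Finset.sum_range_succ', h0] at hA
        have := congrArg (auxDec q r) hA
        simp only [Polynomial.coe_zero, zero_mul, add_zero, map_sum, map_zero] at this
        rw [← this]
        refine Finset.sum_congr rfl fun j _ => ?_
        rw [hB, pow_succ, pow_mul]
        exact (aux_dec_mul _ _ r (Nat.mod_lt _ hq)).symm
      · intro h
        have := congrArg (coeff (m / q)) (hB (i+1))
        simp only [h, Polynomial.coe_zero, map_zero, auxDec, LinearMap.coe_mk, AddHom.coe_mk,
          coeff_mk, Polynomial.coeff_coe, hr, Nat.div_add_mod] at this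
        exact hm this.symm
    · exact ⟨k, A, h0, hA⟩

lemma aux_dec_comp {F : Type*} [Field F] (W : Submodule F (PowerSeries F)) (p : ℕ) (hp : 0 < p)
    (hW : ∀ r < p, ∀ w ∈ W, auxDec p r w ∈ W) (e : ℕ) :
    ∀ r < p ^ e, ∀ w ∈ W, auxDec (p ^ e) r w ∈ W := by
  induction e with
  | zero =>
    intro r hr w hw
    have : auxDec (p ^ 0) r w = w := by
      ext n
      have : r = 0 := by simpa using hr
      simp [auxDec, this]
    rwa [this]
  | succ e ih =>
    intro r hr w hw
    have hpe : 0 < p ^ e := pow_pos hp e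
    have : auxDec (p ^ (e + 1)) r w = auxDec p (r / p ^ e) (auxDec (p ^ e) (r % p ^ e) w) := by
      ext n
      simp only [auxDec, LinearMap.coe_mk, AddHom.coe_mk, coeff_mk]
      congr 2
      conv_lhs => rw [← Nat.div_add_mod r (p ^ e)]
      ring
    rw [this]
    refine hW _ ?_ _ (ih _ (Nat.mod_lt _ hpe) _ hw)
    rw [Nat.div_lt_iff_lt_mul hpe]
    rwa [pow_succ'] at hr

lemma aux_span_pow {F : Type*} [Field F] (p : ℕ) [Fact p.Prime] [CharP (PowerSeries F) p]
    (S : Set (PowerSeries F)) (n : ℕ) (w : PowerSeries F)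
    (hw : w ∈ Submodule.span (Polynomial F) S) :
    w ^ p ^ n ∈ Submodule.span (Polynomial F) ((fun v => v ^ p ^ n) '' S) := by
  induction hw using Submodule.span_induction with
  | mem x hx => exact Submodule.subset_span ⟨x, hx, rfl⟩
  | zero =>
    rw [zero_pow (pow_ne_zero _ (Fact.out : p.Prime).ne_zero)]
    exact zero_mem _
  | add x y _ _ hx hy => rw [add_pow_char_pow]; exact add_mem hx hy
  | smul a x _ hx =>
    rw [Algebra.smul_def, mul_pow, ← map_pow, ← Algebra.smul_def]
    exact Submodule.smul_mem _ _ hx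

lemma aux_alg {F : Type*} [Field F] (a : Polynomial F) (x : PowerSeries F) :
    a • x = (a : PowerSeries F) * x := by
  rw [Algebra.smul_def, PowerSeries.algebraMap_apply']
  simp

lemma aux_relation {F : Type*} [Field F] [Fintype F] (p e : ℕ) [Fact p.Prime]
    [CharP (PowerSeries F) p] (hq : Fintype.card F = p ^ e)
    (W : Submodule F (PowerSeries F)) (hfg : W.FG)
    (hW : ∀ r < Fintype.card F, ∀ w ∈ W, auxDec (Fintype.card F) r w ∈ W)
    (U : PowerSeries F) (hU : U ∈ W) :
    ∃ (k : ℕ) (A : ℕ → Polynomial F),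
      ∑ i ∈ Finset.range k, (A i : PowerSeries F) * U ^ (Fintype.card F) ^ i = 0 ∧
      (∃ i < k, A i ≠ 0) := by
  classical
  obtain ⟨t, ht⟩ := hfg
  set q := Fintype.card F with hqd
  have key : ∀ k : ℕ, ∀ w ∈ W, w ∈ Submodule.span (Polynomial F)
      ((fun v => v ^ q ^ k) '' (t : Set (PowerSeries F))) := by
    intro k
    induction k with
    | zero =>
      intro w hw
      rw [← ht] at hw
      simp only [pow_zero, pow_one, Set.image_id']
      induction hw using Submodule.span_induction with
      | mem x hx => exact Submodule.subset_span hx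
      | zero => exact zero_mem _
      | add x y _ _ hx hy => exact add_mem hx hy
      | smul a x _ hx =>
        have : a • x = (Polynomial.C a) • x := by
          rw [aux_alg, Polynomial.coe_C, smul_eq_C_mul]
        rw [this]
        exact Submodule.smul_mem _ _ hx
    | succ k ih =>
      intro w hw
      rw [aux_decomp w]
      refine Submodule.sum_mem _ fun s hs => ?_
      have h1 := ih _ (hW s (Finset.mem_range.1 hs) w hw)
      have h2 := aux_span_pow p _ e _ h1
      rw [← hq, Set.image_image] at h2
      simp only [← pow_mul, ← pow_succ] at h2
      have h3 := Submodule.smul_mem _ (Polynomial.X ^ s : Polynomial F) h2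
      rw [aux_alg] at h3
      simpa using h3
  set D := t.card with hD
  by_contra! hcon
  have hli : LinearIndependent (Polynomial F) (fun i : Fin (D + 1) => U ^ q ^ (i : ℕ)) := by
    rw [Fintype.linearIndependent_iff]
    intro g hg i
    by_contra hne
    refine hne ?_
    have := hcon (D + 1) (fun j => if h : j < D + 1 then g ⟨j, h⟩ else 0) ?_ i i.2
    · rwa [dif_pos i.2] at this
    · rw [Finset.sum_range, ← hg]
      refine Finset.sum_congr rfl fun j _ => ?_
      rw [dif_pos j.2, aux_alg]
  have hsp : Set.range (fun i : Fin (D + 1) => U ^ q ^ (i : ℕ)) ≤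
      Submodule.span (Polynomial F)
        ((t.image (fun v => v ^ q ^ D) : Finset (PowerSeries F)) : Set (PowerSeries F)) := by
    rintro _ ⟨i, rfl⟩
    have h1 := key (D - i) U hU
    have h2 := aux_span_pow p _ (e * i) _ h1
    rw [pow_mul, ← hq, Set.image_image] at h2
    simp only [← pow_mul, ← pow_add] at h2
    rw [Nat.sub_add_cancel (by omega)] at h2
    simpa using h2
  have := linearIndependent_le_span_aux' _ hli _ hsp
  simp only [Fintype.card_fin, Fintype.card_coe, Finset.coe_sort_coe] at this
  have := Finset.card_image_le (s := t) (f := fun v => v ^ q ^ D)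
  omega

lemma aux_auto_space {F : Type*} [Field F] (p : ℕ) (hp : 1 < p) (u : ℕ → F)
    (hu : ∃ (S : Type) (_ : Fintype S) (s₀ : S) (δ : S → ℕ → S) (ω : S → F),
      ∀ n : ℕ, u n = ω ((Nat.digits p n).foldl δ s₀)) :
    ∃ W : Submodule F (PowerSeries F), W.FG ∧ (∀ r < p, ∀ w ∈ W, auxDec p r w ∈ W) ∧
      mk u ∈ W := by
  obtain ⟨S, _, s₀, δ, ω, hu⟩ := hu
  let U : S → PowerSeries F := fun s => mk fun n => ω ((Nat.digits p n).foldl δ s)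
  refine ⟨Submodule.span F (insert 1 (Set.range U)),
    Submodule.fg_span ((Set.finite_range U).insert 1), ?_, ?_⟩
  · intro r hr w hw
    have hone : (1 : PowerSeries F) ∈ Submodule.span F (insert 1 (Set.range U)) :=
      Submodule.subset_span (Set.mem_insert _ _)
    induction hw using Submodule.span_induction with
    | mem x hx =>
      rcases hx with rfl | ⟨s, rfl⟩
      · have : auxDec p r (1 : PowerSeries F) = (if r = 0 then (1 : F) else 0) • 1 := by
          ext n
          simp only [auxDec, LinearMap.coe_mk, AddHom.coe_mk, coeff_mk, coeff_one, coeff_smul]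
          have : p ≠ 0 := by omega
          by_cases h : r = 0 <;> by_cases h' : n = 0 <;> simp [h, h', this]
        rw [this]
        exact Submodule.smul_mem _ _ hone
      · have : auxDec p r (U s) = U (δ s r) + (if r = 0 then ω s - ω (δ s r) else 0) • 1 := by
          ext n
          simp only [auxDec, LinearMap.coe_mk, AddHom.coe_mk, coeff_mk, coeff_one, map_add,
            coeff_smul, U]
          by_cases h : r = 0 ∧ n = 0
          · obtain ⟨rfl, rfl⟩ := h
            simp
          · have h2 : r ≠ 0 ∨ n ≠ 0 := by tauto
            rw [add_comm (p * n) r, Nat.digits_add p hp r n hr h2]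
            rcases h2 with h2 | h2 <;> simp [h2]
        rw [this]
        exact add_mem (Submodule.subset_span (Set.mem_insert_of_mem _ ⟨_, rfl⟩))
          (Submodule.smul_mem _ _ hone)
    | zero => rw [map_zero]; exact zero_mem _
    | add x y _ _ hx hy => rw [map_add]; exact add_mem hx hy
    | smul a x _ hx => rw [map_smul]; exact Submodule.smul_mem _ _ hx
  · refine Submodule.subset_span (Set.mem_insert_of_mem _ ⟨s₀, ?_⟩)
    ext n
    simp [U, hu]

lemma aux_normalize {F : Type*} [Field F] (p e : ℕ) [Fact p.Prime]
    [CharP (PowerSeries F) p] (q : ℕ) (hq : q = p ^ e) (hq2 : 2 ≤ q)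
    (U : PowerSeries F) (k : ℕ) (A : ℕ → Polynomial F) (hA0 : A 0 ≠ 0)
    (hrel : ∑ i ∈ Finset.range (k + 1), (A i : PowerSeries F) * U ^ q ^ i = 0) :
    ∃ (N : ℕ) (T : Polynomial F) (V : PowerSeries F) (a c : Polynomial F)
      (b : ℕ → Polynomial F),
      U = X ^ N * V + (T : PowerSeries F) ∧ constantCoeff V = 0 ∧ a.coeff 0 ≠ 0 ∧
      (a : PowerSeries F) * V +
        X * ∑ i ∈ Finset.range k, (b i : PowerSeries F) * V ^ q ^ (i + 1) + (c : PowerSeries F) = 0 := by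
  obtain ⟨a, ha, hna⟩ := Polynomial.exists_eq_pow_rootMultiplicity_mul_and_not_dvd (A 0) hA0 0
  set v := (A 0).rootMultiplicity 0
  simp only [Polynomial.C_0, sub_zero, Polynomial.X_dvd_iff] at ha hna
  set N := v + 1 with hN
  set T := trunc (N + 1) U with hT
  set V : PowerSeries F := X * mk fun i => coeff (i + (N + 1)) U with hV
  have hU : U = X ^ N * V + (T : PowerSeries F) := by
    conv_lhs => rw [eq_X_pow_mul_shift_add_trunc (N + 1) U]
    rw [hV, hT, pow_succ, mul_assoc]
  have hexp : ∀ i, N + v + 1 ≤ N * q ^ (i + 1) := by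
    intro i
    have : 2 ≤ q ^ (i + 1) := hq2.trans (Nat.le_self_pow (by omega) q)
    nlinarith
  let b : ℕ → Polynomial F := fun i => A (i + 1) * Polynomial.X ^ (N * q ^ (i + 1) - (N + v + 1))
  let cc : Polynomial F := ∑ i ∈ Finset.range (k + 1), A i * T ^ q ^ i
  have hfrob : ∀ i, U ^ q ^ i = X ^ (N * q ^ i) * V ^ q ^ i + (T : PowerSeries F) ^ q ^ i := by
    intro i
    conv_lhs => rw [hU]
    have : q ^ i = p ^ (e * i) := by rw [hq, pow_mul]
    rw [this, add_pow_char_pow, mul_pow, ← pow_mul]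
  have hcc : (cc : PowerSeries F) =
      ∑ i ∈ Finset.range (k + 1), (A i : PowerSeries F) * (T : PowerSeries F) ^ q ^ i := by
    have : (cc : PowerSeries F) = Polynomial.coeToPowerSeries.ringHom cc := rfl
    rw [this, map_sum]
    simp
  have hmain : X ^ (N + v) * ((a : PowerSeries F) * V +
        X * ∑ i ∈ Finset.range k, (b i : PowerSeries F) * V ^ q ^ (i + 1)) + (cc : PowerSeries F)
        = 0 := by
    rw [← hrel, hcc]
    simp only [hfrob, mul_add, Finset.sum_add_distrib]
    congr 1
    rw [Finset.sum_range_succ', add_comm]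
    congr 1
    · rw [Finset.mul_sum, Finset.mul_sum]
      refine Finset.sum_congr rfl fun i _ => ?_
      have h := hexp i
      simp only [b, Polynomial.coe_mul, Polynomial.coe_pow, Polynomial.coe_X]
      have : (X : PowerSeries F) ^ (N * q ^ (i + 1)) =
        X ^ (N + v) * X * X ^ (N * q ^ (i + 1) - (N + v + 1)) := by
        rw [← pow_succ, ← pow_add]; congr 1; omega
      rw [this]; ring
    · rw [ha]
      simp only [Polynomial.coe_mul, Polynomial.coe_pow, Polynomial.coe_X, pow_zero, mul_one,
        pow_one]
      ring
  have hdvd : (Polynomial.X ^ (N + v) : Polynomial F) ∣ cc := by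
    rw [Polynomial.X_pow_dvd_iff]
    have : (X : PowerSeries F) ^ (N + v) ∣ (cc : PowerSeries F) := by
      rw [eq_neg_of_add_eq_zero_right hmain]
      exact (Dvd.intro _ rfl).neg_right
    rw [X_pow_dvd_iff] at this
    simpa using this
  obtain ⟨c, hc⟩ := hdvd
  refine ⟨N, T, V, a, c, b, hU, by simp [hV], hna, ?_⟩
  have hX : (X : PowerSeries F) ^ (N + v) ≠ 0 := pow_ne_zero _ X_ne_zero
  apply mul_left_cancel₀ hX
  rw [mul_zero, mul_add, ← hmain, hc]
  simp

lemma aux_toLaurent_nat {F : Type*} [Field F] (f : Polynomial F) (n : ℕ) :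
    (Polynomial.toLaurent f).coeff (n : ℤ) = f.coeff n := by
  rw [LaurentPolynomial.coeff_toLaurent]
  exact Finsupp.mapDomain_apply Nat.castEmbedding.injective _ _

lemma aux_toLaurent_neg {F : Type*} [Field F] (f : Polynomial F) (m : ℤ) (hm : m < 0) :
    (Polynomial.toLaurent f).coeff m = 0 := by
  rw [LaurentPolynomial.coeff_toLaurent]
  apply Finsupp.mapDomain_of_notMem_range
  rintro ⟨n, hn⟩
  have : (n : ℤ) = m := hn
  omega

lemma aux_diag {F : Type*} [Field F] (p e : ℕ) [Fact p.Prime] [CharP F p]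
    (q : ℕ) (hq : q = p ^ e) (hq2 : 2 ≤ q)
    (V : PowerSeries F) (k : ℕ) (a c : Polynomial F) (b : ℕ → Polynomial F)
    (hV0 : constantCoeff V = 0) (ha : a.coeff 0 ≠ 0)
    (hrel : (a : PowerSeries F) * V +
        X * ∑ i ∈ Finset.range k, (b i : PowerSeries F) * V ^ q ^ (i + 1) +
          (c : PowerSeries F) = 0) :
    ∃ (G : PowerSeries (LaurentPolynomial F)) (Q M : Polynomial (LaurentPolynomial F)),
      Q.coeff 0 = LaurentPolynomial.C (a.coeff 0) ∧
      G * (Q : PowerSeries (LaurentPolynomial F)) = (M : PowerSeries (LaurentPolynomial F)) ∧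
      ∀ n, (coeff n G).coeff (-1) = coeff n V := by
  have : CharP (PowerSeries (Polynomial F)) p :=
    charP_of_injective_ringHom (f := (PowerSeries.C : Polynomial F →+* _)) PowerSeries.C_injective p
  let jP : PowerSeries F →+* PowerSeries (Polynomial F) := PowerSeries.map Polynomial.C
  let y : PowerSeries (Polynomial F) := PowerSeries.C Polynomial.X
  have hcj : ∀ f, constantCoeff (jP f) = Polynomial.C (constantCoeff f) := by
    intro f
    rw [← coeff_zero_eq_constantCoeff_apply, ← coeff_zero_eq_constantCoeff_apply]
    simp only [jP, coeff_map]
  have hjX : jP X = X := by simp [jP]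
  let τ : PowerSeries (Polynomial F) →+* PowerSeries (LaurentPolynomial F) :=
    PowerSeries.map Polynomial.toLaurent
  let σ : PowerSeries (Polynomial F) →+* PowerSeries (LaurentPolynomial F) :=
    PowerSeries.map ((LaurentPolynomial.invert (R := F)).toRingEquiv.toRingHom.comp
      Polynomial.toLaurent)
  have hστ : ∀ f, σ (jP f) = τ (jP f) := by
    intro f
    ext1 n
    simp [σ, τ, jP]
  let t : PowerSeries (LaurentPolynomial F) := PowerSeries.C (LaurentPolynomial.T 1)
  let s : PowerSeries (LaurentPolynomial F) := PowerSeries.C (LaurentPolynomial.T (-1))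
  have hst : s * t = 1 := by
    simp only [s, t]
    rw [← map_mul, ← LaurentPolynomial.T_add]
    simp
  have hτy : τ y = t := by simp [τ, y, t]
  have hσy : σ y = s := by simp [σ, y, s]
  -- the factorization in the polynomial ring
  let g : PowerSeries (Polynomial F) := y - jP V
  let B : PowerSeries (Polynomial F) :=
    X * ∑ i ∈ Finset.range k, jP (b i : PowerSeries F) * g ^ (q ^ (i + 1) - 2)
  let H : PowerSeries (Polynomial F) := jP (a : PowerSeries F) + g * B
  have hHunit : IsUnit H := by
    rw [isUnit_iff_constantCoeff]
    have : constantCoeff H = Polynomial.C (a.coeff 0) := by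
      simp [H, B, hcj]
    rw [this]
    exact (isUnit_iff_ne_zero.2 ha).map Polynomial.C
  obtain ⟨Hi, hHi⟩ := hHunit.exists_right_inv
  have hEunit : IsUnit (1 - y * jP V) := by
    rw [isUnit_iff_constantCoeff]
    have : constantCoeff (1 - y * jP V) = 1 := by
      simp [hcj, hV0]
    rw [this]
    exact isUnit_one
  obtain ⟨E, hE⟩ := hEunit.exists_left_inv
  have hgH : g * H = jP (a : PowerSeries F) * y +
      X * ∑ i ∈ Finset.range k, jP (b i : PowerSeries F) * y ^ q ^ (i + 1) +
      jP (c : PowerSeries F) := by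
    have h1 := congrArg jP hrel
    simp only [map_add, map_mul, map_sum, map_pow, map_zero, hjX] at h1
    have h2 : g * (g * B) = X * ∑ i ∈ Finset.range k, jP (b i : PowerSeries F) * y ^ q ^ (i + 1)
        - X * ∑ i ∈ Finset.range k, jP (b i : PowerSeries F) * jP V ^ q ^ (i + 1) := by
      simp only [B]
      rw [← mul_sub, ← Finset.sum_sub_distrib, ← mul_assoc, mul_left_comm, Finset.mul_sum]
      congr 1
      refine Finset.sum_congr rfl fun i _ => ?_
      have h3 : 2 ≤ q ^ (i + 1) := hq2.trans (Nat.le_self_pow (by omega) q)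
      have h4 : g * g * g ^ (q ^ (i + 1) - 2) = y ^ q ^ (i + 1) - jP V ^ q ^ (i + 1) := by
        rw [← pow_two, ← pow_add, Nat.add_sub_cancel' h3]
        have : q ^ (i + 1) = p ^ (e * (i + 1)) := by rw [hq, pow_mul]
        rw [this, sub_pow_char_pow]
      rw [← mul_sub, ← h4]
      ring
    simp only [H]
    rw [mul_add, h2]
    simp only [g]
    linear_combination (-1 : PowerSeries (Polynomial F)) * h1
  let LC : F →+* LaurentPolynomial F := LaurentPolynomial.C
  have hcoe : ∀ f : Polynomial F, ((f.map LC : Polynomial (LaurentPolynomial F)) :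
      PowerSeries (LaurentPolynomial F)) = τ (jP (f : PowerSeries F)) := by
    intro f
    ext1 n
    simp [τ, jP, LC]
  let Q : Polynomial (LaurentPolynomial F) :=
    Polynomial.C (LaurentPolynomial.T (-1)) * (a.map LC * Polynomial.C (LaurentPolynomial.T 1) +
      Polynomial.X * ∑ i ∈ Finset.range k, (b i).map LC *
        Polynomial.C (LaurentPolynomial.T 1) ^ q ^ (i + 1) + c.map LC)
  have hQ : (Q : PowerSeries (LaurentPolynomial F)) = s * τ (g * H) := by
    rw [hgH]
    simp only [map_add, map_mul, map_sum, map_pow, hτy, ← hcoe]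
    have h5 : ∀ P : Polynomial (LaurentPolynomial F), (P : PowerSeries (LaurentPolynomial F)) =
      Polynomial.coeToPowerSeries.ringHom P := fun _ => rfl
    simp only [h5, Q, map_add, map_mul, map_sum, map_pow]
    simp [s, t, τ]
  have hc0 : c.coeff 0 = 0 := by
    have := congrArg constantCoeff hrel
    simpa [hV0] using this
  refine ⟨σ E + t * τ (-(B * Hi)), Q, a.map LC, ?_, ?_, ?_⟩
  · simp only [Q, Polynomial.mul_coeff_zero, Polynomial.coeff_add, Polynomial.coeff_C_zero,
      Polynomial.coeff_map, hc0, Polynomial.coeff_X_zero, zero_mul, add_zero, map_zero]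
    rw [mul_left_comm, ← LaurentPolynomial.T_add]
    simp [LC]
  · rw [hQ, hcoe]
    have h6 : σ E * (1 - s * τ (jP V)) = 1 := by
      have := congrArg σ hE
      simpa [hσy, hστ] using this
    have h7 : τ g = t - τ (jP V) := by simp [g, hτy]
    have h8 : τ H * τ Hi = 1 := by rw [← map_mul, hHi, map_one]
    have h9 : τ H = τ (jP (a : PowerSeries F)) + τ g * τ B := by simp [H]
    rw [map_mul, map_neg, map_mul]
    have h10 : σ E * (s * τ g) = 1 := by
      rw [h7, mul_sub, hst, h6]
    linear_combination (τ H) * h10 - τ B * τ g * τ H * τ Hi * hst - τ B * τ g * h8 + h9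
  · intro n
    have h11 : E = 1 + y * (jP V + y * (jP V ^ 2 * E)) := by
      linear_combination (1 + y * jP V) * hE
    have h12 : (coeff n E).coeff 1 = coeff n V := by
      rw [h11]
      simp only [y, map_add, coeff_C_mul, Polynomial.coeff_add]
      rw [Polynomial.coeff_X_mul, Polynomial.coeff_add, Polynomial.mul_coeff_zero]
      simp [jP, coeff_one]
      split_ifs <;> simp [Polynomial.coeff_one]
    have h13 : (coeff n (σ E)).coeff (-1) = (coeff n E).coeff 1 := by
      simp only [σ, coeff_map]
      exact (LaurentPolynomial.invert_apply _ _).trans (by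
        rw [neg_neg]; exact aux_toLaurent_nat _ 1)
    have h14 : ∀ f, (coeff n (t * τ f)).coeff (-1) = 0 := by
      intro f
      simp only [t, τ, coeff_C_mul, coeff_map]
      rw [LaurentPolynomial.T, AddMonoidAlgebra.coeff_single_mul_apply,
        aux_toLaurent_neg _ _ (by norm_num), mul_zero]
    rw [map_add, AddMonoidAlgebra.coeff_add, Finsupp.add_apply, h13, h14, h12, add_zero]

lemma aux_final {F : Type*} [Field F] (u : ℕ → F)
    (S : PowerSeries (LaurentPolynomial F)) (Q M : Polynomial (LaurentPolynomial F)) (a : F)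
    (ha : a ≠ 0) (hQ0 : Q.coeff 0 = LaurentPolynomial.C a)
    (hSQ : S * (Q : PowerSeries (LaurentPolynomial F)) = (M : PowerSeries (LaurentPolynomial F)))
    (m₀ : ℤ) (hcol : ∀ n, (coeff n S).coeff m₀ = u n) :
    ∃ (d l r : ℕ) (f : ℤ → ℕ → F) (R : ℕ → ℤ → F) (m₀ : ℤ),
      1 ≤ d ∧
      (∀ i, i < d → {m : ℤ | R i m ≠ 0}.Finite) ∧
      (∀ n, d ≤ n → ∀ m : ℤ,
        R n m = ∑ i ∈ Finset.Icc 1 d, ∑ j ∈ Finset.Icc (-(l : ℤ)) (r : ℤ),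
          f j i * R (n - i) (m + j)) ∧
      (∀ n, R n m₀ = u n) := by
  set d := Q.natDegree + M.natDegree + 1 with hd
  let Z : ℕ := ∑ i ∈ Finset.range (d + 1), ∑ k ∈ (Q.coeff i).coeff.support, k.natAbs
  have hZ : ∀ i ≤ d, ∀ k ∈ (Q.coeff i).coeff.support, k.natAbs ≤ Z := by
    intro i hi k hk
    calc k.natAbs ≤ ∑ k ∈ (Q.coeff i).coeff.support, k.natAbs :=
          Finset.single_le_sum (f := fun k : ℤ => k.natAbs) (fun _ _ => Nat.zero_le _) hk
      _ ≤ Z := Finset.single_le_sum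
          (f := fun i => ∑ k ∈ (Q.coeff i).coeff.support, k.natAbs)
          (fun _ _ => Nat.zero_le _) (Finset.mem_range.2 (by omega))
  have hmul : ∀ i ≤ d, ∀ (P : LaurentPolynomial F) (m : ℤ), (Q.coeff i * P).coeff m =
      ∑ j ∈ Finset.Icc (-(Z : ℤ)) (Z : ℤ), (Q.coeff i).coeff (-j) * P.coeff (m + j) := by
    intro i hi P m
    rw [AddMonoidAlgebra.coeff_mul_apply_left, Finsupp.sum_of_support_subset
      (s := Finset.Icc (-(Z : ℤ)) (Z : ℤ))]
    · refine Finset.sum_bij' (fun k _ => -k) (fun k _ => -k) ?_ ?_ ?_ ?_ ?_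
      · intro k hk; rw [Finset.mem_Icc] at *; omega
      · intro k hk; rw [Finset.mem_Icc] at *; omega
      · intro k _; simp
      · intro k _; simp
      · intro k _; rw [neg_neg, add_comm]
    · intro k hk
      have := hZ i hi k hk
      rw [Finset.mem_Icc]; omega
    · intro k _; simp
  refine ⟨d, Z, Z, fun j i => -a⁻¹ * (Q.coeff i).coeff (-j), fun n m => (coeff n S).coeff m, m₀,
    by omega, ?_, ?_, hcol⟩
  · intro i _
    exact ((coeff i S).coeff.support.finite_toSet).subset fun m hm => by simpa using hm
  · intro n hn m
    have h1 := congrArg (coeff n) hSQ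
    rw [mul_comm, coeff_mul, Polynomial.coeff_coe, Polynomial.coeff_eq_zero_of_natDegree_lt
      (by omega), Finset.Nat.sum_antidiagonal_eq_sum_range_succ_mk] at h1
    simp only [Polynomial.coeff_coe] at h1
    have h2 : ∑ i ∈ Finset.range (n + 1), Q.coeff i * coeff (n - i) S =
        ∑ i ∈ Finset.range (d + 1), Q.coeff i * coeff (n - i) S := by
      symm
      apply Finset.sum_subset
      · intro x hx; rw [Finset.mem_range] at *; omega
      · intro x _ hx
        rw [Finset.mem_range] at hx
        rw [Polynomial.coeff_eq_zero_of_natDegree_lt (by omega), zero_mul]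
    rw [Nat.succ_eq_add_one, h2, Finset.range_eq_Ico, Finset.sum_eq_sum_Ico_succ_bot (by omega), hQ0, Nat.sub_zero] at h1
    have h3 : Finset.Ico (0 + 1) (d + 1) = Finset.Icc 1 d := by
      ext x; simp only [Finset.mem_Ico, Finset.mem_Icc]; omega
    rw [h3] at h1
    have h4 := congrArg (fun P : LaurentPolynomial F => P.coeff m) h1
    simp only [AddMonoidAlgebra.coeff_add, Finsupp.add_apply, AddMonoidAlgebra.coeff_sum,
      Finsupp.finsetSum_apply, AddMonoidAlgebra.coeff_zero, Finsupp.zero_apply] at h4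
    rw [← LaurentPolynomial.smul_eq_C_mul, AddMonoidAlgebra.coeff_smul_apply, smul_eq_mul,
      Finset.sum_congr rfl (fun i hi => hmul i (Finset.mem_Icc.1 hi).2 _ m)] at h4
    simp only [mul_assoc, ← Finset.mul_sum]
    field_simp
    linear_combination h4

/-- Every `p`-automatic sequence over `F_q` occurs as a column of a spacetime diagram of
a linear cellular automaton with memory over `F_q` whose initial rows have finitely many
nonzero entries. -/
theorem automatic_is_column_of_linear_CA_finite_support
    (p : ℕ) (hp : p.Prime) (Fq : Type*) [Field Fq] [Fintype Fq] (hchar : CharP Fq p)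
    (u : ℕ → Fq) (hu : IsKAutomatic p u) :
    ∃ (d l r : ℕ) (f : ℤ → ℕ → Fq) (R : ℕ → ℤ → Fq) (m₀ : ℤ),
      1 ≤ d ∧
      (∀ i, i < d → {m : ℤ | R i m ≠ 0}.Finite) ∧
      (∀ n, d ≤ n → ∀ m : ℤ,
        R n m = ∑ i ∈ Finset.Icc 1 d, ∑ j ∈ Finset.Icc (-(l : ℤ)) (r : ℤ),
          f j i * R (n - i) (m + j)) ∧
      (∀ n, R n m₀ = u n) := by
  have hfact : Fact p.Prime := ⟨hp⟩
  obtain ⟨e, -, hq⟩ := FiniteField.card Fq p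
  have hcharP : CharP (PowerSeries Fq) p :=
    charP_of_injective_ringHom (f := (PowerSeries.C : Fq →+* _)) PowerSeries.C_injective p
  have hq2 : 2 ≤ Fintype.card Fq := Fintype.one_lt_card
  obtain ⟨W, hfg, hW, hUW⟩ := aux_auto_space p hp.one_lt u hu
  have hW' := aux_dec_comp W p hp.pos hW e
  rw [← hq] at hW'
  obtain ⟨k₀, A₀, hA₀, hne⟩ := aux_relation p e hq W hfg hW' _ hUW
  obtain ⟨k, A, hA0, hA⟩ := aux_reduce _ k₀ A₀ hA₀ hne
  obtain ⟨N, T, V, a, c, b, hU, hV0, ha, hrel⟩ :=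
    aux_normalize p e (Fintype.card Fq) hq hq2 _ k A hA0 hA
  obtain ⟨G, Q, M, hQ0, hGQ, hcol⟩ :=
    aux_diag p e (Fintype.card Fq) hq hq2 V k a c b hV0 ha hrel
  let T' : Polynomial (LaurentPolynomial Fq) :=
    Polynomial.C (LaurentPolynomial.T (-1)) * T.map LaurentPolynomial.C
  refine aux_final u (X ^ N * G + (T' : PowerSeries (LaurentPolynomial Fq))) Q
    (Polynomial.X ^ N * M + T' * Q) (a.coeff 0) ha hQ0 ?_ (-1) ?_
  · rw [add_mul, mul_assoc, hGQ]
    simp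
  · intro n
    have h1 := congrArg (coeff n) hU
    rw [coeff_mk, map_add, coeff_X_pow_mul', Polynomial.coeff_coe] at h1
    rw [h1, map_add, AddMonoidAlgebra.coeff_add, Finsupp.add_apply, coeff_X_pow_mul']
    congr 1
    · split_ifs
      · exact hcol _
      · rfl
    · rw [Polynomial.coeff_coe, Polynomial.coeff_C_mul, Polynomial.coeff_map,
        LaurentPolynomial.T, AddMonoidAlgebra.coeff_single_mul_apply]
      simp
end

section
/- Let p be a prime and F_q a finite field of characteristic p. If u : ℕ → F_q is a p-automatic sequence, then there exist e ≥ 1, radii l, r ≥ 0, F_q-linear maps L_j : F_q^e → F_q^e for −l ≤ j ≤ r, an initial configuration R_0 : ℤ → F_q^e eventually periodic in both directions, a column index m₀ ∈ ℤ, and a map π : F_q^e → F_q, such that the spacetime diagram defined by R_{n+1}(m) = Σ_{j=−l}^{r} L_j(R_n(m+j)) for all n ≥ 0 and m ∈ ℤ satisfies π(R_n(m₀)) = u(n) for all n ≥ 0. That is, every p-automatic sequence is the letter-to-letter projection of a column of a linear cellular automaton (without memory) begun from an initial condition eventually periodic in both directions. -/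
open scoped LaurentPolynomial in
/-- Finitely many Laurent polynomials have coefficients supported in a common window. -/
lemma AC_exists_bound {F : Type*} [Field F] (K : ℕ) (C : ℕ → F[T;T⁻¹]) :
    ∃ B : ℕ, ∀ k < K, ∀ m : ℤ, (C k).coeff m ≠ 0 → -(B : ℤ) < m ∧ m < B := by
  induction K with
  | zero => exact ⟨0, by simp⟩
  | succ K ih =>
    obtain ⟨B, hB⟩ := ih
    refine ⟨B + ((C K).coeff.support.sup Int.natAbs + 1), ?_⟩
    intro k hk m hm
    rcases Nat.lt_succ_iff_lt_or_eq.mp hk with h | rfl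
    · have := hB k h m hm
      push_cast
      omega
    · have : m.natAbs ≤ (C k).coeff.support.sup Int.natAbs :=
        Finset.le_sup (f := Int.natAbs) (Finsupp.mem_support_iff.mpr hm)
      push_cast
      omega

open scoped LaurentPolynomial in
lemma AC_coeff_mul {F : Type*} [Field F] (B : ℕ) (c z : F[T;T⁻¹])
    (hB : ∀ m : ℤ, c.coeff m ≠ 0 → -(B : ℤ) < m ∧ m < B) (m : ℤ) :
    (c * z).coeff m = ∑ j ∈ Finset.Icc (-(B : ℤ)) B, c.coeff (-j) * z.coeff (m + j) := by
  classical
  rw [AddMonoidAlgebra.coeff_mul]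
  have h1 : ∀ m₁ : ℤ, ∀ r₁ : F, (z.coeff.sum fun m₂ r₂ => if m₁ + m₂ = m then r₁ * r₂ else 0)
      = r₁ * z.coeff (m - m₁) := by
    intro m₁ r₁
    rw [Finsupp.sum, Finset.sum_eq_single (m - m₁)]
    · simp
    · intro b _ hb
      rw [if_neg]
      omega
    · intro h
      simp [Finsupp.notMem_support_iff.mp h]
  simp only [h1]
  rw [Finsupp.sum_of_support_subset (s := Finset.Icc (-(B : ℤ)) B) _ _ _ (by simp)]
  · refine Finset.sum_nbij' (fun j => -j) (fun j => -j) ?_ ?_ ?_ ?_ ?_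
    · intro a ha; simp only [Finset.mem_Icc] at *; omega
    · intro a ha; simp only [Finset.mem_Icc] at *; omega
    · simp
    · simp
    · intro a _; simp [sub_eq_add_neg]
  · intro a ha
    have := hB a (Finsupp.mem_support_iff.mp ha)
    simp only [Finset.mem_Icc]; omega

open scoped LaurentPolynomial in
lemma AC_column {F : Type*} [Field F] (u : ℕ → F) (Z : ℕ → F[T;T⁻¹]) (K : ℕ) (hK : 1 ≤ K)
    (C : ℕ → F[T;T⁻¹]) (hrec : ∀ n, Z (n + K) = ∑ k ∈ Finset.range K, C k * Z (n + k))
    (m₀ : ℤ) (hu : ∀ n, (Z n).coeff m₀ = u n) :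
    ∃ (e l r : ℕ), 1 ≤ e ∧
      ∃ (L : ℤ → (Fin e → F) →ₗ[F] (Fin e → F)) (R : ℕ → ℤ → (Fin e → F)) (m₀ : ℤ)
        (π : (Fin e → F) → F),
        EventuallyPeriodicBoth (R 0) ∧
        (∀ (n : ℕ) (m : ℤ),
          R (n + 1) m = ∑ j ∈ Finset.Icc (-(l : ℤ)) (r : ℤ), L j (R n (m + j))) ∧
        (∀ n, π (R n m₀) = u n) := by
  obtain ⟨B, hB⟩ := AC_exists_bound K C
  obtain ⟨D, hD⟩ := AC_exists_bound K Z
  refine ⟨K, B, B, hK, fun j => LinearMap.pi fun i =>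
      if h : (i : ℕ) + 1 < K then
        (if j = 0 then LinearMap.proj (⟨i + 1, h⟩ : Fin K) else 0)
      else ∑ k : Fin K, (C k).coeff (-j) • LinearMap.proj k,
    fun n m i => (Z (n + i)).coeff m, m₀, fun v => v ⟨0, hK⟩, ?_, ?_, ?_⟩
  · refine ⟨D, 1, le_rfl, ?_, ?_⟩
    · intro m hm
      funext i
      have h0 : ∀ m : ℤ, (D : ℤ) ≤ m → (Z (0 + i)).coeff m = 0 := by
        intro m hm
        by_contra h
        have := hD i i.2 m (by simpa using h)
        omega
      simp only
      rw [h0 _ hm, h0 _ (by push_cast; omega)]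
    · intro m hm
      funext i
      have h0 : ∀ m : ℤ, m ≤ -(D : ℤ) → (Z (0 + i)).coeff m = 0 := by
        intro m hm
        by_contra h
        have := hD i i.2 m (by simpa using h)
        omega
      simp only
      rw [h0 _ hm, h0 _ (by push_cast; omega)]
  · intro n m
    funext i
    rw [Finset.sum_apply]
    simp only [LinearMap.pi_apply]
    by_cases h : (i : ℕ) + 1 < K
    · simp only [h, dif_pos]
      rw [Finset.sum_eq_single 0]
      · simp [add_assoc, add_comm, add_left_comm]
      · intro b _ hb
        simp [hb]
      · intro h
        exact absurd (by simp) h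
    · simp only [h, dif_neg, not_false_eq_true]
      have hi : n + 1 + (i : ℕ) = n + K := by have := i.2; omega
      rw [hi, hrec]
      simp only [LinearMap.sum_apply, LinearMap.smul_apply, LinearMap.proj_apply, smul_eq_mul]
      rw [Finset.sum_comm, ← Fin.sum_univ_eq_sum_range (fun k => C k * Z (n + k))]
      rw [AddMonoidAlgebra.coeff_sum, Finsupp.finsetSum_apply]
      refine Finset.sum_congr rfl fun k _ => ?_
      exact AC_coeff_mul B _ _ (hB k k.2) m
  · intro n
    simpa using hu n

/-- rational power series satisfy a homogeneous recurrence -/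
lemma AC_rec {A : Type*} [CommRing A] (Q N : Polynomial A) (Z : PowerSeries A)
    (h : (Q : PowerSeries A) * Z = N) (hQ : IsUnit (Q.coeff 0)) :
    ∃ (K : ℕ) (C : ℕ → A), 1 ≤ K ∧
      ∀ n, Z.coeff (n + K) = ∑ k ∈ Finset.range K, C k * Z.coeff (n + k) := by
  obtain ⟨w, hw⟩ := hQ
  refine ⟨Q.natDegree + N.natDegree + 1,
    fun k => - ((w⁻¹ : Aˣ) : A) * Q.coeff (Q.natDegree + N.natDegree + 1 - k), by omega, ?_⟩
  intro n
  set K := Q.natDegree + N.natDegree + 1 with hK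
  have h1 : PowerSeries.coeff (n + K) ((Q : PowerSeries A) * Z) = 0 := by
    rw [h, Polynomial.coeff_coe]
    exact Polynomial.coeff_eq_zero_of_natDegree_lt (by omega)
  rw [PowerSeries.coeff_mul, Finset.Nat.sum_antidiagonal_eq_sum_range_succ_mk,
    ← Finset.sum_range_reflect, Finset.sum_range_succ] at h1
  have e1 : n + K + 1 - 1 - (n + K) = 0 := by omega
  simp only [e1, Polynomial.coeff_coe] at h1
  rw [Finset.sum_range_add] at h1
  have h2 : ∑ x ∈ Finset.range n, Q.coeff (n + K + 1 - 1 - x) *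
      Z.coeff (n + K - (n + K + 1 - 1 - x)) = 0 := by
    refine Finset.sum_eq_zero fun x hx => ?_
    rw [Finset.mem_range] at hx
    rw [Polynomial.coeff_eq_zero_of_natDegree_lt (by omega), zero_mul]
  rw [h2, zero_add] at h1
  have h3 : Z.coeff (n + K) = - ((w⁻¹ : Aˣ) : A) * ∑ x ∈ Finset.range K,
      Q.coeff (n + K + 1 - 1 - (n + x)) * Z.coeff (n + K - (n + K + 1 - 1 - (n + x))) := by
    have h4 := eq_neg_of_add_eq_zero_left h1
    rw [h4, ← hw]
    simp
  rw [h3, Finset.mul_sum]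
  refine Finset.sum_congr rfl fun k hk => ?_
  rw [Finset.mem_range] at hk
  have e2 : n + K + 1 - 1 - (n + k) = K - k := by omega
  have e3 : n + K - (K - k) = n + k := by omega
  rw [e2, e3, mul_assoc]

open PowerSeries in
/-- Frobenius on power series over a finite field. -/
lemma AC_pow_card {F : Type*} [Field F] [Fintype F] (i : ℕ) (f : PowerSeries F)
    (hq : Fintype.card F ^ i ≠ 0) :
    f ^ (Fintype.card F ^ i) = PowerSeries.expand (Fintype.card F ^ i) hq f := by
  obtain ⟨p, hc⟩ := CharP.exists F
  obtain ⟨n, hp, hn⟩ := FiniteField.card F p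
  have : Fact p.Prime := ⟨hp⟩
  have h := MvPowerSeries.map_iterateFrobenius_expand (σ := Unit) (R := F) p hp.ne_zero f (n * i)
  have e : p ^ ((n : ℕ) * i) = Fintype.card F ^ i := by rw [hn, pow_mul]
  have h2 : (iterateFrobenius F p (n * i)) = RingHom.id F := by
    ext x
    rw [iterateFrobenius_def, e, FiniteField.pow_card_pow]
    rfl
  rw [h2, MvPowerSeries.map_id] at h
  simp only [e] at h
  exact h.symm

/-- a shifted contraction of a polynomial -/
lemma AC_cartier {F : Type*} [Field F] (q : ℕ) (hq : q ≠ 0) (j : ℕ) (hj : j < q)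
    (a : Polynomial F) (g : PowerSeries F) (b : Polynomial F)
    (hb : ∀ n, b.coeff n = a.coeff (q * n + j)) (n : ℕ) :
    PowerSeries.coeff (q * n + j) ((a : PowerSeries F) * PowerSeries.expand q hq g) =
      PowerSeries.coeff n ((b : PowerSeries F) * g) := by
  rw [PowerSeries.coeff_mul, PowerSeries.coeff_mul]
  rw [← Finset.sum_subset (s₁ := (Finset.HasAntidiagonal.antidiagonal n).image
    fun x => (q * x.1 + j, q * x.2)), Finset.sum_image]
  · refine Finset.sum_congr rfl fun x _ => ?_
    simp [hb]
  · intro x _ y _ h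
    simp only [Prod.mk.injEq, add_left_inj, mul_eq_mul_left_iff, hq, or_false] at h
    exact Prod.ext h.1 h.2
  · intro x hx
    simp only [Finset.mem_image, Finset.HasAntidiagonal.mem_antidiagonal] at hx ⊢
    obtain ⟨y, hy, rfl⟩ := hx
    rw [← hy]; ring
  · intro x hx hx2
    simp only [Finset.mem_image, Finset.HasAntidiagonal.mem_antidiagonal] at hx hx2
    rw [PowerSeries.coeff_expand]
    split_ifs with h
    · exfalso
      obtain ⟨c, hc⟩ := h
      have hcn : c ≤ n := by
        by_contra hlt
        have : q * (n + 1) ≤ q * c := Nat.mul_le_mul_left _ (by omega)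
        rw [mul_add] at this
        omega
      obtain ⟨d, rfl⟩ := Nat.exists_eq_add_of_le hcn
      refine hx2 ⟨(d, c), by omega, ?_⟩
      rw [mul_add] at hx
      apply Prod.ext
      · simp only; omega
      · simp only; omega
    · simp

lemma AC_exists_contract {F : Type*} [Field F] (q : ℕ) (hq : q ≠ 0) (j : ℕ) (a : Polynomial F) :
    ∃ b : Polynomial F, ∀ n, b.coeff n = a.coeff (q * n + j) := by
  refine ⟨Polynomial.contract q (Polynomial.divX^[j] a), fun n => ?_⟩
  rw [Polynomial.coeff_contract hq]
  have : ∀ j m, (Polynomial.divX^[j] a).coeff m = a.coeff (m + j) := by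
    intro j
    induction j with
    | zero => simp
    | succ j ih =>
      intro m
      rw [Function.iterate_succ_apply', Polynomial.coeff_divX, ih]
      congr 1; ring
  rw [this, mul_comm]

lemma AC_lower {F : Type*} [Field F] (q : ℕ) (hq : q ≠ 0) (f : PowerSeries F) (N : ℕ) :
    ∀ a : ℕ → Polynomial F, (∃ i < N, a i ≠ 0) →
      (∑ i ∈ Finset.range N, (a i : PowerSeries F) *
        PowerSeries.expand (q ^ i) (pow_ne_zero i hq) f = 0) →
      ∃ (M : ℕ) (b : ℕ → Polynomial F), b 0 ≠ 0 ∧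
      (∑ i ∈ Finset.range (M + 1), (b i : PowerSeries F) *
        PowerSeries.expand (q ^ i) (pow_ne_zero i hq) f = 0) := by
  induction N with
  | zero => intro a h; simp at h
  | succ N ih =>
    intro a ⟨i, hi, hai⟩ h
    by_cases h0 : a 0 = 0
    · have hi0 : i ≠ 0 := by rintro rfl; exact hai h0
      obtain ⟨i, rfl⟩ := Nat.exists_eq_succ_of_ne_zero hi0
      rw [Finset.sum_range_succ', h0] at h
      simp only [Polynomial.coe_zero, zero_mul, add_zero] at h
      obtain ⟨m, hm⟩ : ∃ m, (a (i+1)).coeff m ≠ 0 := by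
        by_contra hcon
        push Not at hcon
        exact hai (Polynomial.ext (by simpa using hcon))
      choose b hb using fun k => AC_exists_contract q hq (m % q) (a (k + 1))
      refine ih b ⟨i, by omega, ?_⟩ ?_
      · intro hz
        have := hb i (m / q)
        rw [hz, Nat.div_add_mod] at this
        exact hm (by simpa using this.symm)
      · ext n
        have h2 := congrArg (PowerSeries.coeff (q * n + m % q)) h
        rw [map_sum] at h2 ⊢
        rw [map_zero] at h2 ⊢
        rw [← h2]
        refine Finset.sum_congr rfl fun k _ => ?_
        rw [← AC_cartier q hq (m % q) (Nat.mod_lt _ (Nat.pos_of_ne_zero hq)) (a (k+1)) _ (b k) (hb k) n,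
          ← PowerSeries.expand_mul]
        simp only [pow_succ']
    · exact ⟨N, a, h0, h⟩

open PowerSeries in
lemma AC_functional {F : Type*} [Field F] {S : Type} (p : ℕ) (hp : 1 < p) (δ : S → ℕ → S)
    (ω : S → F) (s : S) :
    ∃ c : F, (PowerSeries.mk fun n => ω ((Nat.digits p n).foldl δ s)) =
      C c + ∑ d ∈ Finset.range p, X ^ d * PowerSeries.expand p (by omega)
        (PowerSeries.mk fun n => ω ((Nat.digits p n).foldl δ (δ s d))) := by
  refine ⟨ω s - ω (δ s 0), ?_⟩
  ext n
  rw [map_add, map_sum, Finset.sum_eq_single (n % p)]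
  · have hn := Nat.div_add_mod n p
    have hX : ∀ g : PowerSeries F, coeff n (X ^ (n % p) * g) = coeff (p * (n / p)) g := by
      intro g
      rw [← PowerSeries.coeff_X_pow_mul g (n % p) (p * (n / p)), hn]
    rw [hX, PowerSeries.coeff_expand_mul, coeff_mk, coeff_mk]
    rcases Nat.eq_zero_or_pos n with rfl | hpos
    · simp
    · rw [Nat.digits_def' hp hpos, PowerSeries.coeff_C, if_neg hpos.ne']
      simp
  · intro d hd hdn
    rw [PowerSeries.coeff_X_pow_mul']
    split_ifs with h
    · rw [PowerSeries.coeff_expand_of_not_dvd]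
      rintro ⟨c, hc⟩
      apply hdn
      have : n = d + p * c := by omega
      rw [this, Nat.add_mul_mod_self_left, Nat.mod_eq_of_lt (Finset.mem_range.mp hd)]
    · rfl
  · intro h
    exact absurd (Finset.mem_range.mpr (Nat.mod_lt _ (by omega))) h

open PowerSeries in
lemma AC_ore {F : Type*} [Field F] {S : Type} [Fintype S] (p : ℕ) (hp : 1 < p) (δ : S → ℕ → S)
    (ω : S → F) (s₀ : S) (r : ℕ) (q : ℕ) (hq : q ≠ 0) (hqr : q = p ^ r) :
    ∃ (N : ℕ) (a : ℕ → Polynomial F), (∃ i < N, a i ≠ 0) ∧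
      (∑ i ∈ Finset.range N, (a i : PowerSeries F) *
        PowerSeries.expand (q ^ i) (pow_ne_zero i hq)
          (PowerSeries.mk fun n => ω ((Nat.digits p n).foldl δ s₀)) = 0) := by
  classical
  have hp0 : p ≠ 0 := by omega
  set G : S → PowerSeries F := fun s => PowerSeries.mk fun n => ω ((Nat.digits p n).foldl δ s)
    with hG
  let w : ℕ → Finset (PowerSeries F) := fun k => insert 1
    (Finset.univ.image fun s => PowerSeries.expand (p ^ k) (pow_ne_zero k hp0) (G s))
  let M : ℕ → Submodule (Polynomial F) (PowerSeries F) := fun k =>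
    Submodule.span (Polynomial F) (w k : Set (PowerSeries F))
  have hpoly : ∀ k (a : Polynomial F) g, g ∈ M k → (a : PowerSeries F) * g ∈ M k := by
    intro k a g hg
    have := (M k).smul_mem a hg
    rw [Algebra.smul_def, PowerSeries.algebraMap_apply'] at this
    simpa using this
  have hone : ∀ k, (1 : PowerSeries F) ∈ M k := fun k => Submodule.subset_span (by simp [w])
  have hgen : ∀ k s, PowerSeries.expand (p ^ k) (pow_ne_zero k hp0) (G s) ∈ M k :=
    fun k s => Submodule.subset_span (by simp [w])
  have hmono : Monotone M := by
    refine monotone_nat_of_le_succ fun k => ?_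
    refine Submodule.span_le.mpr ?_
    intro x hx
    simp only [w, Finset.coe_insert, Finset.coe_image, Finset.coe_univ, Set.image_univ,
      Set.mem_insert_iff, Set.mem_range] at hx
    rcases hx with rfl | ⟨s, rfl⟩
    · exact hone _
    · obtain ⟨c, hc⟩ := AC_functional p hp δ ω s
      change G s = _ at hc
      rw [hc, map_add, map_sum, PowerSeries.expand_C]
      refine Submodule.add_mem _ ?_ (Submodule.sum_mem _ fun d _ => ?_)
      · have := hpoly (k+1) (Polynomial.C c) 1 (hone _)
        simpa using this
      · rw [map_mul, map_pow, PowerSeries.expand_X, ← PowerSeries.expand_mul]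
        have := hpoly (k+1) ((Polynomial.X ^ p ^ k) ^ d) _ (hgen (k+1) (δ s d))
        simp only [pow_succ] at this ⊢
        simpa using this
  obtain ⟨N, hN⟩ : ∃ N, N = Fintype.card S + 2 := ⟨_, rfl⟩
  let v : Fin N → PowerSeries F := fun i =>
    PowerSeries.expand (q ^ (i : ℕ)) (pow_ne_zero i hq) (G s₀)
  have hv : Set.range v ≤ M (r * N) := by
    rintro _ ⟨i, rfl⟩
    have h1 := hmono (Nat.mul_le_mul_left r i.2.le) (hgen (r * i) s₀)
    have e : p ^ (r * (i : ℕ)) = q ^ (i : ℕ) := by rw [hqr, pow_mul]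
    simp only [e] at h1
    exact h1
  have hli : ¬ LinearIndependent (Polynomial F) v := by
    intro h
    have h1 := linearIndependent_le_span_aux' v h (w (r * N) : Set (PowerSeries F)) hv
    rw [Fintype.card_fin] at h1
    simp only [Finset.coe_sort_coe, Fintype.card_coe] at h1
    have h2 : (w (r * N)).card ≤ Fintype.card S + 1 :=
      (Finset.card_insert_le _ _).trans (Nat.succ_le_succ Finset.card_image_le)
    omega
  rw [Fintype.not_linearIndependent_iff] at hli
  obtain ⟨g, hg, i, hi⟩ := hli
  refine ⟨N, fun k => if h : k < N then g ⟨k, h⟩ else 0, ⟨i, i.2, by simpa using hi⟩, ?_⟩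
  rw [← hg, Finset.sum_range]
  refine Finset.sum_congr rfl fun k _ => ?_
  rw [Algebra.smul_def, PowerSeries.algebraMap_apply']
  simp [v, hG]


/-- A power series is a polynomial as soon as a shift of it is. -/
lemma AC_isPoly {A : Type*} [CommRing A] (n : ℕ) (Q : PowerSeries A) (P : Polynomial A)
    (h : PowerSeries.X ^ n * Q = (P : PowerSeries A)) : ∃ Q' : Polynomial A, (Q' : PowerSeries A) = Q := by
  refine ⟨Q.trunc (P.natDegree + 1), ?_⟩
  ext m
  rw [Polynomial.coeff_coe, PowerSeries.coeff_trunc]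
  split_ifs with hm
  · rfl
  · have := congrArg (PowerSeries.coeff (m + n)) h
    rw [PowerSeries.coeff_X_pow_mul, Polynomial.coeff_coe,
      Polynomial.coeff_eq_zero_of_natDegree_lt (by omega)] at this
    exact this.symm

open PowerSeries in
lemma AC_alg {F : Type*} [Field F] (p : ℕ) [Fact p.Prime] [CharP F p] (r q : ℕ) (hr : r ≠ 0)
    (hq : q = p ^ r) (f : PowerSeries F) (M : ℕ) (a : ℕ → Polynomial F) (ha : a 0 ≠ 0)
    (h : ∑ i ∈ Finset.range (M + 1), (a i : PowerSeries F) * f ^ (q ^ i) = 0) :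
    ∃ (K : ℕ) (P a' : Polynomial F) (g : PowerSeries F) (V B : PowerSeries (Polynomial F))
      (Q : Polynomial (Polynomial F)),
      f = (P : PowerSeries F) + X ^ K * g ∧ constantCoeff g = 0 ∧ a'.coeff 0 ≠ 0 ∧
      V = map Polynomial.C (a' : PowerSeries F) +
        B * (PowerSeries.C Polynomial.X - map Polynomial.C g) ∧
      constantCoeff B = 0 ∧
      (Q : PowerSeries (Polynomial F)) = (PowerSeries.C Polynomial.X - map Polynomial.C g) * V := by
  have hp := (Fact.out : p.Prime)
  have hq2 : 2 ≤ q := by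
    rw [hq]; exact hp.two_le.trans (Nat.le_self_pow hr p)
  obtain ⟨v, a', ha', hva⟩ : ∃ (v : ℕ) (a' : Polynomial F), a'.coeff 0 ≠ 0 ∧
      a 0 = Polynomial.X ^ v * a' := by
    obtain ⟨b, hb, hb2⟩ := Polynomial.exists_eq_pow_rootMultiplicity_mul_and_not_dvd (a 0) ha 0
    simp only [map_zero, sub_zero] at hb hb2
    exact ⟨_, b, fun h => hb2 (Polynomial.X_dvd_iff.mpr h), hb⟩
  obtain ⟨K, hK⟩ : ∃ K, K = v + 1 := ⟨_, rfl⟩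
  obtain ⟨g', hg'⟩ : X ^ (K + 1) ∣ f - (f.trunc (K + 1) : PowerSeries F) := by
    rw [PowerSeries.X_pow_dvd_iff]
    intro m hm
    rw [map_sub, PowerSeries.coeff_coe_trunc_of_lt hm, sub_self]
  obtain ⟨P, hP⟩ : ∃ P, P = f.trunc (K + 1) := ⟨_, rfl⟩
  rw [← hP] at hg'
  obtain ⟨g, hg⟩ : ∃ g, g = X * g' := ⟨_, rfl⟩
  have hfg : f = (P : PowerSeries F) + X ^ K * g := by
    rw [hg, ← mul_assoc, ← pow_succ, ← hg']; ring
  obtain ⟨w, hw⟩ : ∃ w : PowerSeries (Polynomial F),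
    w = PowerSeries.C Polynomial.X - map Polynomial.C g := ⟨_, rfl⟩
  have hexp : ∀ i, ∃ c, K * q ^ (i + 1) = K + v + 1 + c := by
    intro i
    have : 2 ≤ q ^ (i + 1) := hq2.trans (Nat.le_self_pow (by omega) q)
    have : K * 2 ≤ K * q ^ (i + 1) := Nat.mul_le_mul_left _ this
    exact ⟨K * q ^ (i + 1) - (K + v + 1), by omega⟩
  choose c hc using hexp
  have hexp2 : ∀ i, ∃ d, q ^ (i + 1) = d + 2 := by
    intro i
    have : 2 ≤ q ^ (i + 1) := hq2.trans (Nat.le_self_pow (by omega) q)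
    exact ⟨q ^ (i + 1) - 2, by omega⟩
  choose d hd using hexp2
  obtain ⟨B, hB⟩ : ∃ B : PowerSeries (Polynomial F), B = ∑ i ∈ Finset.range M,
    map Polynomial.C (a (i + 1) : PowerSeries F) * X ^ (c i + 1) * w ^ d i := ⟨_, rfl⟩
  obtain ⟨V, hV⟩ : ∃ V, V = map Polynomial.C (a' : PowerSeries F) + B * w := ⟨_, rfl⟩
  have hchar : CharP (PowerSeries (Polynomial F)) p :=
    charP_of_injective_ringHom (f := (PowerSeries.C).comp (Polynomial.C : F →+* Polynomial F))
      (RingHom.injective _) p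
  obtain ⟨Y, hY⟩ : ∃ Y : Polynomial (Polynomial F),
    Y = P.map Polynomial.C + Polynomial.X ^ K * Polynomial.C Polynomial.X := ⟨_, rfl⟩
  have hYc : (Y : PowerSeries (Polynomial F)) - map Polynomial.C f = X ^ K * w := by
    rw [hY, hw, hfg]
    simp
    ring
  have key : X ^ (K + v) * (w * V) =
      ((∑ i ∈ Finset.range (M + 1), (a i).map Polynomial.C * Y ^ (q ^ i) :
        Polynomial (Polynomial F)) : PowerSeries (Polynomial F)) := by
    have h1 : ((∑ i ∈ Finset.range (M + 1), (a i).map Polynomial.C * Y ^ (q ^ i) :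
        Polynomial (Polynomial F)) : PowerSeries (Polynomial F)) =
        ∑ i ∈ Finset.range (M + 1), map Polynomial.C (a i : PowerSeries F) *
          (Y : PowerSeries (Polynomial F)) ^ (q ^ i) := by
      rw [← Polynomial.coeToPowerSeries.ringHom_apply, map_sum]
      simp
    have h2 := congrArg (map (Polynomial.C : F →+* Polynomial F)) h
    rw [map_sum, map_zero] at h2
    have h3 : ∑ i ∈ Finset.range (M + 1), map Polynomial.C (a i : PowerSeries F) *
          (Y : PowerSeries (Polynomial F)) ^ (q ^ i) =
        ∑ i ∈ Finset.range (M + 1), map Polynomial.C (a i : PowerSeries F) * (X ^ K * w) ^ (q ^ i) := by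
      rw [← sub_zero (∑ i ∈ Finset.range (M + 1), _), ← h2, ← Finset.sum_sub_distrib]
      refine Finset.sum_congr rfl fun i _ => ?_
      rw [← hYc, map_mul, map_pow, ← mul_sub]
      congr 1
      rw [hq, ← pow_mul]
      exact (sub_pow_char_pow (p := p) (n := r * i) _ _).symm
    rw [h1, h3, Finset.sum_range_succ', hV, hB, hva]
    have t1 : ∑ i ∈ Finset.range M, map Polynomial.C (a (i + 1) : PowerSeries F) *
          (X ^ K * w) ^ (q ^ (i + 1)) = X ^ (K + v) * (w * ((∑ i ∈ Finset.range M,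
            map Polynomial.C (a (i + 1) : PowerSeries F) * X ^ (c i + 1) * w ^ d i) * w)) := by
      rw [Finset.sum_mul, Finset.mul_sum, Finset.mul_sum]
      refine Finset.sum_congr rfl fun i _ => ?_
      have t3 : (X ^ K * w) ^ (q ^ (i + 1)) = X ^ (K + v + 1 + c i) * w ^ (d i + 2) := by
        rw [mul_pow, ← pow_mul, hc, hd]
      rw [t3]
      ring
    have t2 : map Polynomial.C ((Polynomial.X ^ v * a' : Polynomial F) : PowerSeries F) *
        (X ^ K * w) ^ (q ^ 0) =
        X ^ (K + v) * (w * map Polynomial.C (a' : PowerSeries F)) := by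
      rw [pow_zero, pow_one, Polynomial.coe_mul, Polynomial.coe_pow, Polynomial.coe_X, map_mul,
        map_pow, PowerSeries.map_X]
      ring
    rw [t1, t2, mul_add, mul_add, add_comm]
  obtain ⟨Q, hQ⟩ := AC_isPoly _ _ _ key
  refine ⟨K, P, a', g, V, B, Q, hfg, by simp [hg], ha', by rw [hV, hw], ?_, by rw [hQ, hw]⟩
  rw [hB, map_sum]
  refine Finset.sum_eq_zero fun i _ => ?_
  simp

open LaurentPolynomial in
lemma AC_toLaurent_coeff {F : Type*} [Field F] (f : Polynomial F) (k : ℕ) :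
    (Polynomial.toLaurent f).coeff (k : ℤ) = f.coeff k := by
  rw [LaurentPolynomial.coeff_toLaurent]
  exact Finsupp.mapDomain_apply Nat.cast_injective _ _

open LaurentPolynomial in
lemma AC_toLaurent_coeff_neg {F : Type*} [Field F] (f : Polynomial F) :
    (Polynomial.toLaurent f).coeff (-2 : ℤ) = 0 := by
  rw [LaurentPolynomial.coeff_toLaurent]
  refine Finsupp.mapDomain_of_notMem_range _ _ ?_
  rintro ⟨k, hk⟩
  change (k : ℤ) = -2 at hk
  omega

lemma AC_constantCoeff_map {A B : Type*} [CommRing A] [CommRing B] (f : A →+* B)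
    (x : PowerSeries A) : PowerSeries.constantCoeff (PowerSeries.map f x) =
      f (PowerSeries.constantCoeff x) := by
  rw [← PowerSeries.coeff_zero_eq_constantCoeff_apply, PowerSeries.coeff_map,
    PowerSeries.coeff_zero_eq_constantCoeff_apply]

lemma AC_constantCoeff_coe {A : Type*} [CommRing A]
    (x : Polynomial A) : PowerSeries.constantCoeff (x : PowerSeries A) = x.coeff 0 := by
  rw [← PowerSeries.coeff_zero_eq_constantCoeff_apply, Polynomial.coeff_coe]

open PowerSeries LaurentPolynomial in
lemma AC_rational {F : Type*} [Field F] (f : PowerSeries F)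
    (K : ℕ) (P a' : Polynomial F) (g : PowerSeries F) (V B : PowerSeries (Polynomial F))
      (Q : Polynomial (Polynomial F))
    (hf : f = (P : PowerSeries F) + X ^ K * g) (hg : constantCoeff g = 0) (ha : a'.coeff 0 ≠ 0)
    (hV : V = map Polynomial.C (a' : PowerSeries F) +
        B * (PowerSeries.C Polynomial.X - map Polynomial.C g))
    (hB : constantCoeff B = 0)
    (hQ : (Q : PowerSeries (Polynomial F)) = (PowerSeries.C Polynomial.X - map Polynomial.C g) * V) :
    ∃ (Q' N : Polynomial F[T;T⁻¹]) (Z : PowerSeries F[T;T⁻¹]),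
      (Q' : PowerSeries F[T;T⁻¹]) * Z = N ∧ IsUnit (Q'.coeff 0) ∧
      ∀ n, (Z.coeff n).coeff (-2) = f.coeff n := by
  let φ : PowerSeries (Polynomial F) →+* PowerSeries F[T;T⁻¹] := map Polynomial.toLaurent
  let inv : F[T;T⁻¹] →+* F[T;T⁻¹] := (LaurentPolynomial.invert (R := F)).toRingEquiv.toRingHom
  let ψ : PowerSeries (Polynomial F) →+* PowerSeries F[T;T⁻¹] :=
    map (inv.comp Polynomial.toLaurent)
  let ι : PowerSeries F →+* PowerSeries F[T;T⁻¹] := map LaurentPolynomial.C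
  have hφι : ∀ x : PowerSeries F, φ (map Polynomial.C x) = ι x := by
    intro x; ext1 n; simp [φ, ι]
  have hψι : ∀ x : PowerSeries F, ψ (map Polynomial.C x) = ι x := by
    intro x; ext1 n; simp [ψ, ι, inv]
  have hcV : constantCoeff V = Polynomial.C (a'.coeff 0) := by
    rw [hV]
    rw [map_add, map_mul, hB, zero_mul, add_zero, AC_constantCoeff_map, AC_constantCoeff_coe]
  have hVu : IsUnit V := by
    rw [PowerSeries.isUnit_iff_constantCoeff, hcV]
    exact (isUnit_iff_ne_zero.mpr ha).map Polynomial.C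
  obtain ⟨V', hV'⟩ := hVu.exists_right_inv
  obtain ⟨G, hG⟩ : ∃ G : PowerSeries (Polynomial F), G = map Polynomial.C g := ⟨_, rfl⟩
  obtain ⟨z, hz⟩ : ∃ z : PowerSeries (Polynomial F), z = PowerSeries.C Polynomial.X := ⟨_, rfl⟩
  have hJu : IsUnit (1 - z * G) := by
    rw [PowerSeries.isUnit_iff_constantCoeff]
    have : constantCoeff G = 0 := by rw [hG, AC_constantCoeff_map, hg, map_zero]
    simp [this]
  obtain ⟨J, hJ⟩ := hJu.exists_right_inv
  have hT : PowerSeries.C (T 1 : F[T;T⁻¹]) * ψ z = 1 := by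
    have : ψ z = PowerSeries.C (T (-1) : F[T;T⁻¹]) := by simp [ψ, hz, inv]
    rw [this, ← map_mul, ← T_add]
    simp
  have hφz : φ z = PowerSeries.C (T 1 : F[T;T⁻¹]) := by simp [φ, hz]
  have hI : φ (z - G) * ψ (z * J) = 1 := by
    have e1 : φ (z - G) = φ z * ψ (1 - z * G) := by
      rw [map_sub, map_sub, map_mul, map_one, mul_sub, ← mul_assoc, hφz, hT, hG, hφι, hψι]
      ring
    calc φ (z - G) * ψ (z * J) = (φ z * ψ z) * ψ ((1 - z * G) * J) := by
            rw [e1, map_mul, map_mul]; ring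
      _ = 1 := by rw [hφz, hT, hJ]; simp
  obtain ⟨Z, hZ⟩ : ∃ Z, Z = ψ (z * J) - φ (B * V') := ⟨_, rfl⟩
  rw [← hz, ← hG] at hV hQ
  have hQZ : φ (Q : PowerSeries (Polynomial F)) * Z = ι (a' : PowerSeries F) := by
    have e2 : φ V * φ V' = 1 := by rw [← map_mul, hV', map_one]
    have e3 : φ V = ι (a' : PowerSeries F) + φ B * φ (z - G) := by
      conv_lhs => rw [hV]
      rw [map_add, map_mul, hφι]
    rw [hQ, hZ, map_mul, map_mul φ B V']
    linear_combination φ V * hI + e3 - φ (z - G) * φ B * e2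
  have hφQ : φ (Q : PowerSeries (Polynomial F)) = ((Q.map Polynomial.toLaurent : Polynomial F[T;T⁻¹]) :
      PowerSeries F[T;T⁻¹]) := by
    simp [φ]
  have hιP : ∀ A : Polynomial F, ι (A : PowerSeries F) =
      ((A.map LaurentPolynomial.C : Polynomial F[T;T⁻¹]) : PowerSeries F[T;T⁻¹]) := by
    intro A; simp [ι]
  have hZg : ∀ n, (Z.coeff n).coeff (-2) = g.coeff n := by
    intro n
    have eJ : z * J = z + z ^ 2 * G + z ^ 3 * (G ^ 2 * J) := by
      linear_combination (z + z ^ 2 * G) * hJ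
    have e4 : (coeff n (φ (B * V'))).coeff (-2) = 0 := by
      simp only [φ, coeff_map]
      exact AC_toLaurent_coeff_neg _
    have e5 : (coeff n (ψ (z * J))).coeff (-2) = g.coeff n := by
      have e6 : (coeff n (ψ (z * J))).coeff (-2) = (coeff n (z * J)).coeff 2 := by
        have : (coeff n (ψ (z * J))) =
            LaurentPolynomial.invert (Polynomial.toLaurent (coeff n (z * J))) := by
          simp only [ψ, coeff_map]; rfl
        rw [this, LaurentPolynomial.invert_apply]
        exact AC_toLaurent_coeff _ 2
      rw [e6, eJ, hz, hG]
      simp only [← map_pow, map_add, coeff_C_mul, coeff_map, Polynomial.coeff_add]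
      have e7 : (coeff n (PowerSeries.C (Polynomial.X : Polynomial F))).coeff 2 = 0 := by
        rw [PowerSeries.coeff_C]
        split_ifs <;> simp [Polynomial.coeff_X]
      rw [e7, Polynomial.coeff_X_pow_mul', Polynomial.coeff_X_pow_mul']
      simp
    rw [hZ, map_sub, AddMonoidAlgebra.coeff_sub, Finsupp.sub_apply, e4, e5, sub_zero]
  refine ⟨Q.map Polynomial.toLaurent,
    Q.map Polynomial.toLaurent * Polynomial.C (T (-2)) * P.map LaurentPolynomial.C +
      Polynomial.X ^ K * a'.map LaurentPolynomial.C,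
    PowerSeries.C (T (-2)) * ι (P : PowerSeries F) + X ^ K * Z, ?_, ?_, ?_⟩
  · rw [Polynomial.coe_add, Polynomial.coe_mul, Polynomial.coe_mul, Polynomial.coe_mul, ← hιP,
      ← hιP, ← hφQ, ← hQZ]
    simp
    ring
  · rw [Polynomial.coeff_map]
    have : Q.coeff 0 = Polynomial.X * Polynomial.C (a'.coeff 0) := by
      rw [← Polynomial.coeff_coe, hQ, PowerSeries.coeff_zero_eq_constantCoeff_apply, map_mul, hcV, hz, hG,
        map_sub, AC_constantCoeff_map, hg]
      simp
    rw [this, map_mul, Polynomial.toLaurent_X, Polynomial.toLaurent_C]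
    exact (isUnit_T 1).mul ((isUnit_iff_ne_zero.mpr ha).map LaurentPolynomial.C)
  · intro n
    rw [hf, map_add, map_add (coeff n), AddMonoidAlgebra.coeff_add, Finsupp.add_apply]
    congr 1
    · rw [coeff_C_mul, coeff_map, T_mul, ← LaurentPolynomial.single_eq_C_mul_T,
        AddMonoidAlgebra.coeff_single, Finsupp.single_eq_same]
    · rw [coeff_X_pow_mul', coeff_X_pow_mul']
      split_ifs
      · exact hZg _
      · simp


/-- Every `p`-automatic sequence over `F_q` is the letter-to-letter projection of a column of
a linear cellular automaton (without memory) on the alphabet `F_q^e`, begun from an initial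
condition eventually periodic in both directions. -/
theorem automatic_is_projection_of_column_of_memoryless_linear_CA
    (p : ℕ) (hp : p.Prime) (Fq : Type*) [Field Fq] [Fintype Fq] (hchar : CharP Fq p)
    (u : ℕ → Fq) (hu : IsKAutomatic p u) :
    ∃ (e l r : ℕ), 1 ≤ e ∧
      ∃ (L : ℤ → (Fin e → Fq) →ₗ[Fq] (Fin e → Fq)) (R : ℕ → ℤ → (Fin e → Fq)) (m₀ : ℤ)
        (π : (Fin e → Fq) → Fq),
        EventuallyPeriodicBoth (R 0) ∧
        (∀ (n : ℕ) (m : ℤ),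
          R (n + 1) m = ∑ j ∈ Finset.Icc (-(l : ℤ)) (r : ℤ), L j (R n (m + j))) ∧
        (∀ n, π (R n m₀) = u n) := by
  classical
  have hfact : Fact p.Prime := ⟨hp⟩
  obtain ⟨S, _, s₀, δ, ω, hω⟩ := hu
  obtain ⟨r, _, hr⟩ := FiniteField.card Fq p
  have hq0 : Fintype.card Fq ≠ 0 := Fintype.card_ne_zero
  obtain ⟨N, a, ha, hsum⟩ := AC_ore p hp.one_lt δ ω s₀ r (Fintype.card Fq) hq0 hr
  obtain ⟨M, b, hb, hsum2⟩ := AC_lower _ hq0 _ N a ha hsum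
  have hsum3 : ∑ i ∈ Finset.range (M + 1), (b i : PowerSeries Fq) *
      (PowerSeries.mk fun n => ω ((Nat.digits p n).foldl δ s₀)) ^ (Fintype.card Fq ^ i) = 0 := by
    rw [← hsum2]
    refine Finset.sum_congr rfl fun i _ => ?_
    rw [AC_pow_card i _ (pow_ne_zero i hq0)]
  obtain ⟨K, P, a', g, V, B, Q, h1, h2, h3, h4, h5, h6⟩ :=
    AC_alg p r (Fintype.card Fq) r.ne_zero hr _ M b hb hsum3
  obtain ⟨Q', N', Z, hZ, hunit, hcoeff⟩ := AC_rational _ K P a' g V B Q h1 h2 h3 h4 h5 h6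
  obtain ⟨K', C, hK', hrec⟩ := AC_rec Q' N' Z hZ hunit
  refine AC_column u (fun n => Z.coeff n) K' hK' C hrec (-2) fun n => ?_
  rw [hcoeff, PowerSeries.coeff_mk, hω]
end

section
/- Let p be a prime and F_q a finite field of characteristic p. If u : ℕ → F_q is a p-automatic sequence, then there exist a finite set B, an injection ι : F_q → B, radii l, r ≥ 0, a local rule φ : B^{l+r+1} → B, an initial configuration R_0 : ℤ → B eventually periodic in both directions, and a column index m₀ ∈ ℤ, such that the spacetime diagram defined by R_{n+1}(m) = φ(R_n(m−l), R_n(m−l+1), …, R_n(m+r)) satisfies R_n(m₀) = ι(u(n)) for all n ≥ 0. That is, every p-automatic sequence occurs (after identifying F_q with a subset of B) as a column of a cellular automaton without memory whose initial condition is eventually periodic in both directions. -/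
namespace ColumnCA

/-- The data carried by a cell of nonnegative index: outgoing stream, incoming stream, clock
and three flags locating the reflecting wall. -/
abbrev Cell (p : ℕ) (W : Type) : Type := W × W × ZMod p × Bool × Bool × Bool

/-- The alphabet: dead cells, output cells and working cells. -/
abbrev Alph (p : ℕ) (W A : Type) : Type := Option A ⊕ Cell p W

/-- The content of the working cell `k` at time `t`. -/
def cell (p : ℕ) {W : Type} (V : ℕ → W) (t k : ℕ) : Cell p W :=
  (V (t - k), (if k + (t + k) / p ≤ t then V ((t + k) / p) else V 0), ((t + k : ℕ) : ZMod p),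
    decide (k + (t + k) / p ≤ t), decide (k + (t + k) / p ≤ t + 1),
    decide (k + (t + k) / p ≤ t + 2))

/-- The spacetime diagram, in closed form. -/
def conf (p : ℕ) {W A : Type} (V : ℕ → W) (out : W → A) (t : ℕ) : ℤ → Alph p W A
  | Int.ofNat k => Sum.inr (cell p V t k)
  | Int.negSucc 0 => Sum.inl (some (out (V (t - 2))))
  | Int.negSucc (_ + 1) => Sum.inl none

/-- Update of the cell 0, from its content and that of its right neighbour. -/
def step0 (p : ℕ) {W : Type} (Δ : W → ℕ → W) (x y : Cell p W) : Cell p W :=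
  (Δ y.2.1 (x.2.2.1 + 1).val, y.2.1, x.2.2.1 + 1, true, true, true)

/-- Update of a cell of positive index. -/
def step (p : ℕ) {W : Type} (w0 : W) (w x y : Cell p W) : Cell p W :=
  (w.1,
    (if y.2.2.2.1 then y.2.1 else if y.2.2.2.2.1 then x.1 else if y.2.2.2.2.2 then w.1 else w0),
    x.2.2.1 + 1,
    y.2.2.2.2.2,
    (if (w.2.2.1.val + 2) / p = 0 then w.2.2.2.2.1 else w.2.2.2.1),
    (if (w.2.2.1.val + 2) / p = 0 then w.2.2.2.2.2 else w.2.2.2.2.1))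

/-- The local rule. -/
def rule (p : ℕ) {W A : Type} (Δ : W → ℕ → W) (w0 : W) (out : W → A) :
    Alph p W A → Alph p W A → Alph p W A → Alph p W A → Alph p W A
  | Sum.inr w, Sum.inr x, Sum.inr y, _ => Sum.inr (step p w0 w x y)
  | Sum.inl _, Sum.inr x, Sum.inr y, _ => Sum.inr (step0 p Δ x y)
  | _, Sum.inl (some _), _, Sum.inr z => Sum.inl (some (out z.1))
  | _, o, _, _ => o

theorem step0_cell (p : ℕ) (hp : 2 ≤ p) {W : Type} (V : ℕ → W) (Δ : W → ℕ → W)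
    (hV : ∀ n, 0 < n → V n = Δ (V (n / p)) (n % p)) (t : ℕ) (ht : 2 ≤ t) :
    cell p V (t + 1) 0 = step0 p Δ (cell p V t 0) (cell p V t 1) := by
  have h1 : (t + 1) / p ≤ (t + 1) / 2 := Nat.div_le_div_left hp (by norm_num)
  have h2 : 1 + (t + 1) / p ≤ t := by omega
  have h3 : (t + 1) / p ≤ t + 1 := by omega
  have h4 : (t + 1) / p ≤ t + 1 + 1 := by omega
  have h5 : (t + 1) / p ≤ t + 1 + 2 := by omega
  have hc : ((t : ZMod p) + 1).val = (t + 1) % p := by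
    rw [← Nat.cast_one, ← Nat.cast_add, ZMod.val_natCast]
  simp [cell, step0, h2, h3, h4, h5, hc, ← hV (t + 1) (by omega)]

theorem step_cell (p : ℕ) (hp : 2 ≤ p) {W : Type} (V : ℕ → W) (t k : ℕ) :
    cell p V (t + 1) (k + 1) =
      step p (V 0) (cell p V t k) (cell p V t (k + 1)) (cell p V t (k + 2)) := by
  have e1 : t + 1 + (k + 1) = t + k + 2 := by ring
  have e2 : t + (k + 2) = t + k + 2 := by ring
  have hc : (t + k + 2) / p = (t + k) / p + ((t + k) % p + 2) / p := by
    conv_lhs => rw [← Nat.div_add_mod (t + k) p, add_assoc]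
    rw [Nat.mul_add_div (by omega)]
  have hr : (t + k) % p < p := Nat.mod_lt _ (by omega)
  have hle : ((t + k) % p + 2) / p ≤ 1 := by
    have : ((t + k) % p + 2) / p < 2 := by
      rw [Nat.div_lt_iff_lt_mul (by omega)]; omega
    omega
  simp only [cell, step, ZMod.val_natCast, e1, e2]
  generalize ((t + k) % p + 2) / p = c at *
  generalize hq : (t + k + 2) / p = q at *
  generalize (t + k) / p = q' at *
  subst hc
  refine Prod.ext ?_ (Prod.ext ?_ (Prod.ext ?_ (Prod.ext ?_ (Prod.ext ?_ ?_))))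
  · show V _ = V _
    congr 1; omega
  · simp only [decide_eq_true_eq]
    split_ifs <;> first | rfl | omega | (congr 1; omega)
  · push_cast; ring
  · simp only [decide_eq_decide]; omega
  · simp only
    split_ifs <;> simp only [decide_eq_decide] <;> omega
  · simp only
    split_ifs <;> simp only [decide_eq_decide] <;> omega

theorem conf_step (p : ℕ) (hp : 2 ≤ p) {W A : Type} (V : ℕ → W) (Δ : W → ℕ → W) (out : W → A)
    (hV : ∀ n, 0 < n → V n = Δ (V (n / p)) (n % p)) (t : ℕ) (ht : 2 ≤ t) (m : ℤ) :
    conf p V out (t + 1) m = rule p Δ (V 0) out (conf p V out t (m - 1)) (conf p V out t m)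
      (conf p V out t (m + 1)) (conf p V out t (m + 2)) := by
  rcases m with k | k
  · rcases k with _ | k
    · have e1 : (Int.ofNat 0) - 1 = Int.negSucc 0 := rfl
      have e2 : (Int.ofNat 0) + 1 = Int.ofNat 1 := rfl
      rw [e1, e2]
      simp only [conf, rule]
      rw [step0_cell p hp V Δ hV t ht]
    · have e1 : (Int.ofNat (k + 1)) - 1 = Int.ofNat k := by simp
      have e2 : (Int.ofNat (k + 1)) + 1 = Int.ofNat (k + 2) := rfl
      rw [e1, e2]
      simp only [conf, rule]
      rw [step_cell p hp V t k]
  · rcases k with _ | k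
    · have e1 : (Int.negSucc 0) + 2 = Int.ofNat 1 := rfl
      rw [e1]
      have e2 : t + 1 - 2 = t - 1 := by omega
      simp only [conf, rule, cell, e2]
    · have e0 : conf p V out t (Int.negSucc (k + 1)) = Sum.inl none := rfl
      rw [e0]
      show Sum.inl none = _
      cases conf p V out t (Int.negSucc (k + 1) - 1) <;>
        cases conf p V out t (Int.negSucc (k + 1) + 1) <;> rfl

theorem conf_periodic (p : ℕ) (hp : 2 ≤ p) {W A : Type} (V : ℕ → W) (out : W → A) :
    EventuallyPeriodicBoth (conf p V out 2) := by
  refine ⟨5, p, by omega, ?_, ?_⟩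
  · intro m hm
    obtain ⟨k, rfl⟩ := Int.eq_ofNat_of_zero_le (show 0 ≤ m by omega)
    have hk : 5 ≤ k := by omega
    show Sum.inr (cell p V 2 (k + p)) = Sum.inr (cell p V 2 k)
    congr 1
    have key : ∀ j, 5 ≤ j → cell p V 2 j
        = (V 0, V 0, ((2 + j : ℕ) : ZMod p), false, false, false) := by
      intro j hj
      have h0 : 2 - j = 0 := by omega
      have h1 : ¬ (j + (2 + j) / p ≤ 2) :=
        fun hh => absurd (le_trans (Nat.le_add_right _ _) hh) (by omega)
      have h2 : ¬ (j + (2 + j) / p ≤ 2 + 1) :=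
        fun hh => absurd (le_trans (Nat.le_add_right _ _) hh) (by omega)
      have h3 : ¬ (j + (2 + j) / p ≤ 2 + 2) :=
        fun hh => absurd (le_trans (Nat.le_add_right _ _) hh) (by omega)
      simp only [cell, h0, h1, h2, h3, if_false, decide_false]
    rw [key _ hk, key _ (by omega)]
    simp
  · intro m hm
    have key : ∀ j : ℤ, j ≤ -2 → conf p V out 2 j = Sum.inl none := by
      intro j hj
      rcases j with k | k
      · have : (0 : ℤ) ≤ Int.ofNat k := Int.natCast_nonneg k
        omega
      · rcases k with _ | k
        · exact absurd hj (by decide)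
        · rfl
    rw [key _ (by push_cast at hm; omega), key _ (by push_cast at hm; omega)]

end ColumnCA

/-- Every `p`-automatic sequence over `F_q` occurs (after injecting `F_q` into a finite
alphabet `B`) as a column of a cellular automaton without memory whose initial condition is
eventually periodic in both directions. -/
theorem automatic_is_column_of_memoryless_CA
    (p : ℕ) (hp : p.Prime) (Fq : Type*) [Field Fq] [Fintype Fq] (hchar : CharP Fq p)
    (u : ℕ → Fq) (hu : IsKAutomatic p u) :
    ∃ (B : Type) (_ : Fintype B) (ι : Fq → B), Function.Injective ι ∧
      ∃ (l r : ℕ) (φ : (Fin (l + r + 1) → B) → B) (R : ℕ → ℤ → B) (m₀ : ℤ),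
        EventuallyPeriodicBoth (R 0) ∧
        (∀ (n : ℕ) (m : ℤ),
          R (n + 1) m = φ (fun k => R n (m - (l : ℤ) + (k : ℕ)))) ∧
        (∀ n, R n m₀ = ι (u n)) := by
  classical
  have hp2 : 2 ≤ p := hp.two_le
  have : NeZero p := ⟨by omega⟩
  obtain ⟨S, hS, s₀, δ, ω, h⟩ := hu
  let A : Type := Fin (Fintype.card Fq)
  let e : Fq ≃ A := Fintype.equivFin Fq
  let W : Type := S → A
  let V : ℕ → W := fun n s => e (ω ((Nat.digits p n).foldl δ s))
  let Δ : W → ℕ → W := fun v d s => v (δ s d)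
  let out : W → A := fun v => v s₀
  have hV : ∀ n, 0 < n → V n = Δ (V (n / p)) (n % p) := by
    intro n hn
    funext s
    simp only [V, Δ]
    rw [Nat.digits_def' (by omega) hn, List.foldl_cons]
  refine ⟨ColumnCA.Alph p W A, inferInstance, fun a => Sum.inl (some (e a)), ?_, 1, 2,
    fun f => ColumnCA.rule p Δ (V 0) out (f 0) (f 1) (f 2) (f 3),
    fun n => ColumnCA.conf p V out (n + 2), -1, ?_, ?_, ?_⟩
  · intro a b hab
    simpa using hab
  · exact ColumnCA.conf_periodic p hp2 V out
  · intro n m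
    have := ColumnCA.conf_step p hp2 V Δ out hV (n + 2) (by omega) m
    show ColumnCA.conf p V out (n + 2 + 1) m = _
    rw [this]
    have h0 : m - ((1 : ℕ) : ℤ) + (((0 : Fin (1 + 2 + 1)) : ℕ) : ℤ) = m - 1 := by simp
    have h1 : m - ((1 : ℕ) : ℤ) + (((1 : Fin (1 + 2 + 1)) : ℕ) : ℤ) = m := by simp
    have h2 : m - ((1 : ℕ) : ℤ) + (((2 : Fin (1 + 2 + 1)) : ℕ) : ℤ) = m + 1 := by
      show m - ((1 : ℕ) : ℤ) + ((2 : ℕ) : ℤ) = m + 1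
      push_cast; ring
    have h3 : m - ((1 : ℕ) : ℤ) + (((3 : Fin (1 + 2 + 1)) : ℕ) : ℤ) = m + 2 := by
      show m - ((1 : ℕ) : ℤ) + ((3 : ℕ) : ℤ) = m + 2
      push_cast; ring
    simp only [h0, h1, h2, h3]
  · intro n
    show Sum.inl (some (out (V (n + 2 - 2)))) = Sum.inl (some (e (u n)))
    rw [Nat.add_sub_cancel, h n]
end

section
/- Let p be a prime and F_q a finite field of characteristic p. Suppose F = Σ_{n≥0} c_n t^n ∈ F_q[[t]] is algebraic over F_q(t). Then there exist r* ≥ 0, m ≥ 0, polynomials A*_0, A*_1, …, A*_m, B* ∈ F_q[t] with A*_0 not divisible by t (equivalently A*_0(0) ≠ 0), a polynomial R* ∈ F_q[t], and a power series G* ∈ F_q[[t]] such that F = R* + t^{r*}·G* and A*_0(t)·G* + A*_1(t)·(G*)^p + ⋯ + A*_m(t)·(G*)^{p^m} + B*(t) = 0 in F_q[[t]]. -/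
open PowerSeries

theorem aux_dep (p : ℕ) (R L : Type*) [CommRing R] [IsDomain R] [Field L]
    [Algebra R L] [FaithfulSMul R L] (x : L) (halg : IsAlgebraic R x) :
    ¬ LinearIndependent R (fun i : ℕ => x ^ (p ^ i)) := by
  intro h1
  let _ := FractionRing.liftAlgebra R L
  rw [LinearIndependent.iff_fractionRing (R := R) (K := FractionRing R)] at h1
  have h2 : IsAlgebraic (FractionRing R) x :=
    halg.extendScalars (IsFractionRing.injective R (FractionRing R))
  have h3 := h2.isIntegral.fg_adjoin_singleton
  let S := Algebra.adjoin (FractionRing R) {x}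
  have : Module.Finite (FractionRing R) S := .of_fg h3
  have hx : x ∈ S := Algebra.subset_adjoin rfl
  have h4 : LinearIndependent (FractionRing R) (fun i : ℕ => (⟨x, hx⟩ : S) ^ (p ^ i)) := by
    apply LinearIndependent.of_comp S.val.toLinearMap
    have e : (S.val.toLinearMap ∘ fun i : ℕ => (⟨x, hx⟩ : S) ^ (p ^ i))
        = fun i : ℕ => x ^ (p ^ i) := by
      funext i
      simp
    rw [e]
    exact h1
  have := h4.finite
  exact not_finite ℕ

theorem aux_step1 (p : ℕ) (Fq : Type*) [Field Fq] (F : PowerSeries Fq)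
    (halg : IsAlgebraic (Polynomial Fq) F) :
    ∃ (m : ℕ) (A : ℕ → Polynomial Fq), (∃ i < m + 1, A i ≠ 0) ∧
      ∑ i ∈ Finset.range (m + 1), ((A i : PowerSeries Fq) * F ^ (p ^ i)) = 0 := by
  have hinj : Function.Injective (algebraMap (PowerSeries Fq) (FractionRing (PowerSeries Fq))) :=
    IsFractionRing.injective _ _
  have hinj0 : Function.Injective (algebraMap (Polynomial Fq) (PowerSeries Fq)) := by
    intro a b h
    simpa [PowerSeries.algebraMap_apply'] using h
  have : FaithfulSMul (Polynomial Fq) (FractionRing (PowerSeries Fq)) := by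
    rw [faithfulSMul_iff_algebraMap_injective,
      IsScalarTower.algebraMap_eq (Polynomial Fq) (PowerSeries Fq) (FractionRing (PowerSeries Fq))]
    exact hinj.comp hinj0
  have hnot : ¬ LinearIndependent (Polynomial Fq) (fun i : ℕ => F ^ (p ^ i)) := by
    intro hli
    apply aux_dep p (Polynomial Fq) (FractionRing (PowerSeries Fq)) (algebraMap _ _ F)
      halg.algebraMap
    have := hli.map_injOn
        (IsScalarTower.toAlgHom (Polynomial Fq) (PowerSeries Fq)
          (FractionRing (PowerSeries Fq))).toLinearMap
        (hinj.injOn)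
    have e : (fun i : ℕ => (algebraMap (PowerSeries Fq) (FractionRing (PowerSeries Fq)) F) ^ (p ^ i))
        = (IsScalarTower.toAlgHom (Polynomial Fq) (PowerSeries Fq)
          (FractionRing (PowerSeries Fq))).toLinearMap ∘ fun i : ℕ => F ^ (p ^ i) := by
      funext i
      simp
    rw [e]
    exact this
  rw [linearIndependent_iff'] at hnot
  push Not at hnot
  obtain ⟨s, g, hs, i, his, hgi⟩ := hnot
  classical
  refine ⟨s.sup id, fun i => if i ∈ s then g i else 0, ⟨i, ?_, ?_⟩, ?_⟩
  · exact Nat.lt_succ_of_le (Finset.le_sup (f := id) his)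
  · simpa [his] using hgi
  · rw [← hs, ← Finset.sum_subset (s₁ := s)]
    · refine Finset.sum_congr rfl fun j hj => ?_
      simp only [hj, if_true]
      rw [Algebra.smul_def]
      simp [PowerSeries.algebraMap_apply']
    · intro j hj
      exact Finset.mem_range.2 (Nat.lt_succ_of_le (Finset.le_sup (f := id) hj))
    · intro j _ hj
      simp [hj]

theorem aux_root (p : ℕ) (hp : p.Prime) (Fq : Type*) [Field Fq] [Fintype Fq] [CharP Fq p]
    (f : Polynomial Fq) (hf : Polynomial.derivative f = 0) : ∃ g : Polynomial Fq, g ^ p = f := by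
  have := Fact.mk hp
  have : ExpChar Fq p := ExpChar.prime hp
  refine ⟨(Polynomial.contract p f).map (frobeniusEquiv Fq p).symm.toRingHom, ?_⟩
  rw [← Polynomial.map_frobenius_expand, ← Polynomial.map_expand, Polynomial.map_map,
    Polynomial.expand_contract p hf hp.ne_zero]
  have : (frobenius Fq p).comp (frobeniusEquiv Fq p).symm.toRingHom = RingHom.id Fq := by
    refine RingHom.ext fun x => ?_
    simp
  rw [this, Polynomial.map_id]

theorem aux_step2 (p : ℕ) (hp : p.Prime) (Fq : Type*) [Field Fq] [Fintype Fq] [CharP Fq p]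
    (F : PowerSeries Fq) (m : ℕ) : ∀ (D : ℕ) (A : ℕ → Polynomial Fq), (∃ i < m + 1, A i ≠ 0) →
      (∀ i < m + 1, (A i).natDegree ≤ D) →
      ∑ i ∈ Finset.range (m + 1), ((A i : PowerSeries Fq) * F ^ (p ^ i)) = 0 →
    ∃ (m : ℕ) (A : ℕ → Polynomial Fq), A 0 ≠ 0 ∧
      ∑ i ∈ Finset.range (m + 1), ((A i : PowerSeries Fq) * F ^ (p ^ i)) = 0 := by
  have := Fact.mk hp
  have hc : CharP (PowerSeries Fq) p :=
    charP_of_injective_ringHom (f := PowerSeries.C (R := Fq)) PowerSeries.C_injective p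
  have : ExpChar (PowerSeries Fq) p := ExpChar.prime hp
  induction m with
  | zero =>
    intro D A ⟨i, hi, hA⟩ _ hs
    obtain rfl : i = 0 := by omega
    exact ⟨0, A, hA, hs⟩
  | succ m ihm =>
    intro D
    induction D using Nat.strong_induction_on with
    | _ D ihD =>
      intro A hA hD hs
      by_cases h0 : A 0 = 0
      swap
      · exact ⟨_, A, h0, hs⟩
      by_cases hd : ∀ i < m + 1 + 1, Polynomial.derivative (A i) = 0
      · have hroot : ∀ i, ∃ g : Polynomial Fq, i < m + 1 → g ^ p = A (i + 1) := by
          intro i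
          by_cases hi : i < m + 1
          · obtain ⟨g, hg⟩ := aux_root p hp Fq (A (i + 1)) (hd _ (by omega))
            exact ⟨g, fun _ => hg⟩
          · exact ⟨0, fun h => absurd h hi⟩
        choose C hC using hroot
        refine ihm ((Finset.range (m + 1)).sup fun i => (C i).natDegree) C ?_ ?_ ?_
        · obtain ⟨i, hi, hAi⟩ := hA
          obtain _ | j := i
          · exact absurd h0 hAi
          · refine ⟨j, by omega, fun h => hAi ?_⟩
            rw [← hC j (by omega), h, zero_pow hp.ne_zero]
        · intro i hi
          exact Finset.le_sup (f := fun i => (C i).natDegree) (Finset.mem_range.2 hi)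
        · refine eq_zero_of_pow_eq_zero (n := p) ?_
          rw [sum_pow_char p]
          rw [Finset.sum_range_succ', h0] at hs
          simp only [Polynomial.coe_zero, zero_mul, add_zero] at hs
          rw [← hs]
          refine Finset.sum_congr rfl fun i hi => ?_
          rw [← hC i (Finset.mem_range.1 hi), mul_pow, ← pow_mul, pow_succ, Polynomial.coe_pow]
      · push Not at hd
        have hD0 : D ≠ 0 := by
          rintro rfl
          obtain ⟨i, hi, h⟩ := hd
          exact h (Polynomial.derivative_of_natDegree_zero (Nat.le_zero.1 (hD i hi)))
        refine ihD (D - 1) (by omega) (fun i => Polynomial.derivative (A i)) hd ?_ ?_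
        · intro i hi
          have := hD i hi
          have := Polynomial.natDegree_derivative_le (A i)
          omega
        · have h := congrArg (PowerSeries.derivative Fq) hs
          rw [map_sum, map_zero] at h
          rw [← h]
          refine Finset.sum_congr rfl fun i hi => ?_
          obtain _ | j := i
          · simp [h0]
          · rw [Derivation.leibniz, PowerSeries.derivative_pow, PowerSeries.derivative_coe]
            have : ((p ^ (j + 1) : ℕ) : PowerSeries Fq) = 0 := by
              rw [Nat.cast_pow, CharP.cast_eq_zero, zero_pow (by omega)]
            rw [this]
            simp [mul_comm]

theorem exists_polynomial_relation_with_unit_linear_coeff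
    (p : ℕ) (hp : p.Prime) (Fq : Type*) [Field Fq] [Fintype Fq] (hchar : CharP Fq p)
    (c : ℕ → Fq) (halg : IsAlgebraic (Polynomial Fq) (PowerSeries.mk c)) :
    ∃ (rs m : ℕ) (A : ℕ → Polynomial Fq) (B Rs : Polynomial Fq) (G : PowerSeries Fq),
      (A 0).coeff 0 ≠ 0 ∧
      (PowerSeries.mk c = (Rs : PowerSeries Fq) + (PowerSeries.X : PowerSeries Fq) ^ rs * G) ∧
      (∑ i ∈ Finset.range (m + 1), ((A i : PowerSeries Fq) * G ^ (p ^ i)))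
        + (B : PowerSeries Fq) = 0 := by
  have := Fact.mk hp
  have hc : CharP (PowerSeries Fq) p :=
    charP_of_injective_ringHom (f := PowerSeries.C (R := Fq)) PowerSeries.C_injective p
  have : ExpChar (PowerSeries Fq) p := ExpChar.prime hp
  generalize PowerSeries.mk c = F at halg
  obtain ⟨m, A, hA, hs⟩ := aux_step1 p Fq F halg
  obtain ⟨m, A, hA, hs⟩ := aux_step2 p hp Fq F m
    ((Finset.range (m + 1)).sup fun i => (A i).natDegree) A hA
    (fun i hi => Finset.le_sup (f := fun i => (A i).natDegree) (Finset.mem_range.2 hi)) hs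
  obtain ⟨u, hu, hud⟩ := Polynomial.exists_eq_pow_rootMultiplicity_mul_and_not_dvd (A 0) hA 0
  generalize Polynomial.rootMultiplicity 0 (A 0) = s at hu
  rw [Polynomial.C_0, sub_zero] at hu hud
  obtain ⟨R, G, hF⟩ : ∃ (R : Polynomial Fq) (G : PowerSeries Fq),
      F = (R : PowerSeries Fq) + PowerSeries.X ^ s * G :=
    ⟨_, _, (PowerSeries.eq_X_pow_mul_shift_add_trunc s F).trans (add_comm _ _)⟩
  have hdiv : ∀ i, ∃ C : Polynomial Fq,
      A i * Polynomial.X ^ (s * p ^ i) = Polynomial.X ^ (2 * s) * C := by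
    intro i
    obtain _ | j := i
    · exact ⟨u, by rw [hu]; ring⟩
    · refine Dvd.dvd.mul_left (pow_dvd_pow _ ?_) _
      rw [mul_comm]
      refine Nat.mul_le_mul_left s ?_
      exact hp.two_le.trans (Nat.le_self_pow (by omega) p)
  choose C hC using hdiv
  have hC0 : C 0 = u := by
    have h := hC 0
    rw [hu] at h
    refine mul_left_cancel₀ (pow_ne_zero (2 * s) Polynomial.X_ne_zero) (h.symm.trans ?_)
    ring
  have hCc : ∀ i, (A i : PowerSeries Fq) * PowerSeries.X ^ (s * p ^ i)
      = PowerSeries.X ^ (2 * s) * (C i : PowerSeries Fq) := by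
    intro i
    have h := congrArg (fun q : Polynomial Fq => (q : PowerSeries Fq)) (hC i)
    simpa using h
  have hsum : (PowerSeries.X : PowerSeries Fq) ^ (2 * s) *
      ∑ i ∈ Finset.range (m + 1), ((C i : PowerSeries Fq) * G ^ (p ^ i)) +
      ((∑ i ∈ Finset.range (m + 1), A i * R ^ (p ^ i) : Polynomial Fq) : PowerSeries Fq) = 0 := by
    rw [← hs, Finset.mul_sum, ← Polynomial.coeToPowerSeries.ringHom_apply, map_sum,
      ← Finset.sum_add_distrib]
    refine Finset.sum_congr rfl fun i _ => ?_
    rw [hF, add_pow_char_pow, mul_pow, ← pow_mul, mul_add, ← mul_assoc, ← mul_assoc, hCc,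
      Polynomial.coeToPowerSeries.ringHom_apply, Polynomial.coe_mul, Polynomial.coe_pow, add_comm]
  generalize (∑ i ∈ Finset.range (m + 1), A i * R ^ (p ^ i) : Polynomial Fq) = Q at hsum
  obtain ⟨B, rfl⟩ : Polynomial.X ^ (2 * s) ∣ Q := by
    rw [Polynomial.X_pow_dvd_iff]
    intro d hd
    rw [← Polynomial.coeff_coe, eq_neg_of_add_eq_zero_right hsum, ← mul_neg]
    exact (PowerSeries.X_pow_dvd_iff.1 (Dvd.intro _ rfl)) d hd
  refine ⟨s, m, C, B, R, G, ?_, hF, ?_⟩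
  · rw [hC0]
    rwa [Polynomial.X_dvd_iff] at hud
  · refine mul_left_cancel₀ (pow_ne_zero (2 * s) (PowerSeries.X_ne_zero (R := Fq))) ?_
    rw [mul_zero, mul_add, ← hsum]
    simp
end
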